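/- For all real numbers $x, y$ with $3 \le y \le \sqrt{x}$, the number of positive integers $n \le x$ having no prime factor $\le y$ is less than $0.6\, x/\log y$. -/

import Mathlib

section
open Finset
open scoped Classical

/-- `Phi x y` is the number of integers `n ∈ [1, x]` having no prime factor `≤ y`. -/
noncomputable def Phi (x y : ℝ) : ℕ :=
  ((Finset.Icc 1 ⌊x⌋₊).filter (fun n => ∀ p : ℕ, p.Prime → p ∣ n → y < (p : ℝ))).card

end

/-- product of `n / gcd(K+1, n)` over `n ∈ [a, a+2^k)` -/
def pt (k : ℕ) : ℕ → ℕ → ℕ :=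
  Nat.rec (fun K a => Nat.div a (Nat.gcd (Nat.succ (Nat.mod K a)) a))
    (fun k ih K a => Nat.mul (ih K a) (ih K (Nat.add a (Nat.pow 2 k)))) k
/-- evaluate `n` (assumed positive) and pass its predecessor -/
def force (n : ℕ) (f : ℕ → Bool) : Bool := Nat.rec false (fun k _ => f k) n
def lv (k : ℕ) (La : ℕ) (cont : ℕ → Bool) (f : ℕ) : ℕ → ℕ → Bool :=
  Nat.rec (fun L _ => cont L) (fun _ ih L a =>
   and (Nat.ble (Nat.pow 2 (Nat.succ (Nat.div (Nat.mul 14182 (Nat.add a (Nat.pow 2 k))) 10000))) L)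
    (force (Nat.mul (Nat.succ L) (pt k La a)) fun L' =>
      and (Nat.ble (Nat.succ L') (Nat.pow 2 (Nat.div (Nat.mul 14664 a) 10000)))
        (ih L' (Nat.add a (Nat.pow 2 k))))) f
def lvls (j : ℕ) : ℕ → ℕ → Bool :=
  Nat.rec (fun _ _ => true) (fun _ ih k L =>
    lv k L (fun L' => ih (Nat.succ k) L') 256 L (Nat.succ (Nat.pow 2 (Nat.add k 8)))) j
def sm (f : ℕ) : ℕ → ℕ → Bool :=
  Nat.rec (fun L _ => lvls 9 3 L) (fun _ ih L a =>
    force (Nat.mul (Nat.succ L) (pt 0 L a)) fun L' =>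
      and (Nat.ble (Nat.pow (Nat.succ L') 8) (Nat.pow 2 (Nat.add (Nat.div (Nat.mul 117312 a) 10000) 46)))
      (and (Nat.ble (Nat.pow 2 (Nat.succ (Nat.div (Nat.mul 113456 (Nat.succ a)) 10000)))
          (Nat.mul (Nat.pow (Nat.succ L') 8) (Nat.pow 2 92)))
        (ih L' (Nat.succ a)))) f

open Chebyshev Nat in
theorem fac_log {a m : ℕ} (h1 : a < m) (h2 : m ≤ 2 * a) :
    ArithmeticFunction.vonMangoldt m = Real.log ((m / Nat.gcd (lcmUpto a) m : ℕ) : ℝ) := by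
  have ha : 0 < a := by omega
  have hm : m ≠ 0 := by omega
  have hdvd : ∀ u, 0 < u → u ≤ a → u ∣ lcmUpto a := by
    intro u hu hua
    exact Finset.dvd_lcm (f := id) (Finset.mem_Icc.2 ⟨hu, hua⟩)
  by_cases hp : IsPrimePow m
  · obtain ⟨p, k, hpp, hk, rfl⟩ := (isPrimePow_nat_iff m).1 hp
    rw [ArithmeticFunction.vonMangoldt_apply_pow hk.ne', ArithmeticFunction.vonMangoldt_apply_prime hpp]
    obtain ⟨j, rfl⟩ : ∃ j, k = j + 1 := ⟨k - 1, by omega⟩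
    have hj : p ^ j ≤ a := by
      have := hpp.two_le
      have : 2 * p ^ j ≤ p ^ (j+1) := by rw [pow_succ, mul_comm]; exact Nat.mul_le_mul_left _ this
      omega
    have hg : Nat.gcd (lcmUpto a) (p ^ (j+1)) = p ^ j := by
      apply Nat.dvd_antisymm
      · obtain ⟨i, hi, he⟩ := (Nat.dvd_prime_pow hpp).1 (Nat.gcd_dvd_right (lcmUpto a) (p ^ (j+1)))
        rw [he]
        rcases Nat.lt_or_ge i (j+1) with h | h
        · exact pow_dvd_pow _ (by omega)
        · exfalso
          have : i = j + 1 := by omega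
          subst this
          have hd : p ^ (j+1) ∣ lcmUpto a := he ▸ Nat.gcd_dvd_left _ _
          have := (hpp.pow_dvd_iff_le_factorization (lcmUpto_ne_zero a)).1 hd
          rw [factorization_lcmUpto a hpp] at this
          have := Nat.pow_le_of_le_log ha.ne' this
          omega
      · exact Nat.dvd_gcd (hdvd _ (pow_pos hpp.pos _) hj) (pow_dvd_pow _ (Nat.le_succ _))
    rw [hg, pow_succ, Nat.mul_div_cancel_left _ (pow_pos hpp.pos _)]
  · rw [ArithmeticFunction.vonMangoldt_eq_zero_iff.2 hp]
    have hm1 : m ≠ 1 := by omega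
    obtain ⟨p, hpp, hpm⟩ := Nat.exists_prime_and_dvd hm1
    obtain ⟨k, r, hr, hmr⟩ := Nat.exists_eq_pow_mul_and_not_dvd hm p hpp.ne_one
    have hk : k ≠ 0 := by
      rintro rfl; apply hr; simpa [hmr] using hpm
    have hr1 : r ≠ 1 := by
      rintro rfl
      apply hp
      rw [hmr, mul_one]
      exact (isPrimePow_nat_iff _).2 ⟨p, k, hpp, Nat.pos_of_ne_zero hk, rfl⟩
    have hr0 : r ≠ 0 := by rintro rfl; simp at hr
    have hpk : 2 ≤ p ^ k := le_trans hpp.two_le (Nat.le_self_pow hk p)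
    have hr2 : 2 ≤ r := by omega
    have hd : m ∣ lcmUpto a := by
      rw [hmr]
      apply Nat.Coprime.mul_dvd_of_dvd_of_dvd
      · exact Nat.Coprime.pow_left _ ((Nat.Prime.coprime_iff_not_dvd hpp).2 hr)
      · exact hdvd _ (by omega) (by nlinarith)
      · exact hdvd _ (by omega) (by nlinarith)
    rw [Nat.gcd_eq_right hd, Nat.div_self (Nat.pos_of_ne_zero hm)]
    simp

open Chebyshev Nat in
theorem psi_succ' (n : ℕ) : Chebyshev.psi ((n+1 : ℕ) : ℝ) = psi (n : ℝ) + ArithmeticFunction.vonMangoldt (n+1) := by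
  unfold psi
  simp only [Nat.floor_natCast]
  exact Finset.sum_Ioc_succ_top (Nat.zero_le n) _

open Chebyshev Nat in
theorem lcm_step {a n : ℕ} (h1 : a ≤ n) (h2 : n + 1 ≤ 2 * a) :
    lcmUpto (n+1) = lcmUpto n * ((n+1) / Nat.gcd (lcmUpto a) (n+1)) := by
  have h := psi_succ' n
  rw [fac_log (a := a) (by omega) h2, psi_eq_log_lcmUpto, psi_eq_log_lcmUpto] at h
  have hq : 0 < (n+1) / Nat.gcd (lcmUpto a) (n+1) :=
    Nat.div_pos (Nat.gcd_le_right _ (Nat.succ_pos _)) (Nat.gcd_pos_of_pos_right _ (Nat.succ_pos _))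
  rw [← Real.log_mul (by exact_mod_cast lcmUpto_ne_zero n) (by exact_mod_cast hq.ne')] at h
  have := Real.log_injOn_pos (by simpa using lcmUpto_pos (n+1)) (by
    simp only [Set.mem_Ioi]; exact mul_pos (by exact_mod_cast lcmUpto_pos n) (by exact_mod_cast hq)) h
  exact_mod_cast this

theorem pt_zero (K a : ℕ) : pt 0 K a = a / Nat.gcd (K % a + 1) a := rfl
theorem pt_succ (k K a : ℕ) : pt (k+1) K a = pt k K a * pt k K (a + 2^k) := rfl

open Chebyshev Nat in
theorem pt_lcm (k : ℕ) : ∀ (K a n : ℕ), K + 1 = lcmUpto a → a ≤ n → n + 2^k ≤ 2 * a →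
    lcmUpto n * pt k K (n+1) = lcmUpto (n + 2^k) := by
  induction k with
  | zero =>
    intro K a n hK h1 h2
    rw [pow_zero, lcm_step h1 (by simpa using h2), pt_zero, ← hK]
    have : Nat.gcd (K % (n+1) + 1) (n+1) = Nat.gcd (K+1) (n+1) := by
      have h : (K % (n+1) + 1) ≡ K + 1 [MOD (n+1)] := (Nat.mod_modEq K (n+1)).add_right 1
      exact h.gcd_eq
    rw [this]
  | succ k ih =>
    intro K a n hK h1 h2
    rw [pow_succ] at h2
    rw [pt_succ, ← mul_assoc, ih K a n hK h1 (by omega)]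
    have := ih K a (n + 2^k) hK (by omega) (by omega)
    rw [show n + 1 + 2^k = n + 2^k + 1 by ring, this]
    congr 1
    ring

theorem force_spec {n : ℕ} {f : ℕ → Bool} (h : force n f = true) : ∃ k, n = k + 1 ∧ f k = true := by
  cases n with
  | zero => simp [force] at h
  | succ k => exact ⟨k, rfl, h⟩


def Good (m : ℕ) : Prop := Chebyshev.psi (m : ℝ) ≤ 1.0165 * m ∧ 0.983 * ((m : ℝ) + 1) ≤ Chebyshev.psi (m : ℝ)
def Fair (m : ℕ) : Prop := Chebyshev.psi (m : ℝ) ≤ 1.0165 * m + 4 ∧ 0.983 * ((m : ℝ) + 1) - 8 ≤ Chebyshev.psi (m : ℝ)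

theorem log_le_of_le_two_pow {L e : ℕ} (hL : 0 < L) (h : L ≤ 2 ^ e) : Real.log L ≤ e * Real.log 2 := by
  rw [← Real.log_pow]
  exact Real.log_le_log (by exact_mod_cast hL) (by exact_mod_cast h)

theorem le_log_of_two_pow_le {L e : ℕ} (h : 2 ^ e ≤ L) : e * Real.log 2 ≤ Real.log L := by
  rw [← Real.log_pow]
  exact Real.log_le_log (by positivity) (by exact_mod_cast h)

open Chebyshev Nat in
theorem good_block {n m K : ℕ} (h1 : n < m) (h2 : m ≤ n + K)
    (hlo : 2 ^ ((14182 * (n + 1 + K)) / 10000 + 1) ≤ lcmUpto n)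
    (hup : lcmUpto (n + K) ≤ 2 ^ ((14664 * (n+1)) / 10000)) : Good m := by
  have hl2 := Real.log_two_gt_d9
  have hl2' := Real.log_two_lt_d9
  constructor
  · have a1 : psi (m : ℝ) ≤ psi ((n + K : ℕ) : ℝ) := psi_mono (by exact_mod_cast h2)
    rw [psi_eq_log_lcmUpto (n+K)] at a1
    have a2 := log_le_of_le_two_pow (lcmUpto_pos _) hup
    have a3 : (((14664 * (n+1)) / 10000 : ℕ) : ℝ) ≤ 1.4664 * m := by
      have : ((14664 * (n+1)) / 10000) * 10000 ≤ 14664 * m :=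
        le_trans (Nat.div_mul_le_self _ _) (Nat.mul_le_mul_left _ h1)
      have : (((14664 * (n+1)) / 10000 : ℕ) : ℝ) * 10000 ≤ 14664 * m := by exact_mod_cast this
      linarith
    have hm : (0:ℝ) ≤ m := Nat.cast_nonneg _
    nlinarith
  · have a1 : psi (n : ℝ) ≤ psi (m : ℝ) := psi_mono (by exact_mod_cast h1.le)
    rw [psi_eq_log_lcmUpto n] at a1
    have a2 := le_log_of_two_pow_le hlo
    have a3 : 1.4182 * ((m:ℝ) + 1) ≤ (((14182 * (n + 1 + K)) / 10000 + 1 : ℕ) : ℝ) := by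
      have : 14182 * (m + 1) ≤ ((14182 * (n + 1 + K)) / 10000 + 1) * 10000 := by
        have := Nat.lt_div_mul_add (a := 14182 * (n + 1 + K)) (b := 10000) (by norm_num)
        have : 14182 * (m+1) ≤ 14182 * (n + 1 + K) := Nat.mul_le_mul_left _ (by omega)
        omega
      have : 14182 * ((m : ℝ) + 1) ≤ (((14182 * (n + 1 + K)) / 10000 + 1 : ℕ) : ℝ) * 10000 := by exact_mod_cast this
      linarith
    have hm : (0:ℝ) ≤ m := Nat.cast_nonneg _
    nlinarith

open Chebyshev Nat in
theorem fair_one {m : ℕ}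
    (hup : lcmUpto m ^ 8 ≤ 2 ^ ((117312 * m) / 10000 + 46))
    (hlo : 2 ^ ((113456 * (m + 1)) / 10000 + 1) ≤ lcmUpto m ^ 8 * 2 ^ 92) : Fair m := by
  generalize he1 : (117312 * m) / 10000 + 46 = e1 at hup
  generalize he2 : (113456 * (m + 1)) / 10000 + 1 = e2 at hlo
  have hl2 := Real.log_two_gt_d9
  have hl2' := Real.log_two_lt_d9
  have hm : (0:ℝ) ≤ m := Nat.cast_nonneg _
  have hp := lcmUpto_pos m
  unfold Fair
  rw [psi_eq_log_lcmUpto m]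
  constructor
  · have a2 := log_le_of_le_two_pow (pow_pos hp 8) hup
    rw [Nat.cast_pow, Real.log_pow] at a2
    have a3 : (e1 : ℝ) ≤ 11.7312 * m + 46 := by
      rw [← he1]
      have : (((117312 * m) / 10000 : ℕ) : ℝ) * 10000 ≤ 117312 * m := by exact_mod_cast Nat.div_mul_le_self _ _
      push_cast at *
      linarith
    push_cast at a2 a3
    nlinarith
  · have a2 := le_log_of_two_pow_le hlo
    rw [Nat.cast_mul, Nat.cast_pow, Nat.cast_pow, Real.log_mul (by positivity) (by positivity), Real.log_pow, Real.log_pow, Nat.cast_ofNat (R := ℝ) (n := 2)] at a2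
    have a3 : 11.3456 * ((m:ℝ) + 1) ≤ (e2 : ℝ) := by
      rw [← he2]
      have : 113456 * (m + 1) ≤ ((113456 * (m + 1)) / 10000 + 1) * 10000 := by
        have := Nat.lt_div_mul_add (a := 113456 * (m + 1)) (b := 10000) (by norm_num)
        omega
      have : 113456 * ((m : ℝ) + 1) ≤ (((113456 * (m + 1)) / 10000 + 1 : ℕ) : ℝ) * 10000 := by exact_mod_cast this
      linarith
    push_cast at a2 a3
    nlinarith

open Chebyshev Nat in
theorem lv_spec (k La A : ℕ) (cont : ℕ → Bool) (hLa : La + 1 = lcmUpto A) (f : ℕ) :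
    ∀ L n, L + 1 = lcmUpto n → A ≤ n → n + f * 2^k ≤ 2 * A → lv k La cont f L (n+1) = true →
    (∀ m, n < m → m ≤ n + f * 2^k → Good m) ∧ ∃ L', L' + 1 = lcmUpto (n + f * 2^k) ∧ cont L' = true := by
  induction f with
  | zero =>
    intro L n hL _ _ h
    exact ⟨fun m h1 h2 => by omega, L, by simpa using hL, h⟩
  | succ f ih =>
    intro L n hL hA h2 h
    have h' : ((Nat.ble (2 ^ (14182 * (n + 1 + 2^k) / 10000 + 1)) L) && (force ((L+1) * pt k La (n+1)) fun L' =>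
      (Nat.ble (L'+1) (2 ^ (14664 * (n+1) / 10000))) && (lv k La cont f L' (n + 1 + 2^k)))) = true := h
    rw [Bool.and_eq_true] at h'
    obtain ⟨hlo, hf⟩ := h'
    obtain ⟨L', hL', hf'⟩ := force_spec hf
    rw [Bool.and_eq_true] at hf'
    obtain ⟨hup, hrec⟩ := hf'
    have hlo := Nat.le_of_ble_eq_true hlo
    have hup := Nat.le_of_ble_eq_true hup
    have e : n + (f+1) * 2^k = n + 2^k + f * 2^k := by ring
    rw [e] at h2 ⊢
    have hstep := pt_lcm k La A n hLa hA (by omega)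
    rw [← hL, hL'] at hstep
    rw [show n + 1 + 2^k = n + 2^k + 1 by ring] at hrec
    obtain ⟨hg, hc⟩ := ih L' (n + 2^k) hstep (hA.trans (Nat.le_add_right _ _)) h2 hrec
    refine ⟨fun m h1 h2 => ?_, hc⟩
    rcases Nat.lt_or_ge (n + 2^k) m with h3 | h3
    · exact hg m h3 h2
    · exact good_block h1 h3 (by rw [← hL]; omega) (by rw [← hstep]; exact hup)

open Chebyshev Nat in
theorem lvls_spec (j : ℕ) : ∀ k L, L + 1 = lcmUpto (2^(k+8)) → lvls j k L = true →
    ∀ m, 2^(k+8) < m → m ≤ 2^(k+8+j) → Good m := by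
  induction j with
  | zero => intro k L _ _ m h1 h2; simp at h2; omega
  | succ j ih =>
    intro k L hL h m h1 h2
    have h' : lv k L (fun L' => lvls j (k+1) L') 256 L (2^(k+8) + 1) = true := h
    have e : 2^(k+8) + 256 * 2^k = 2^(k+1+8) := by ring
    obtain ⟨hg, L', hL', hc⟩ := lv_spec k L (2^(k+8)) _ hL 256 L (2^(k+8)) hL le_rfl (by rw [e]; ring_nf; rfl) h'
    rw [e] at hg hL'
    rcases Nat.lt_or_ge (2^(k+1+8)) m with h3 | h3
    · exact ih (k+1) L' hL' hc m h3 (by rwa [show k+1+8+j = k+8+(j+1) by ring])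
    · exact hg m h1 h3

open Chebyshev Nat in
theorem sm_spec (f : ℕ) : ∀ L n, L + 1 = lcmUpto n → 0 < n → n + f = 2048 → sm f L (n+1) = true →
    (∀ m, n < m → m ≤ 2048 → Fair m) ∧ ∃ L', L' + 1 = lcmUpto 2048 ∧ lvls 9 3 L' = true := by
  induction f with
  | zero =>
    intro L n hL _ hn h
    have : n = 2048 := by omega
    subst this
    exact ⟨fun m h1 h2 => by omega, L, hL, h⟩
  | succ f ih =>
    intro L n hL h0 hn h
    have h' : (force ((L+1) * pt 0 L (n+1)) fun L' =>
      (Nat.ble ((L'+1)^8) (2 ^ (117312 * (n+1) / 10000 + 46))) && ((Nat.ble (2 ^ (113456 * (n+1+1) / 10000 + 1)) ((L'+1)^8 * 2^92))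
        && sm f L' (n+1+1))) = true := h
    obtain ⟨L', hL', hf'⟩ := force_spec h'
    rw [Bool.and_eq_true, Bool.and_eq_true] at hf'
    obtain ⟨hup, hlo, hrec⟩ := hf'
    have hlo := Nat.le_of_ble_eq_true hlo
    have hup := Nat.le_of_ble_eq_true hup
    have hstep := pt_lcm 0 L n n hL le_rfl (by simp; omega)
    rw [← hL, hL', pow_zero] at hstep
    obtain ⟨hg, hc⟩ := ih L' (n + 1) hstep (by omega) (by omega) hrec
    refine ⟨fun m h1 h2 => ?_, hc⟩
    rcases Nat.lt_or_ge (n + 1) m with h3 | h3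
    · exact hg m h3 h2
    · have : m = n + 1 := by omega
      subst this
      exact fair_one (by rw [← hstep]; exact hup) (by rw [← hstep]; exact hlo)

set_option maxRecDepth 100000 in
theorem base_run : sm 2047 0 2 = true := by decide +kernel

theorem base_fair {m : ℕ} (h2 : m ≤ 2048) : Fair m := by
  rcases Nat.lt_or_ge 1 m with h | h
  · exact (sm_spec 2047 0 1 (by simp [Nat.lcmUpto]) one_pos rfl base_run).1 m h h2
  · unfold Fair
    rw [Chebyshev.psi_eq_zero_of_le_one (by exact_mod_cast h)]
    have : (m : ℝ) ≤ 1 := by exact_mod_cast h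
    have : (0:ℝ) ≤ m := Nat.cast_nonneg _
    constructor <;> norm_num <;> linarith

theorem base_good {m : ℕ} (h1 : 2048 < m) (h2 : m ≤ 2^20) : Good m := by
  obtain ⟨_, L, hL, hc⟩ := sm_spec 2047 0 1 (by simp [Nat.lcmUpto]) one_pos rfl base_run
  exact lvls_spec 9 3 L hL hc m h1 h2

theorem log_fact_eq (M : ℕ) : Real.log (M.factorial : ℝ) =
    ∑ n ∈ Finset.Ioc 0 M, ArithmeticFunction.vonMangoldt n * ((M / n : ℕ) : ℝ) := by
  have h := ArithmeticFunction.sum_Ioc_mul_zeta_eq_sum (ArithmeticFunction.vonMangoldt) M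
  rw [← h, ArithmeticFunction.vonMangoldt_mul_zeta]
  induction M with
  | zero => simp
  | succ n ih =>
    rw [Nat.factorial_succ, Nat.cast_mul, Real.log_mul (by positivity) (by positivity),
      Finset.sum_Ioc_succ_top (Nat.zero_le n), ih (ArithmeticFunction.sum_Ioc_mul_zeta_eq_sum _ n), ArithmeticFunction.log_apply]
    ring

theorem stir_nat_up {n : ℕ} (hn : n ≠ 0) :
    Real.log (n.factorial : ℝ) ≤ n * Real.log n - n + Real.log n / 2 + 1 := by
  have h1 := Stirling.log_stirlingSeq'_antitone (Nat.zero_le (n-1))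
  simp only [Function.comp, Nat.succ_eq_add_one] at h1
  rw [show n - 1 + 1 = n by omega, Stirling.log_stirlingSeq_formula, zero_add, Stirling.stirlingSeq_one] at h1
  have hn' : (0:ℝ) < n := by exact_mod_cast Nat.pos_of_ne_zero hn
  rw [Real.log_div (x := (n:ℝ)) (by positivity) (by positivity), Real.log_exp, 
    Real.log_mul (by positivity) (by positivity), Real.log_div (by positivity) (by positivity), Real.log_exp,
    Real.log_sqrt (by positivity)] at h1
  linarith

theorem xlogx_mono {a b : ℝ} (ha : 1 ≤ a) (hab : a ≤ b) : a * Real.log a - a ≤ b * Real.log b - b := by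
  have hb : 0 < b := by linarith
  have h1 : Real.log (a / b) ≥ 1 - (a/b)⁻¹ := Real.one_sub_inv_le_log_of_pos (by positivity)
  have h2 : Real.log (b / a) ≤ b / a - 1 := Real.log_le_sub_one_of_pos (by positivity)
  have h3 : Real.log (b/a) ≥ 1 - (b/a)⁻¹ := Real.one_sub_inv_le_log_of_pos (by positivity)
  rw [Real.log_div (by positivity) (by positivity)] at h3
  rw [inv_div] at h3
  have h0 : 0 ≤ Real.log a := Real.log_nonneg ha
  have h4 : b * (1 - a / b) ≤ b * (Real.log b - Real.log a) := mul_le_mul_of_nonneg_left h3 hb.le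
  have h5 : b * (1 - a/b) = b - a := by field_simp
  nlinarith

theorem stir_up {z : ℝ} (hz : 1 ≤ z) :
    Real.log ((⌊z⌋₊).factorial : ℝ) ≤ z * Real.log z - z + Real.log z / 2 + 1 := by
  have hn : 1 ≤ ⌊z⌋₊ := Nat.le_floor (by simpa using hz)
  have hz' : ((⌊z⌋₊ : ℕ) : ℝ) ≤ z := Nat.floor_le (by linarith)
  have h1 : (1:ℝ) ≤ ((⌊z⌋₊ : ℕ) : ℝ) := by exact_mod_cast hn
  have := stir_nat_up (n := ⌊z⌋₊) (by omega)
  have := xlogx_mono h1 hz'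
  have := Real.log_le_log (by linarith) hz'
  linarith

theorem stir_lo {z : ℝ} (hz : 1 ≤ z) :
    z * Real.log z - z - Real.log z / 2 - 1 ≤ Real.log ((⌊z⌋₊).factorial : ℝ) := by
  have hz' : z < ((⌊z⌋₊ : ℕ) : ℝ) + 1 := Nat.lt_floor_add_one z
  have hz2 : ((⌊z⌋₊ : ℕ) : ℝ) ≤ z := Nat.floor_le (by linarith)
  set n := ⌊z⌋₊
  have h1 := Stirling.le_log_factorial_stirling (n := n+1) (by omega)
  have h2 := xlogx_mono hz hz'.le
  rw [Nat.factorial_succ, Nat.cast_mul, Real.log_mul (x := ((n + 1 : ℕ) : ℝ)) (by positivity) (by positivity)] at h1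
  simp only [Nat.cast_add, Nat.cast_one] at h1
  have h3 : Real.log ((n:ℝ) + 1) ≤ Real.log 2 + Real.log z := by
    rw [← Real.log_mul (by norm_num) (by positivity)]
    exact Real.log_le_log (by positivity) (by linarith)
  have h4 : 0 ≤ Real.log (2 * Real.pi) := Real.log_nonneg (by linarith [Real.pi_gt_three])
  have := Real.log_two_lt_d9
  linarith

/-- `F N d = log ⌊N/d⌋!` is close to the main term -/
theorem stir_div {N d : ℕ} (hd : 0 < d) (hN : d ≤ N) :
    |Real.log ((N / d).factorial : ℝ) - ((N:ℝ) / d * (Real.log N - 1) - N * (Real.log d / d))| ≤ Real.log N / 2 + 1 := by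
  have hd' : (0:ℝ) < d := by exact_mod_cast hd
  have hNp : (0:ℝ) < N := by exact_mod_cast (by omega : 0 < N)
  have hz : (1:ℝ) ≤ (N:ℝ) / d := by rw [le_div_iff₀ hd']; simpa using by exact_mod_cast hN
  have h1 := stir_up hz
  have h2 := stir_lo hz
  rw [Nat.floor_div_eq_div] at h1 h2
  rw [Real.log_div hNp.ne' hd'.ne'] at h1 h2
  have h3 : 0 ≤ Real.log d := Real.log_nonneg (by exact_mod_cast hd)
  have e : (N:ℝ) / d * (Real.log N - Real.log d) - (N:ℝ)/d = ((N:ℝ) / d * (Real.log N - 1) - N * (Real.log d / d)) := by ring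
  rw [abs_le]
  constructor <;> linarith

def Pl : List ℕ := [1, 6, 10, 14, 15, 21, 22, 26, 33, 34, 35, 38, 39, 46, 51, 55, 57, 58, 62, 65, 69, 74, 77, 82, 85, 86, 87, 91, 
  93, 94, 95, 106, 111, 115, 118, 119, 122, 123, 129]
def Nl : List ℕ := [2, 3, 5, 7, 11, 13, 17, 19, 23, 29, 30, 31, 37, 41, 42, 43, 47, 53, 59, 61, 66, 67, 70, 71, 73, 78, 79, 83, 
  89, 97, 101, 102, 103, 105, 107, 109, 110, 113, 114, 127, 130]
def segs : List (ℕ × ℕ × ℕ) := [(nat_lit 130,nat_lit 164,nat_lit 164), (nat_lit 2,nat_lit 164,nat_lit 169), (nat_lit 1,nat_lit 164,nat_lit 165), (nat_lit 3,nat_lit 168,nat_lit 165), (nat_lit 1,nat_lit 164,nat_lit 165), (nat_lit 1,nat_lit 164,nat_lit 169), (nat_lit 2,nat_lit 164,nat_lit 173), (nat_lit 1,nat_lit 164,nat_lit 169), 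
  (nat_lit 1,nat_lit 164,nat_lit 165), (nat_lit 2,nat_lit 168,nat_lit 161), (nat_lit 1,nat_lit 172,nat_lit 157), (nat_lit 3,nat_lit 176,nat_lit 157), (nat_lit 2,nat_lit 172,nat_lit 157), (nat_lit 3,nat_lit 168,nat_lit 161), (nat_lit 4,nat_lit 168,nat_lit 165), (nat_lit 1,nat_lit 168,nat_lit 161), 
  (nat_lit 2,nat_lit 172,nat_lit 157), (nat_lit 2,nat_lit 176,nat_lit 157), (nat_lit 2,nat_lit 172,nat_lit 157), (nat_lit 2,nat_lit 172,nat_lit 161), (nat_lit 3,nat_lit 168,nat_lit 161), (nat_lit 3,nat_lit 164,nat_lit 165), (nat_lit 1,nat_lit 164,nat_lit 169), (nat_lit 5,nat_lit 164,nat_lit 173), 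
  (nat_lit 3,nat_lit 160,nat_lit 173), (nat_lit 1,nat_lit 160,nat_lit 177), (nat_lit 7,nat_lit 160,nat_lit 173), (nat_lit 1,nat_lit 156,nat_lit 173), (nat_lit 2,nat_lit 152,nat_lit 177), (nat_lit 2,nat_lit 152,nat_lit 181), (nat_lit 2,nat_lit 148,nat_lit 181), (nat_lit 2,nat_lit 148,nat_lit 185), 
  (nat_lit 2,nat_lit 148,nat_lit 189), (nat_lit 1,nat_lit 148,nat_lit 185), (nat_lit 1,nat_lit 148,nat_lit 181), (nat_lit 2,nat_lit 152,nat_lit 177), (nat_lit 1,nat_lit 156,nat_lit 173), (nat_lit 3,nat_lit 160,nat_lit 169), (nat_lit 1,nat_lit 164,nat_lit 165), (nat_lit 3,nat_lit 168,nat_lit 165), 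
  (nat_lit 1,nat_lit 168,nat_lit 161), (nat_lit 1,nat_lit 172,nat_lit 157), (nat_lit 2,nat_lit 176,nat_lit 153), (nat_lit 1,nat_lit 180,nat_lit 149), (nat_lit 1,nat_lit 184,nat_lit 145), (nat_lit 2,nat_lit 188,nat_lit 145), (nat_lit 1,nat_lit 192,nat_lit 145), (nat_lit 5,nat_lit 188,nat_lit 145), 
  (nat_lit 2,nat_lit 184,nat_lit 145), (nat_lit 1,nat_lit 180,nat_lit 149), (nat_lit 1,nat_lit 176,nat_lit 153), (nat_lit 2,nat_lit 176,nat_lit 157), (nat_lit 5,nat_lit 176,nat_lit 161), (nat_lit 1,nat_lit 172,nat_lit 161), (nat_lit 2,nat_lit 168,nat_lit 161), (nat_lit 5,nat_lit 168,nat_lit 165), 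
  (nat_lit 1,nat_lit 168,nat_lit 169), (nat_lit 7,nat_lit 168,nat_lit 165), (nat_lit 1,nat_lit 172,nat_lit 165), (nat_lit 2,nat_lit 168,nat_lit 165), (nat_lit 1,nat_lit 164,nat_lit 165), (nat_lit 9,nat_lit 164,nat_lit 169), (nat_lit 1,nat_lit 168,nat_lit 169), (nat_lit 1,nat_lit 172,nat_lit 169), 
  (nat_lit 2,nat_lit 168,nat_lit 169), (nat_lit 2,nat_lit 164,nat_lit 169), (nat_lit 3,nat_lit 160,nat_lit 169), (nat_lit 1,nat_lit 156,nat_lit 173), (nat_lit 4,nat_lit 152,nat_lit 177), (nat_lit 2,nat_lit 148,nat_lit 181), (nat_lit 4,nat_lit 148,nat_lit 185), (nat_lit 4,nat_lit 148,nat_lit 181), 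
  (nat_lit 1,nat_lit 152,nat_lit 177), (nat_lit 3,nat_lit 156,nat_lit 177), (nat_lit 4,nat_lit 156,nat_lit 173), (nat_lit 2,nat_lit 160,nat_lit 169), (nat_lit 2,nat_lit 164,nat_lit 165), (nat_lit 2,nat_lit 168,nat_lit 165), (nat_lit 2,nat_lit 172,nat_lit 165), (nat_lit 6,nat_lit 168,nat_lit 165), 
  (nat_lit 6,nat_lit 168,nat_lit 169), (nat_lit 2,nat_lit 168,nat_lit 165), (nat_lit 2,nat_lit 168,nat_lit 161), (nat_lit 4,nat_lit 172,nat_lit 157), (nat_lit 2,nat_lit 176,nat_lit 153), (nat_lit 3,nat_lit 180,nat_lit 153), (nat_lit 3,nat_lit 180,nat_lit 149), (nat_lit 10,nat_lit 184,nat_lit 149), 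
  (nat_lit 2,nat_lit 180,nat_lit 149), (nat_lit 1,nat_lit 176,nat_lit 153), (nat_lit 1,nat_lit 172,nat_lit 157), (nat_lit 4,nat_lit 172,nat_lit 161), (nat_lit 4,nat_lit 172,nat_lit 165), (nat_lit 2,nat_lit 168,nat_lit 165), (nat_lit 5,nat_lit 164,nat_lit 165), (nat_lit 8,nat_lit 164,nat_lit 169), 
  (nat_lit 1,nat_lit 160,nat_lit 169), (nat_lit 6,nat_lit 160,nat_lit 173), (nat_lit 1,nat_lit 156,nat_lit 173), (nat_lit 5,nat_lit 156,nat_lit 177), (nat_lit 17,nat_lit 156,nat_lit 181), (nat_lit 1,nat_lit 156,nat_lit 177), (nat_lit 1,nat_lit 156,nat_lit 173), (nat_lit 3,nat_lit 160,nat_lit 169), 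
  (nat_lit 5,nat_lit 164,nat_lit 169), (nat_lit 1,nat_lit 164,nat_lit 165), (nat_lit 10,nat_lit 168,nat_lit 165), (nat_lit 3,nat_lit 168,nat_lit 161), (nat_lit 1,nat_lit 172,nat_lit 157), (nat_lit 1,nat_lit 176,nat_lit 157), (nat_lit 10,nat_lit 180,nat_lit 157), (nat_lit 1,nat_lit 184,nat_lit 157), 
  (nat_lit 16,nat_lit 180,nat_lit 157), (nat_lit 2,nat_lit 176,nat_lit 157), (nat_lit 3,nat_lit 172,nat_lit 157), (nat_lit 1,nat_lit 168,nat_lit 161), (nat_lit 1,nat_lit 164,nat_lit 165), (nat_lit 1,nat_lit 164,nat_lit 169), (nat_lit 4,nat_lit 164,nat_lit 173), (nat_lit 2,nat_lit 164,nat_lit 177), 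
  (nat_lit 4,nat_lit 164,nat_lit 173), (nat_lit 12,nat_lit 164,nat_lit 169), (nat_lit 2,nat_lit 168,nat_lit 169), (nat_lit 5,nat_lit 164,nat_lit 169), (nat_lit 31,nat_lit 164,nat_lit 173), (nat_lit 1,nat_lit 164,nat_lit 177), (nat_lit 3,nat_lit 164,nat_lit 178), (nat_lit 4,nat_lit 164,nat_lit 174), 
  (nat_lit 2,nat_lit 164,nat_lit 170), (nat_lit 1,nat_lit 164,nat_lit 166), (nat_lit 1,nat_lit 167,nat_lit 162), (nat_lit 1,nat_lit 171,nat_lit 162), (nat_lit 35,nat_lit 175,nat_lit 162), (nat_lit 6,nat_lit 175,nat_lit 166), (nat_lit 8,nat_lit 175,nat_lit 170), (nat_lit 8,nat_lit 171,nat_lit 170), 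
  (nat_lit 2,nat_lit 167,nat_lit 170), (nat_lit 6,nat_lit 163,nat_lit 170), (nat_lit 16,nat_lit 163,nat_lit 174), (nat_lit 6,nat_lit 163,nat_lit 178), (nat_lit 6,nat_lit 163,nat_lit 174), (nat_lit 3,nat_lit 163,nat_lit 170), (nat_lit 3,nat_lit 163,nat_lit 166), (nat_lit 4,nat_lit 167,nat_lit 166), 
  (nat_lit 32,nat_lit 171,nat_lit 166), (nat_lit 9,nat_lit 175,nat_lit 166), (nat_lit 11,nat_lit 171,nat_lit 166), (nat_lit 2,nat_lit 171,nat_lit 170), (nat_lit 3,nat_lit 171,nat_lit 174), (nat_lit 7,nat_lit 171,nat_lit 178), (nat_lit 2,nat_lit 171,nat_lit 174), (nat_lit 5,nat_lit 171,nat_lit 170), 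
  (nat_lit 1,nat_lit 171,nat_lit 166), (nat_lit 2,nat_lit 171,nat_lit 162), (nat_lit 25,nat_lit 175,nat_lit 162), (nat_lit 1,nat_lit 171,nat_lit 162), (nat_lit 4,nat_lit 167,nat_lit 162), (nat_lit 1,nat_lit 167,nat_lit 166), (nat_lit 7,nat_lit 167,nat_lit 170), (nat_lit 6,nat_lit 163,nat_lit 170), 
  (nat_lit 3,nat_lit 159,nat_lit 170), (nat_lit 1,nat_lit 159,nat_lit 174), (nat_lit 12,nat_lit 159,nat_lit 178), (nat_lit 1,nat_lit 159,nat_lit 182), (nat_lit 1,nat_lit 159,nat_lit 186), (nat_lit 1,nat_lit 159,nat_lit 182), (nat_lit 3,nat_lit 159,nat_lit 178), (nat_lit 11,nat_lit 159,nat_lit 174), 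
  (nat_lit 1,nat_lit 159,nat_lit 170), (nat_lit 2,nat_lit 163,nat_lit 166), (nat_lit 2,nat_lit 167,nat_lit 162), (nat_lit 6,nat_lit 171,nat_lit 162), (nat_lit 2,nat_lit 175,nat_lit 162), (nat_lit 1,nat_lit 179,nat_lit 162), (nat_lit 4,nat_lit 183,nat_lit 162), (nat_lit 1,nat_lit 187,nat_lit 162), 
  (nat_lit 10,nat_lit 183,nat_lit 162), (nat_lit 2,nat_lit 179,nat_lit 162), (nat_lit 4,nat_lit 175,nat_lit 162), (nat_lit 2,nat_lit 171,nat_lit 162), (nat_lit 1,nat_lit 167,nat_lit 162), (nat_lit 1,nat_lit 167,nat_lit 166), (nat_lit 30,nat_lit 167,nat_lit 170), (nat_lit 4,nat_lit 167,nat_lit 174), 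
  (nat_lit 26,nat_lit 167,nat_lit 178), (nat_lit 1,nat_lit 167,nat_lit 174), (nat_lit 3,nat_lit 167,nat_lit 170), (nat_lit 6,nat_lit 167,nat_lit 166), (nat_lit 2,nat_lit 167,nat_lit 162), (nat_lit 3,nat_lit 171,nat_lit 162), (nat_lit 46,nat_lit 175,nat_lit 162), (nat_lit 2,nat_lit 171,nat_lit 162), 
  (nat_lit 1,nat_lit 167,nat_lit 162), (nat_lit 14,nat_lit 167,nat_lit 166), (nat_lit 8,nat_lit 167,nat_lit 170), (nat_lit 2,nat_lit 167,nat_lit 174), (nat_lit 10,nat_lit 167,nat_lit 178), (nat_lit 7,nat_lit 167,nat_lit 174), (nat_lit 13,nat_lit 167,nat_lit 170), (nat_lit 9,nat_lit 171,nat_lit 170), 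
  (nat_lit 1,nat_lit 175,nat_lit 170), (nat_lit 13,nat_lit 179,nat_lit 170), (nat_lit 1,nat_lit 183,nat_lit 170), (nat_lit 1,nat_lit 179,nat_lit 170), (nat_lit 1,nat_lit 175,nat_lit 170), (nat_lit 16,nat_lit 174,nat_lit 170), (nat_lit 12,nat_lit 174,nat_lit 171), (nat_lit 2,nat_lit 174,nat_lit 175), 
  (nat_lit 2,nat_lit 174,nat_lit 179), (nat_lit 20,nat_lit 174,nat_lit 175), (nat_lit 6,nat_lit 178,nat_lit 175), (nat_lit 1,nat_lit 174,nat_lit 175), (nat_lit 55,nat_lit 170,nat_lit 175), (nat_lit 10,nat_lit 174,nat_lit 175), (nat_lit 2,nat_lit 174,nat_lit 171), (nat_lit 70,nat_lit 174,nat_lit 167), 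
  (nat_lit 1,nat_lit 174,nat_lit 171), (nat_lit 1,nat_lit 174,nat_lit 175), (nat_lit 1,nat_lit 174,nat_lit 179), (nat_lit 7,nat_lit 174,nat_lit 183), (nat_lit 4,nat_lit 174,nat_lit 179), (nat_lit 27,nat_lit 174,nat_lit 175), (nat_lit 1,nat_lit 178,nat_lit 175), (nat_lit 2,nat_lit 182,nat_lit 175), 
  (nat_lit 1,nat_lit 186,nat_lit 175), (nat_lit 1,nat_lit 182,nat_lit 175), (nat_lit 14,nat_lit 178,nat_lit 175), (nat_lit 18,nat_lit 174,nat_lit 175), (nat_lit 49,nat_lit 174,nat_lit 179), (nat_lit 1,nat_lit 178,nat_lit 179), (nat_lit 1,nat_lit 182,nat_lit 179), (nat_lit 2,nat_lit 186,nat_lit 179), 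
  (nat_lit 27,nat_lit 182,nat_lit 179), (nat_lit 16,nat_lit 182,nat_lit 175), (nat_lit 22,nat_lit 182,nat_lit 171), (nat_lit 51,nat_lit 178,nat_lit 171), (nat_lit 12,nat_lit 174,nat_lit 171), (nat_lit 1,nat_lit 174,nat_lit 175), (nat_lit 5,nat_lit 174,nat_lit 179), 
  (nat_lit 112,nat_lit 174,nat_lit 176), (nat_lit 169,nat_lit 177,nat_lit 176), (nat_lit 31,nat_lit 181,nat_lit 176), (nat_lit 2,nat_lit 181,nat_lit 180), (nat_lit 52,nat_lit 181,nat_lit 176), (nat_lit 142,nat_lit 177,nat_lit 176), (nat_lit 1,nat_lit 177,nat_lit 181), 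
  (nat_lit 6,nat_lit 177,nat_lit 185), (nat_lit 4,nat_lit 177,nat_lit 181), (nat_lit 47,nat_lit 177,nat_lit 177), (nat_lit 19,nat_lit 180,nat_lit 177), (nat_lit 143,nat_lit 176,nat_lit 177), (nat_lit 45,nat_lit 176,nat_lit 173), (nat_lit 116,nat_lit 172,nat_lit 173), 
  (nat_lit 30,nat_lit 172,nat_lit 177), (nat_lit 1,nat_lit 176,nat_lit 177), (nat_lit 17,nat_lit 180,nat_lit 177), (nat_lit 5,nat_lit 184,nat_lit 177), (nat_lit 39,nat_lit 183,nat_lit 177), (nat_lit 2,nat_lit 183,nat_lit 181), (nat_lit 2,nat_lit 183,nat_lit 185), (nat_lit 6,nat_lit 183,nat_lit 181), 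
  (nat_lit 45,nat_lit 183,nat_lit 178), (nat_lit 1,nat_lit 179,nat_lit 178), (nat_lit 92,nat_lit 175,nat_lit 178), (nat_lit 160,nat_lit 175,nat_lit 174), (nat_lit 22,nat_lit 179,nat_lit 174), (nat_lit 143,nat_lit 179,nat_lit 178), (nat_lit 4,nat_lit 183,nat_lit 178), 
  (nat_lit 185,nat_lit 182,nat_lit 178), (nat_lit 161,nat_lit 182,nat_lit 179), (nat_lit 1,nat_lit 186,nat_lit 179), (nat_lit 7,nat_lit 182,nat_lit 179), (nat_lit 159,nat_lit 178,nat_lit 179), (nat_lit 2,nat_lit 178,nat_lit 183), (nat_lit 2,nat_lit 178,nat_lit 187), (nat_lit 2,nat_lit 178,nat_lit 191), 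
  (nat_lit 5,nat_lit 178,nat_lit 187), (nat_lit 1,nat_lit 178,nat_lit 183), (nat_lit 50,nat_lit 178,nat_lit 180), (nat_lit 23,nat_lit 177,nat_lit 180), (nat_lit 355,nat_lit 177,nat_lit 176), (nat_lit 25,nat_lit 181,nat_lit 176), (nat_lit 1,nat_lit 181,nat_lit 177), (nat_lit 5,nat_lit 181,nat_lit 181), 
  (nat_lit 1,nat_lit 181,nat_lit 185), (nat_lit 47,nat_lit 181,nat_lit 181), (nat_lit 107,nat_lit 184,nat_lit 181), (nat_lit 50,nat_lit 180,nat_lit 181), (nat_lit 70,nat_lit 180,nat_lit 177), (nat_lit 313,nat_lit 176,nat_lit 177), (nat_lit 109,nat_lit 176,nat_lit 178), 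
  (nat_lit 2,nat_lit 179,nat_lit 178), (nat_lit 158,nat_lit 183,nat_lit 178), (nat_lit 8,nat_lit 183,nat_lit 182), (nat_lit 4,nat_lit 183,nat_lit 186), (nat_lit 451,nat_lit 183,nat_lit 183), (nat_lit 125,nat_lit 186,nat_lit 183), (nat_lit 38,nat_lit 182,nat_lit 183), 
  (nat_lit 31,nat_lit 182,nat_lit 187), (nat_lit 51,nat_lit 182,nat_lit 185), (nat_lit 919,nat_lit 180,nat_lit 185), (nat_lit 15,nat_lit 183,nat_lit 185), (nat_lit 38,nat_lit 179,nat_lit 185), (nat_lit 1,nat_lit 179,nat_lit 186), (nat_lit 780,nat_lit 179,nat_lit 182), 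
  (nat_lit 49,nat_lit 179,nat_lit 183), (nat_lit 1,nat_lit 182,nat_lit 183), (nat_lit 3,nat_lit 186,nat_lit 183), (nat_lit 702,nat_lit 184,nat_lit 183), (nat_lit 8,nat_lit 184,nat_lit 185), (nat_lit 6,nat_lit 184,nat_lit 189), (nat_lit 2,nat_lit 184,nat_lit 185), (nat_lit 705,nat_lit 184,nat_lit 182), 
  (nat_lit 545,nat_lit 187,nat_lit 182), (nat_lit 2,nat_lit 190,nat_lit 182), (nat_lit 107,nat_lit 186,nat_lit 182), (nat_lit 55,nat_lit 185,nat_lit 182), (nat_lit 280,nat_lit 185,nat_lit 184), (nat_lit 291,nat_lit 184,nat_lit 184), (nat_lit 303,nat_lit 184,nat_lit 185), 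
  (nat_lit 804,nat_lit 181,nat_lit 185), (nat_lit 5,nat_lit 181,nat_lit 187), (nat_lit 379,nat_lit 181,nat_lit 184), (nat_lit 840,nat_lit 181,nat_lit 183), (nat_lit 657,nat_lit 183,nat_lit 183), (nat_lit 1329,nat_lit 186,nat_lit 183), (nat_lit 288,nat_lit 186,nat_lit 186), 
  (nat_lit 1,nat_lit 191,nat_lit 186), (nat_lit 1400,nat_lit 188,nat_lit 186), (nat_lit 45,nat_lit 188,nat_lit 189), (nat_lit 1689,nat_lit 186,nat_lit 189), (nat_lit 3623,nat_lit 186,nat_lit 188), (nat_lit 2,nat_lit 193,nat_lit 188), (nat_lit 895,nat_lit 191,nat_lit 188), 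
  (nat_lit 6399,nat_lit 188,nat_lit 188), (nat_lit 11332,nat_lit 188,nat_lit 191)]

def ls (l : List ℕ) (m : ℕ) : ℕ := (l.map fun d => m / d).sum
/-- packed divisor-count generating number -/
def gen (M : ℕ) (l : List ℕ) : ℕ :=
  List.rec 0 (fun d _ ih => Nat.add (Nat.div (Nat.sub (Nat.pow (Nat.pow 256 d) (Nat.succ (Nat.div M d))) 1) (Nat.sub (Nat.pow 256 d) 1)) ih) l
def chk (m U L p n : ℕ) : Bool :=
    and (Nat.ble (Nat.mul 100000000 (Nat.add 42 n))
          (Nat.add (Nat.mul 100000000 p) (Nat.add (Nat.mul 6673795 (Nat.div m 131)) (Nat.mul 25000000 U))))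
        (Nat.ble (Nat.add (Nat.mul 100000000 (Nat.add 41 p)) (Nat.mul 6673796 (Nat.div m 131)))
          (Nat.add (Nat.mul 100000000 (Nat.succ n)) (Nat.mul 25000000 L)))
def seg (U L : ℕ) (cont : ℕ → ℕ → ℕ → Bool) (len : ℕ) : ℕ → ℕ → ℕ → ℕ → ℕ → Bool :=
  Nat.rec (fun _ _ p n m => cont p n m) (fun _ ih gp gn p n m =>
    force (Nat.succ (Nat.add p (Nat.mod gp 256))) fun p' =>
    force (Nat.succ (Nat.add n (Nat.mod gn 256))) fun n' =>
    force (Nat.succ (Nat.succ m)) fun m' =>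
    force (Nat.succ (Nat.div gp 256)) fun gp' =>
    force (Nat.succ (Nat.div gn 256)) fun gn' =>
    and (chk m' U L p' n') (ih gp' gn' p' n' m')) len
def walk : List (ℕ × ℕ × ℕ) → ℕ → ℕ → ℕ → ℕ → ℕ → Bool :=
  List.rec (fun _ _ _ _ _ => true) (fun s _ ih gp gn p n m =>
    force (Nat.succ (Nat.mod gp (Nat.pow 256 s.1))) fun g1 =>
    force (Nat.succ (Nat.mod gn (Nat.pow 256 s.1))) fun h1 =>
    force (Nat.succ (Nat.div gp (Nat.pow 256 s.1))) fun g2 =>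
    force (Nat.succ (Nat.div gn (Nat.pow 256 s.1))) fun h2 =>
     seg s.2.1 s.2.2 (fun p' n' m' => ih g2 h2 p' n' m') s.1 g1 h1 p n m)

/-- packed digits -/
def dg (a : ℕ → ℕ) (m len : ℕ) : ℕ := ∑ j ∈ Finset.range len, a (m + j) * 256 ^ j

theorem dg_succ (a : ℕ → ℕ) (m len : ℕ) : dg a m (len+1) = a m + 256 * dg a (m+1) len := by
  unfold dg
  rw [Finset.sum_range_succ', Finset.mul_sum]
  simp only [add_zero, pow_zero, mul_one]
  rw [add_comm]
  congr 1
  refine Finset.sum_congr rfl fun j _ => ?_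
  rw [show m + (j+1) = m + 1 + j by ring, pow_succ]
  ring

theorem dg_add (a : ℕ → ℕ) (m l1 l2 : ℕ) : dg a m (l1 + l2) = dg a m l1 + 256 ^ l1 * dg a (m + l1) l2 := by
  unfold dg
  rw [Finset.sum_range_add, Finset.mul_sum]
  congr 1
  refine Finset.sum_congr rfl fun j _ => ?_
  rw [pow_add, add_assoc]
  ring

theorem dg_lt (a : ℕ → ℕ) (ha : ∀ m, a m < 256) (len : ℕ) : ∀ m, dg a m len < 256 ^ len := by
  induction len with
  | zero => intro m; simp [dg]
  | succ n ih =>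
    intro m
    rw [dg_succ, pow_succ]
    have := ih (m+1)
    have := ha m
    omega

/-- number of `d ∈ l` dividing `m` -/
def cnt (l : List ℕ) (m : ℕ) : ℕ := (l.map fun d => if d ∣ m then 1 else 0).sum

theorem ls_succ (l : List ℕ) (m : ℕ) : ls l (m+1) = ls l m + cnt l (m+1) := by
  unfold ls cnt
  rw [← List.sum_map_add]
  congr 1
  refine List.map_congr_left fun d _ => ?_
  exact Nat.succ_div

theorem cnt_le (l : List ℕ) (m : ℕ) : cnt l m ≤ l.length := by
  unfold cnt
  induction l with
  | nil => simp
  | cons d l ih =>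
    rw [List.map_cons, List.sum_cons, List.length_cons]
    split_ifs <;> omega

theorem gen_one {M d : ℕ} (hd : 0 < d) :
    Nat.div (Nat.sub (Nat.pow (Nat.pow 256 d) (Nat.succ (Nat.div M d))) 1) (Nat.sub (Nat.pow 256 d) 1)
      = ∑ j ∈ Finset.range (M+1), (if d ∣ j then 1 else 0) * 256 ^ j := by
  have h2 : 2 ≤ 256 ^ d := by
    calc 2 ≤ 256 ^ 1 := by norm_num
      _ ≤ 256 ^ d := Nat.pow_le_pow_right (by norm_num) hd
  have h := Nat.geomSum_eq h2 (M / d + 1)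
  change ((256 ^ d) ^ (M / d + 1) - 1) / (256 ^ d - 1) = _
  rw [← h]
  simp only [ite_mul, one_mul, zero_mul]
  rw [← Finset.sum_filter]
  refine Finset.sum_bij (fun k _ => d * k) ?_ ?_ ?_ ?_
  · intro k hk
    simp only [Finset.mem_range, Finset.mem_filter] at hk ⊢
    refine ⟨?_, dvd_mul_right _ _⟩
    have : k ≤ M / d := by omega
    have := (Nat.le_div_iff_mul_le hd).1 this
    rw [mul_comm]; omega
  · intro a _ b _ hab
    exact Nat.eq_of_mul_eq_mul_left hd hab
  · intro b hb
    simp only [Finset.mem_range, Finset.mem_filter] at hb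
    obtain ⟨hb, k, rfl⟩ := hb
    refine ⟨k, ?_, rfl⟩
    simp only [Finset.mem_range]
    have : k ≤ M / d := by rw [Nat.le_div_iff_mul_le hd, mul_comm]; omega
    omega
  · intro k _
    rw [pow_mul]

theorem gen_eq (M : ℕ) (l : List ℕ) (hl : ∀ d ∈ l, 0 < d) : gen M l = dg (cnt l) 0 (M+1) := by
  induction l with
  | nil => simp [gen, dg, cnt]
  | cons d l ih =>
    have : gen M (d :: l) = Nat.div (Nat.sub (Nat.pow (Nat.pow 256 d) (Nat.succ (Nat.div M d))) 1) (Nat.sub (Nat.pow 256 d) 1) + gen M l := rfl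
    rw [this, gen_one (hl d (by simp)), ih (fun e he => hl e (by simp [he]))]
    unfold dg
    rw [← Finset.sum_add_distrib]
    refine Finset.sum_congr rfl fun j _ => ?_
    simp only [cnt, List.map_cons, List.sum_cons, zero_add]
    ring

theorem force_succ (n : ℕ) (f : ℕ → Bool) : force (Nat.succ n) f = f n := rfl

def CK (m U L : ℕ) : Prop :=
  100000000 * (42 + ls Nl m) ≤ 100000000 * ls Pl m + (6673795 * (m / 131) + 25000000 * U) ∧
  100000000 * (41 + ls Pl m) + 6673796 * (m / 131) ≤ 100000000 * (ls Nl m + 1) + 25000000 * L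

theorem chk_spec {m U L : ℕ} (h : chk m U L (ls Pl m) (ls Nl m) = true) : CK m U L := by
  unfold chk at h
  rw [Bool.and_eq_true] at h
  exact ⟨Nat.le_of_ble_eq_true h.1, Nat.le_of_ble_eq_true h.2⟩

theorem cntP_lt (m : ℕ) : cnt Pl m < 256 := lt_of_le_of_lt (cnt_le Pl m) (by decide)
theorem cntN_lt (m : ℕ) : cnt Nl m < 256 := lt_of_le_of_lt (cnt_le Nl m) (by decide)

theorem seg_spec (U L : ℕ) (cont : ℕ → ℕ → ℕ → Bool) (len : ℕ) : ∀ m,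
    seg U L cont len (dg (cnt Pl) (m+1) len) (dg (cnt Nl) (m+1) len) (ls Pl m) (ls Nl m) m = true →
    (∀ m', m < m' → m' ≤ m + len → CK m' U L) ∧ cont (ls Pl (m+len)) (ls Nl (m+len)) (m+len) = true := by
  induction len with
  | zero => intro m h; exact ⟨fun m' h1 h2 => by omega, h⟩
  | succ len ih =>
    intro m h
    have h' : (and (chk (m+1) U L (ls Pl m + dg (cnt Pl) (m+1) (len+1) % 256) (ls Nl m + dg (cnt Nl) (m+1) (len+1) % 256))
       (seg U L cont len (dg (cnt Pl) (m+1) (len+1) / 256) (dg (cnt Nl) (m+1) (len+1) / 256) 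
        (ls Pl m + dg (cnt Pl) (m+1) (len+1) % 256) (ls Nl m + dg (cnt Nl) (m+1) (len+1) % 256) (m+1))) = true := h
    have e1 : dg (cnt Pl) (m+1) (len+1) % 256 = cnt Pl (m+1) := by
      rw [dg_succ]; have := cntP_lt (m+1); omega
    have e2 : dg (cnt Nl) (m+1) (len+1) % 256 = cnt Nl (m+1) := by
      rw [dg_succ]; have := cntN_lt (m+1); omega
    have e3 : dg (cnt Pl) (m+1) (len+1) / 256 = dg (cnt Pl) (m+1+1) len := by
      rw [dg_succ]; have := cntP_lt (m+1); omega
    have e4 : dg (cnt Nl) (m+1) (len+1) / 256 = dg (cnt Nl) (m+1+1) len := by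
      rw [dg_succ]; have := cntN_lt (m+1); omega
    rw [e1, e2, e3, e4, ← ls_succ, ← ls_succ, Bool.and_eq_true] at h'
    obtain ⟨hc, hr⟩ := ih (m+1) h'.2
    refine ⟨fun m' h1 h2 => ?_, by rwa [show m + (len+1) = m + 1 + len by ring]⟩
    rcases Nat.lt_or_ge (m+1) m' with h3 | h3
    · exact hc m' h3 (by omega)
    · have : m' = m + 1 := by omega
      subst this
      exact chk_spec h'.1

def SegsOK : List (ℕ × ℕ × ℕ) → ℕ → Prop
  | [], _ => True
  | s :: r, m => (∀ m', m < m' → m' ≤ m + s.1 → CK m' s.2.1 s.2.2) ∧ SegsOK r (m + s.1)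

def tot (l : List (ℕ × ℕ × ℕ)) : ℕ := (l.map fun s => s.1).sum

theorem walk_spec (l : List (ℕ × ℕ × ℕ)) : ∀ m, 
    walk l (dg (cnt Pl) (m+1) (tot l)) (dg (cnt Nl) (m+1) (tot l)) (ls Pl m) (ls Nl m) m = true → SegsOK l m := by
  induction l with
  | nil => intro m _; trivial
  | cons s r ih =>
    intro m h
    have et : tot (s :: r) = s.1 + tot r := by simp [tot]
    rw [et] at h
    have h' : seg s.2.1 s.2.2 (fun p' n' m' => walk r (dg (cnt Pl) (m+1) (s.1 + tot r) / 256 ^ s.1) (dg (cnt Nl) (m+1) (s.1 + tot r) / 256 ^ s.1) p' n' m') s.1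
      (dg (cnt Pl) (m+1) (s.1 + tot r) % 256 ^ s.1) (dg (cnt Nl) (m+1) (s.1 + tot r) % 256 ^ s.1) (ls Pl m) (ls Nl m) m = true := h
    have e1 : ∀ l : List ℕ, (∀ m, cnt l m < 256) → dg (cnt l) (m+1) (s.1 + tot r) % 256 ^ s.1 = dg (cnt l) (m+1) s.1 := by
      intro l hl
      rw [dg_add, Nat.add_mul_mod_self_left, Nat.mod_eq_of_lt (dg_lt _ hl _ _)]
    have e2 : ∀ l : List ℕ, (∀ m, cnt l m < 256) → dg (cnt l) (m+1) (s.1 + tot r) / 256 ^ s.1 = dg (cnt l) (m+s.1+1) (tot r) := by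
      intro l hl
      rw [dg_add, Nat.add_mul_div_left _ _ (by positivity), Nat.div_eq_of_lt (dg_lt _ hl _ _), zero_add]
      congr 1; ring
    rw [e1 Pl cntP_lt, e1 Nl cntN_lt, e2 Pl cntP_lt, e2 Nl cntN_lt] at h'
    obtain ⟨h1, h2⟩ := seg_spec _ _ _ _ m h'
    exact ⟨h1, ih _ h2⟩

set_option maxRecDepth 100000 in
theorem walk_run : (force (Nat.div (gen 40000 Pl) 256).succ fun g =>
  force (Nat.div (gen 40000 Nl) 256).succ fun h => walk segs g h 0 0 0) = true := by decide +kernel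

theorem segs_ok : SegsOK segs 0 := by
  have h := walk_run
  rw [force_succ, force_succ] at h
  apply walk_spec
  have ht : tot segs = 40000 := by decide +kernel
  have e : ∀ l : List ℕ, (∀ m, cnt l m < 256) → (∀ d ∈ l, 0 < d) → Nat.div (gen 40000 l) 256 = dg (cnt l) (0+1) 40000 := by
    intro l hl hl'
    change gen 40000 l / 256 = _
    rw [gen_eq _ _ hl', dg_succ]; have := hl 0; omega
  rw [e Pl cntP_lt (by decide), e Nl cntN_lt (by decide)] at h
  rw [ht]
  exact h

noncomputable def hs (l : List ℕ) : ℝ := (l.map fun d : ℕ => 1 / (d:ℝ)).sum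
noncomputable def gs (l : List ℕ) : ℝ := (l.map fun d : ℕ => Real.log d / (d:ℝ)).sum
noncomputable def nu0 : ℝ := 131 * (hs Nl - hs Pl)
noncomputable def lf (l : List ℕ) (N : ℕ) : ℝ := (l.map fun d => Real.log ((N / d).factorial : ℝ)).sum
noncomputable def Aw (m : ℕ) : ℝ := (ls Pl m : ℝ) - ls Nl m + nu0 * ((m / 131 : ℕ) : ℝ)

theorem log_fact_div (N d : ℕ) : Real.log ((N / d).factorial : ℝ) =
    ∑ n ∈ Finset.Ioc 0 N, ArithmeticFunction.vonMangoldt n * (((N / n) / d : ℕ) : ℝ) := by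
  rw [log_fact_eq]
  have hsub : Finset.Ioc 0 (N / d) ⊆ Finset.Ioc 0 N := Finset.Ioc_subset_Ioc le_rfl (Nat.div_le_self _ _)
  rw [← Finset.sum_subset hsub]
  · refine Finset.sum_congr rfl fun n _ => ?_
    rw [Nat.div_div_eq_div_mul, Nat.div_div_eq_div_mul, mul_comm n d]
  · intro n h1 h2
    simp only [Finset.mem_Ioc, not_and, not_le] at h1 h2
    rw [Nat.div_div_eq_div_mul, mul_comm n d, ← Nat.div_div_eq_div_mul, Nat.div_eq_of_lt (h2 h1.1)]
    simp

theorem lf_eq (l : List ℕ) (N : ℕ) : lf l N = ∑ n ∈ Finset.Ioc 0 N, ArithmeticFunction.vonMangoldt n * (ls l (N / n) : ℝ) := by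
  induction l with
  | nil => simp [lf, ls]
  | cons d l ih =>
    unfold lf ls at *
    simp only [List.map_cons, List.sum_cons, Nat.cast_add, mul_add, Finset.sum_add_distrib]
    rw [ih, log_fact_div]

theorem T_eq (N : ℕ) : lf Pl N - lf Nl N + nu0 * Real.log ((N / 131).factorial : ℝ) =
    ∑ n ∈ Finset.Ioc 0 N, ArithmeticFunction.vonMangoldt n * Aw (N / n) := by
  rw [lf_eq, lf_eq, log_fact_div, ← Finset.sum_sub_distrib, Finset.mul_sum, ← Finset.sum_add_distrib]
  refine Finset.sum_congr rfl fun n _ => ?_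
  unfold Aw
  ring

theorem lf_main (l : List ℕ) (N : ℕ) (hl : ∀ d ∈ l, 0 < d ∧ d ≤ N) :
    |lf l N - ((N:ℝ) * (Real.log N - 1) * hs l - N * gs l)| ≤ l.length * (Real.log N / 2 + 1) := by
  induction l with
  | nil => simp [lf, hs, gs]
  | cons d l ih =>
    have h1 := ih fun e he => hl e (by simp [he])
    have h2 := stir_div (hl d (by simp)).1 (hl d (by simp)).2
    have e : lf (d :: l) N - ((N:ℝ) * (Real.log N - 1) * hs (d :: l) - N * gs (d :: l)) =
      (Real.log ((N / d).factorial : ℝ) - ((N:ℝ) / d * (Real.log N - 1) - N * (Real.log d / d))) +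
      (lf l N - ((N:ℝ) * (Real.log N - 1) * hs l - N * gs l)) := by
      simp only [lf, hs, gs, List.map_cons, List.sum_cons]
      ring
    rw [e]
    refine (abs_add_le _ _).trans ?_
    rw [List.length_cons]
    push_cast
    linarith

noncomputable def Am : ℝ := gs Nl - gs Pl - nu0 * (Real.log 131 / 131)

theorem nu0_bd : 0.06673795 ≤ nu0 ∧ nu0 ≤ 0.06673796 := by
  unfold nu0 hs Nl Pl
  simp only [List.map_cons, List.map_nil, List.sum_cons, List.sum_nil]
  constructor <;> norm_num

theorem T_main (N : ℕ) (hN : 131 ≤ N) :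
    |(∑ n ∈ Finset.Ioc 0 N, ArithmeticFunction.vonMangoldt n * Aw (N / n)) - N * Am| ≤ 80.07 * (Real.log N / 2 + 1) := by
  rw [← T_eq]
  have h1 := lf_main Pl N (fun d hd => ⟨(by decide : ∀ d ∈ Pl, 0 < d) d hd, ((by decide : ∀ d ∈ Pl, d ≤ 131) d hd).trans hN⟩)
  have h2 := lf_main Nl N (fun d hd => ⟨(by decide : ∀ d ∈ Nl, 0 < d) d hd, ((by decide : ∀ d ∈ Nl, d ≤ 131) d hd).trans hN⟩)
  have h3 := stir_div (N := N) (d := 131) (by norm_num) hN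
  rw [show Pl.length = 39 from rfl] at h1
  rw [show Nl.length = 41 from rfl] at h2
  have hE : 0 ≤ Real.log N / 2 + 1 := by
    have := Real.log_natCast_nonneg N
    linarith
  obtain ⟨n1, n2⟩ := nu0_bd
  have h4 : |nu0 * (Real.log ((N / 131).factorial : ℝ) - ((N:ℝ) / (131:ℕ) * (Real.log N - 1) - N * (Real.log (131:ℕ) / (131:ℕ))))| ≤ 0.07 * (Real.log N / 2 + 1) := by
    rw [abs_mul, abs_of_nonneg (by linarith)]
    exact mul_le_mul (by linarith) h3 (abs_nonneg _) (by norm_num)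
  have hz : nu0 / 131 = hs Nl - hs Pl := by unfold nu0; ring
  have e : lf Pl N - lf Nl N + nu0 * Real.log ((N / 131).factorial : ℝ) - N * Am =
     (lf Pl N - ((N:ℝ) * (Real.log N - 1) * hs Pl - N * gs Pl)) - (lf Nl N - ((N:ℝ) * (Real.log N - 1) * hs Nl - N * gs Nl))
     + nu0 * (Real.log ((N / 131).factorial : ℝ) - ((N:ℝ) / (131:ℕ) * (Real.log N - 1) - N * (Real.log (131:ℕ) / (131:ℕ)))) := by
    have e2 : nu0 * ((N:ℝ) / (131:ℕ) * (Real.log N - 1)) = N * (Real.log N - 1) * (hs Nl - hs Pl) := by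
      rw [← hz]; push_cast; ring
    rw [mul_sub nu0, mul_sub nu0, e2]
    unfold Am
    push_cast
    ring
  rw [e]
  rw [abs_le] at *
  push_cast at *
  constructor <;> linarith

theorem ls_bd (l : List ℕ) (m : ℕ) (hl : ∀ d ∈ l, 0 < d) : m * hs l - l.length ≤ (ls l m : ℝ) ∧ (ls l m : ℝ) ≤ m * hs l := by
  induction l with
  | nil => simp [ls, hs]
  | cons d l ih =>
    have h1 := ih fun e he => hl e (by simp [he])
    have hd := hl d (by simp)
    have hd' : (0:ℝ) < d := by exact_mod_cast hd
    have h2 : ((m / d : ℕ) : ℝ) ≤ m / d := Nat.cast_div_le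
    have h3 : (m:ℝ) / d - 1 ≤ ((m / d : ℕ) : ℝ) := by
      have := Nat.lt_floor_add_one ((m:ℝ)/d)
      rw [Nat.floor_div_eq_div] at this
      linarith
    unfold ls hs at *
    simp only [List.map_cons, List.sum_cons, List.length_cons, Nat.cast_add, mul_add, Nat.cast_one, mul_one_div] at *
    constructor <;> linarith [h1.1, h1.2]

theorem w_bd (m : ℕ) : 1 - Aw m ≤ 40.25 ∧ -(1 - Aw m) ≤ 40 := by
  have h1 := ls_bd Pl m (by decide)
  have h2 := ls_bd Nl m (by decide)
  rw [show Pl.length = 39 from rfl] at h1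
  rw [show Nl.length = 41 from rfl] at h2
  have h3 : ((m / 131 : ℕ) : ℝ) ≤ m / (131:ℕ) := Nat.cast_div_le
  have h4 : (m:ℝ) / (131:ℕ) - 1 ≤ ((m / 131 : ℕ) : ℝ) := by
    have := Nat.lt_floor_add_one ((m:ℝ)/(131:ℕ))
    rw [Nat.floor_div_eq_div] at this
    linarith
  obtain ⟨n1, n2⟩ := nu0_bd
  have hz : nu0 / 131 = hs Nl - hs Pl := by unfold nu0; ring
  have e : nu0 * ((m:ℝ) / (131:ℕ)) = m * hs Nl - m * hs Pl := by
    rw [← mul_sub, ← hz]; push_cast; ring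
  have h5 := mul_le_mul_of_nonneg_left h3 (show 0 ≤ nu0 by linarith)
  have h6 := mul_le_mul_of_nonneg_left h4 (show 0 ≤ nu0 by linarith)
  rw [mul_sub, e] at h6
  rw [e] at h5
  unfold Aw
  push_cast at *
  constructor <;> linarith [h1.1, h1.2, h2.1, h2.2]

theorem CK_w {m U L : ℕ} (h : CK m U L) : 1 - Aw m ≤ ((U:ℤ):ℝ) / 4 - 41 ∧ -(1 - Aw m) ≤ ((L:ℤ):ℝ) / 4 - 41 := by
  obtain ⟨h1, h2⟩ := h
  have h1' : (100000000:ℝ) * (42 + ls Nl m) ≤ 100000000 * ls Pl m + (6673795 * ((m / 131 : ℕ) : ℝ) + 25000000 * U) := by exact_mod_cast h1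
  have h2' : (100000000:ℝ) * (41 + ls Pl m) + 6673796 * ((m / 131 : ℕ) : ℝ) ≤ 100000000 * (ls Nl m + 1) + 25000000 * L := by exact_mod_cast h2
  obtain ⟨n1, n2⟩ := nu0_bd
  have h0 : (0:ℝ) ≤ ((m / 131 : ℕ) : ℝ) := Nat.cast_nonneg _
  unfold Aw
  have := mul_le_mul_of_nonneg_right n1 h0
  have := mul_le_mul_of_nonneg_right n2 h0
  push_cast at *
  constructor <;> linarith

def tabP : List (ℕ × ℕ) := [(1,0), (6,338816), (10,435411), (14,499037), (15,512083), (21,575709), (22,584506), (26,616096), (33,661178), 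
  (34,666823), (35,672305), (38,687856), (39,692768), (46,723984), (51,743496), (55,757774), (57,764528), 
  (58,767817), (62,780428), (65,789363), (69,800656), (74,813885), (77,821400), (82,833297), (85,840091), 
  (86,842303), (87,844489), (91,852989), (93,857100), (94,859123), (95,861124), (106,881841), (111,890557), 
  (115,897252), (118,902121), (119,903717), (122,908425), (123,909969), (129,918975)]
def tabN : List (ℕ × ℕ) := [(2,131072), (3,207744), (5,304339), (7,367965), (11,453434), (13,485024), (17,535751), (19,556784), 
  (23,592912), (29,636745), (30,643155), (31,649356), (37,682813), (41,702225), (42,706781), (43,711231), 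
  (47,728051), (53,750769), (59,771049), (61,777353), (66,792250), (67,795094), (70,803377), (71,806059), 
  (73,811312), (78,823840), (79,826249), (83,835589), (89,848787), (97,865063), (101,872705), (102,874568), 
  (103,876412), (105,880049), (107,883617), (109,887119), (110,888846), (113,893934), (114,895600), 
  (127,916020), (130,920435)]
def tabck (l : List (ℕ × ℕ)) : Bool :=
  List.rec true (fun s _ ih => and (Nat.ble (Nat.pow 2 s.2) (Nat.pow s.1 131072))
    (and (Nat.ble (Nat.pow s.1 131072) (Nat.pow 2 (Nat.succ s.2))) ih)) l
theorem tabck_run : tabck ((131, 921884) :: (tabP ++ tabN)) = true := by decide +kernel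
theorem tabck_spec (l : List (ℕ × ℕ)) (h : tabck l = true) : ∀ s ∈ l, (1 ≤ s.1) →
    (s.2 : ℝ) * (Real.log 2 / 131072) ≤ Real.log s.1 ∧ Real.log s.1 ≤ (s.2 + 1 : ℝ) * (Real.log 2 / 131072) := by
  induction l with
  | nil => simp
  | cons s l ih =>
    have h' : (and (Nat.ble (2 ^ s.2) (s.1 ^ 131072)) (and (Nat.ble (s.1 ^ 131072) (2 ^ (s.2 + 1))) (tabck l))) = true := h
    rw [Bool.and_eq_true, Bool.and_eq_true] at h'
    obtain ⟨h1, h2, h3⟩ := h'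
    have h1 := Nat.le_of_ble_eq_true h1
    have h2 := Nat.le_of_ble_eq_true h2
    intro t ht ht1
    rcases List.mem_cons.1 ht with rfl | ht
    · have a1 := le_log_of_two_pow_le h1
      have a2 := log_le_of_le_two_pow (pow_pos ht1 _) h2
      rw [Nat.cast_pow, Real.log_pow] at a1 a2
      push_cast at a1 a2
      constructor <;> linarith
    · exact ih h3 t ht ht1
theorem gs_bd (l : List (ℕ × ℕ)) (h : ∀ s ∈ l, 1 ≤ s.1 ∧ (s.2 : ℝ) * (Real.log 2 / 131072) ≤ Real.log s.1 ∧ Real.log s.1 ≤ (s.2 + 1 : ℝ) * (Real.log 2 / 131072)) :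
    (l.map fun s => (s.2 : ℝ) / s.1).sum * (Real.log 2 / 131072) ≤ gs (l.map fun s => s.1) ∧
    gs (l.map fun s => s.1) ≤ (l.map fun s => (s.2 + 1 : ℝ) / s.1).sum * (Real.log 2 / 131072) := by
  induction l with
  | nil => simp [gs]
  | cons s l ih =>
    have h1 := ih fun t ht => h t (by simp [ht])
    obtain ⟨h2, h3, h4⟩ := h s (by simp)
    have hp : (0:ℝ) < s.1 := by exact_mod_cast h2
    unfold gs at *
    simp only [List.map_cons, List.sum_cons, add_mul] at *
    have h5 : (s.2 : ℝ) / s.1 * (Real.log 2 / 131072) ≤ Real.log s.1 / s.1 := by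
      rw [div_mul_eq_mul_div]; gcongr
    have h6 : Real.log s.1 / s.1 ≤ (s.2 + 1 : ℝ) / s.1 * (Real.log 2 / 131072) := by
      rw [div_mul_eq_mul_div]; gcongr; linarith
    constructor <;> linarith [h1.1, h1.2]
theorem Am_bd : 0.99948 ≤ Am ∧ Am ≤ 0.99953 := by
  have hs := tabck_spec _ tabck_run
  have hp := gs_bd tabP (fun s h => ⟨(by decide : ∀ s ∈ tabP, 1 ≤ s.1) s h, hs s (by simp [h]) ((by decide : ∀ s ∈ tabP, 1 ≤ s.1) s h)⟩)
  have hn := gs_bd tabN (fun s h => ⟨(by decide : ∀ s ∈ tabN, 1 ≤ s.1) s h, hs s (by simp [h]) ((by decide : ∀ s ∈ tabN, 1 ≤ s.1) s h)⟩)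
  have h1 := hs (131, 921884) (by simp) (by norm_num)
  rw [show (tabP.map fun s => s.1) = Pl from rfl] at hp
  rw [show (tabN.map fun s => s.1) = Nl from rfl] at hn
  have hl2 := Real.log_two_gt_d9
  have hl2' := Real.log_two_lt_d9
  obtain ⟨n1, n2⟩ := nu0_bd
  have p1 : 608634 ≤ (tabP.map fun s => (s.2 : ℝ) / s.1).sum ∧ (tabP.map fun s => (s.2 + 1 : ℝ) / s.1).sum ≤ 608637 := by
    unfold tabP
    simp only [List.map_cons, List.map_nil, List.sum_cons, List.sum_nil]
    constructor <;> norm_num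
  have q1 : 798107.6 ≤ (tabN.map fun s => (s.2 : ℝ) / s.1).sum ∧ (tabN.map fun s => (s.2 + 1 : ℝ) / s.1).sum ≤ 798109.8 := by
    unfold tabN
    simp only [List.map_cons, List.map_nil, List.sum_cons, List.sum_nil]
    constructor <;> norm_num
  have c1 : 5.28829e-6 ≤ Real.log 2 / 131072 := by linarith
  have c2 : Real.log 2 / 131072 ≤ 5.28831e-6 := by linarith
  generalize Real.log 2 / 131072 = c at *
  push_cast at h1
  have d1 : 0.03721 ≤ Real.log 131 / 131 := by linarith
  have d2 : Real.log 131 / 131 ≤ 0.03722 := by linarith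
  have e1 := mul_le_mul n1 d1 (by norm_num) (by linarith)
  have e2 := mul_le_mul n2 d2 (by linarith) (by norm_num)
  unfold Am
  generalize (tabP.map fun s => (s.2 : ℝ) / s.1).sum = P1 at *
  generalize (tabP.map fun s => (s.2 + 1 : ℝ) / s.1).sum = P2 at *
  generalize (tabN.map fun s => (s.2 : ℝ) / s.1).sum = N1 at *
  generalize (tabN.map fun s => (s.2 + 1 : ℝ) / s.1).sum = N2 at *
  have f1 : (N1 - P2) * c ≥ (798107.6 - 608637) * c := mul_le_mul_of_nonneg_right (by linarith) (by linarith)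
  have f2 : (N2 - P1) * c ≤ (798109.8 - 608634) * c := mul_le_mul_of_nonneg_right (by linarith) (by linarith)
  constructor <;> linarith

/-- weighted von Mangoldt sum over the tail -/
noncomputable def Sv (v : ℕ → ℝ) (N m : ℕ) : ℝ :=
  ∑ n ∈ Finset.Ioc 0 (N / (m+1)), ArithmeticFunction.vonMangoldt n * v (N / n)

theorem psi_nat (n : ℕ) : Chebyshev.psi (n:ℝ) = ∑ k ∈ Finset.Ioc 0 n, ArithmeticFunction.vonMangoldt k := by
  unfold Chebyshev.psi; rw [Nat.floor_natCast]

theorem Sv_step (v : ℕ → ℝ) (N m len : ℕ) (a : ℝ) (h : ∀ m', m < m' → m' ≤ m + len → v m' ≤ a) :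
    Sv v N m ≤ a * (Chebyshev.psi ((N / (m+1) : ℕ) : ℝ) - Chebyshev.psi ((N / (m+len+1) : ℕ) : ℝ)) + Sv v N (m+len) := by
  have hle : N / (m+len+1) ≤ N / (m+1) := Nat.div_le_div_left (by omega) (by omega)
  have key : ∀ f : ℕ → ℝ, ∑ n ∈ Finset.Ioc 0 (N / (m+1)), f n = ∑ n ∈ Finset.Ioc 0 (N / (m+len+1)), f n
      + ∑ n ∈ Finset.Ioc (N / (m+len+1)) (N / (m+1)), f n := fun f =>
    (Finset.sum_Ioc_consecutive f (Nat.zero_le _) hle).symm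
  rw [psi_nat, psi_nat, key, add_sub_cancel_left]
  unfold Sv
  rw [key]
  have : ∑ n ∈ Finset.Ioc (N / (m+len+1)) (N / (m+1)), ArithmeticFunction.vonMangoldt n * v (N / n) ≤
      ∑ n ∈ Finset.Ioc (N / (m+len+1)) (N / (m+1)), a * ArithmeticFunction.vonMangoldt n := by
    refine Finset.sum_le_sum fun n hn => ?_
    rw [mul_comm]
    refine mul_le_mul_of_nonneg_right ?_ ArithmeticFunction.vonMangoldt_nonneg
    simp only [Finset.mem_Ioc] at hn
    have hn0 : 0 < n := lt_of_le_of_lt (Nat.zero_le _) hn.1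
    apply h
    · have := (Nat.le_div_iff_mul_le (by omega)).1 hn.2
      rw [Nat.lt_iff_add_one_le, Nat.le_div_iff_mul_le hn0, mul_comm]; exact this
    · have := (Nat.div_lt_iff_lt_mul (by omega)).1 hn.1
      have : N / n < m + len + 1 := by rw [Nat.div_lt_iff_lt_mul hn0, mul_comm]; exact this
      omega
  rw [← Finset.mul_sum] at this
  linarith

theorem Sv_end (v : ℕ → ℝ) (N m : ℕ) (a : ℝ) (h : ∀ m', v m' ≤ a) :
    Sv v N m ≤ a * Chebyshev.psi ((N / (m+1) : ℕ) : ℝ) := by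
  rw [psi_nat, Finset.mul_sum]
  unfold Sv
  refine Finset.sum_le_sum fun n _ => ?_
  rw [mul_comm]
  exact mul_le_mul_of_nonneg_right (h _) ArithmeticFunction.vonMangoldt_nonneg

def cu (k : ℕ) : ℤ := ((10165000000 / k + 1 + (if k ≤ 511 then 0 else 38148) : ℕ) : ℤ)
def cd (k : ℕ) : ℤ := ((9830000000 / k : ℕ) : ℤ) - (if k ≤ 511 then 0 else 76294)
def cost (δ : ℤ) (k : ℕ) : ℤ := if 0 ≤ δ then δ * cu k else δ * cd k
def Zs (E : ℤ) : List (ℕ × ℕ) → ℕ → ℤ → ℤ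
  | [], m, prev => cost (E - prev) (m+1)
  | s :: r, m, prev => cost ((s.2 : ℤ) - prev) (m+1) + Zs E r (m + s.1) (s.2 : ℤ)

theorem cost_spec {N k : ℕ} (hN : 2^20 < N) (ih : ∀ j < N, Fair j ∧ (2048 < j → Good j)) (hk : 2 ≤ k) (δ : ℤ) :
    (δ : ℝ) * Chebyshev.psi ((N / k : ℕ) : ℝ) ≤ N * (cost δ k : ℝ) / 10^10 := by
  have hk0 : 0 < k := by omega
  have hkr : (0:ℝ) < k := by exact_mod_cast hk0
  have hNr : (2^20 : ℝ) < N := by exact_mod_cast hN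
  have hj : N / k < N := Nat.div_lt_self (by omega) hk
  obtain ⟨hf, hg⟩ := ih _ hj
  have h1 : ((N / k : ℕ) : ℝ) ≤ N / k := Nat.cast_div_le
  have h2 : (N:ℝ) / k ≤ ((N / k : ℕ) : ℝ) + 1 := by
    have := Nat.lt_floor_add_one ((N:ℝ)/k)
    rw [Nat.floor_div_eq_div] at this
    linarith
  have hbig : k ≤ 511 → 2048 < N / k := by
    intro h
    rw [Nat.lt_iff_add_one_le, Nat.le_div_iff_mul_le hk0]
    nlinarith
  have hcu : Chebyshev.psi ((N / k : ℕ) : ℝ) ≤ N * (cu k : ℝ) / 10^10 := by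
    have a1 : (10165000000 : ℝ) / k ≤ ((10165000000 / k : ℕ) : ℝ) + 1 := by
      have := Nat.lt_floor_add_one (((10165000000:ℕ):ℝ)/k)
      rw [Nat.floor_div_eq_div] at this
      push_cast at this ⊢
      linarith
    have a2 : 1.0165 * ((N:ℝ) / k) ≤ N * (((10165000000 / k : ℕ) : ℝ) + 1) / 10^10 := by
      have : 1.0165 * ((N:ℝ) / k) = N * (10165000000 / k) / 10^10 := by ring
      rw [this]
      gcongr
    unfold cu
    generalize 10165000000 / k = q at *
    split_ifs with h
    · have := (hg (hbig h)).1
      push_cast at *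
      linarith
    · have := hf.1
      push_cast at *
      have : (N:ℝ) * ((q : ℝ) + 1 + 38148) / 10^10 = N * ((q : ℝ) + 1) / 10^10 + N * (38148 / 10^10) := by ring
      push_cast at *
      linarith
  have hcd : N * (cd k : ℝ) / 10^10 ≤ Chebyshev.psi ((N / k : ℕ) : ℝ) := by
    have a1 : ((9830000000 / k : ℕ) : ℝ) ≤ ((9830000000 : ℕ):ℝ) / k := Nat.cast_div_le
    have a2 : N * (((9830000000 / k : ℕ) : ℝ)) / 10^10 ≤ 0.983 * ((N:ℝ) / k) := by
      have : 0.983 * ((N:ℝ) / k) = N * (((9830000000 : ℕ):ℝ) / k) / 10^10 := by push_cast; ring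
      rw [this]
      gcongr
    unfold cd
    generalize 9830000000 / k = q at *
    split_ifs with h
    · have := (hg (hbig h)).2
      push_cast at *
      linarith
    · have := hf.2
      have : (N:ℝ) * ((q : ℝ) - 76294) / 10^10 = N * (q : ℝ) / 10^10 - N * (76294 / 10^10) := by ring
      push_cast at *
      linarith
  unfold cost
  split_ifs with h
  · have h' : (0:ℝ) ≤ δ := by exact_mod_cast h
    have := mul_le_mul_of_nonneg_left hcu h'
    push_cast
    linarith
  · have h' : (δ:ℝ) ≤ 0 := by exact_mod_cast (not_le.1 h).le
    have := mul_le_mul_of_nonpos_left hcd h'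
    push_cast
    linarith

def Vok (v : ℕ → ℝ) : List (ℕ × ℕ) → ℕ → Prop
  | [], _ => True
  | s :: r, m => (∀ m', m < m' → m' ≤ m + s.1 → v m' ≤ ((s.2 : ℤ) : ℝ) / 4 - 41) ∧ Vok v r (m + s.1)

theorem Zs_spec {N : ℕ} (hN : 2^20 < N) (ih : ∀ j < N, Fair j ∧ (2048 < j → Good j)) (v : ℕ → ℝ) (E : ℤ)
    (hE : ∀ m', v m' ≤ (E : ℝ) / 4 - 41) (l : List (ℕ × ℕ)) : ∀ m (prev : ℤ), 1 ≤ m → Vok v l m →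
    Sv v N m ≤ ((prev:ℝ) / 4 - 41) * Chebyshev.psi ((N / (m+1) : ℕ) : ℝ) + N * (Zs E l m prev : ℝ) / (4 * 10^10) := by
  induction l with
  | nil =>
    intro m prev hm _
    have h1 := Sv_end v N m _ hE
    have h2 := cost_spec hN ih (k := m+1) (by omega) (E - prev)
    have e : Zs E [] m prev = cost (E - prev) (m+1) := rfl
    rw [e]
    push_cast at *
    linarith
  | cons s r ihl =>
    intro m prev hm hv
    have h1 := Sv_step v N m s.1 _ hv.1
    have h3 := ihl (m + s.1) (s.2 : ℤ) (by omega) hv.2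
    have h2 := cost_spec hN ih (k := m+1) (by omega) ((s.2:ℤ) - prev)
    have e : Zs E (s :: r) m prev = cost ((s.2 : ℤ) - prev) (m+1) + Zs E r (m + s.1) (s.2 : ℤ) := rfl
    rw [e]
    push_cast at *
    linarith

def lU : List (ℕ × ℕ) := segs.map fun s => (s.1, s.2.1)
def lL : List (ℕ × ℕ) := segs.map fun s => (s.1, s.2.2)

theorem vok_of (l : List (ℕ × ℕ × ℕ)) : ∀ m, SegsOK l m →
    Vok (fun m => 1 - Aw m) (l.map fun s => (s.1, s.2.1)) m ∧ Vok (fun m => -(1 - Aw m)) (l.map fun s => (s.1, s.2.2)) m := by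
  induction l with
  | nil => intro m _; exact ⟨trivial, trivial⟩
  | cons s r ih =>
    intro m h
    obtain ⟨h1, h2⟩ := ih _ h.2
    exact ⟨⟨fun m' a b => (CK_w (h.1 m' a b)).1, h1⟩, ⟨fun m' a b => (CK_w (h.1 m' a b)).2, h2⟩⟩

theorem sum_first {N : ℕ} (hN : 2^20 < N) (ih : ∀ j < N, Fair j ∧ (2048 < j → Good j)) (v : ℕ → ℝ) (E : ℤ)
    (hE : ∀ m', v m' ≤ (E : ℝ) / 4 - 41) (l : List (ℕ × ℕ)) (len : ℕ) (hlen : 1 ≤ len) (hv : Vok v ((len, 164) :: l) 0) :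
    ∑ n ∈ Finset.Ioc 0 N, ArithmeticFunction.vonMangoldt n * v (N / n) ≤ N * (Zs E l len 164 : ℝ) / (4 * 10^10) := by
  have h1 := Sv_step v N 0 len _ hv.1
  have h2 := Zs_spec hN ih v E hE l (0+len) 164 (by omega) hv.2
  have e : Sv v N 0 = ∑ n ∈ Finset.Ioc 0 N, ArithmeticFunction.vonMangoldt n * v (N / n) := by
    unfold Sv; simp
  rw [e] at h1
  rw [zero_add] at h2
  norm_num at h1 h2 ⊢
  linarith

theorem Zu_run : Zs 325 (lU.tail) 130 164 ≤ 647000000 := by decide +kernel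
theorem Zl_run : Zs 324 (lL.tail) 130 164 ≤ 630000000 := by decide +kernel

theorem logN_bd {N : ℕ} (hN : 2^20 < N) : 80.07 * (Real.log N / 2 + 1) ≤ 0.000606 * N := by
  have hNr : (1048576 : ℝ) < N := by exact_mod_cast (show 1048576 < N by norm_num at hN; exact hN)
  have h1 := Real.log_le_sub_one_of_pos (show (0:ℝ) < N / 2^20 by positivity)
  rw [Real.log_div (by positivity) (by positivity), Real.log_pow] at h1
  have := Real.log_two_lt_d9
  push_cast at h1
  norm_num at h1 ⊢
  linarith

theorem good_step {N : ℕ} (hN : 2^20 < N) (ih : ∀ j < N, Fair j ∧ (2048 < j → Good j)) : Good N := by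
  have hNr : (1048576 : ℝ) < N := by exact_mod_cast (show 1048576 < N by norm_num at hN; exact hN)
  obtain ⟨hU, hL⟩ := vok_of segs 0 segs_ok
  have h1 := sum_first hN ih (fun m => 1 - Aw m) 325 (fun m => by have := (w_bd m).1; norm_num at this ⊢; linarith) lU.tail 130 (by norm_num) hU
  have h2 := sum_first hN ih (fun m => -(1 - Aw m)) 324 (fun m => by have := (w_bd m).2; norm_num at this ⊢; linarith) lL.tail 130 (by norm_num) hL
  have h3 := T_main N (by omega)
  have h4 := logN_bd hN
  have e : ∑ n ∈ Finset.Ioc 0 N, ArithmeticFunction.vonMangoldt n * (1 - Aw (N / n)) = Chebyshev.psi (N:ℝ) -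
      ∑ n ∈ Finset.Ioc 0 N, ArithmeticFunction.vonMangoldt n * Aw (N / n) := by
    rw [psi_nat, ← Finset.sum_sub_distrib]
    exact Finset.sum_congr rfl fun n _ => by ring
  have e2 : ∑ n ∈ Finset.Ioc 0 N, ArithmeticFunction.vonMangoldt n * -(1 - Aw (N / n)) = -(Chebyshev.psi (N:ℝ) -
      ∑ n ∈ Finset.Ioc 0 N, ArithmeticFunction.vonMangoldt n * Aw (N / n)) := by
    rw [← e, ← Finset.sum_neg_distrib]
    exact Finset.sum_congr rfl fun n _ => by ring
  rw [e] at h1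
  rw [e2] at h2
  have z1 : ((Zs 325 (lU.tail) 130 164 : ℤ) : ℝ) ≤ 647000000 := by exact_mod_cast Zu_run
  have z2 : ((Zs 324 (lL.tail) 130 164 : ℤ) : ℝ) ≤ 630000000 := by exact_mod_cast Zl_run
  have y1 : (N:ℝ) * ((Zs 325 (lU.tail) 130 164 : ℤ) : ℝ) / (4 * 10^10) ≤ N * 647000000 / (4 * 10^10) := by gcongr
  have y2 : (N:ℝ) * ((Zs 324 (lL.tail) 130 164 : ℤ) : ℝ) / (4 * 10^10) ≤ N * 630000000 / (4 * 10^10) := by gcongr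
  obtain ⟨a1, a2⟩ := Am_bd
  have b1 := mul_le_mul_of_nonneg_left a1 (show (0:ℝ) ≤ N by positivity)
  have b2 := mul_le_mul_of_nonneg_left a2 (show (0:ℝ) ≤ N by positivity)
  rw [abs_le] at h3
  constructor
  · linarith [h3.2]
  · linarith [h3.1]

theorem fair_of_good {m : ℕ} (h : Good m) : Fair m := ⟨by linarith [h.1], by linarith [h.2]⟩

theorem all_fg (n : ℕ) : Fair n ∧ (2048 < n → Good n) := by
  induction n using Nat.strong_induction_on with
  | _ N ih =>
    rcases Nat.lt_or_ge (2^20) N with h | h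
    · have := good_step h ih
      exact ⟨fair_of_good this, fun _ => this⟩
    · rcases Nat.lt_or_ge 2048 N with h' | h'
      · have := base_good h' h
        exact ⟨fair_of_good this, fun _ => this⟩
      · exact ⟨base_fair h', fun h => by omega⟩

theorem psi_up {t : ℝ} (ht : 0 ≤ t) : Chebyshev.psi t ≤ 1.0165 * t + 4 := by
  rw [Chebyshev.psi_eq_psi_coe_floor]
  have := (all_fg ⌊t⌋₊).1.1
  have := Nat.floor_le ht
  linarith

theorem psi_lo {t : ℝ} (ht : 2049 ≤ t) : 0.983 * t ≤ Chebyshev.psi t := by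
  rw [Chebyshev.psi_eq_psi_coe_floor]
  have h : 2049 ≤ ⌊t⌋₊ := Nat.le_floor (by exact_mod_cast ht)
  have := ((all_fg ⌊t⌋₊).2 (by omega)).2
  have := Nat.lt_floor_add_one t
  linarith

theorem psi_lo' {t : ℝ} (ht : 0 ≤ t) : 0.983 * t - 8 ≤ Chebyshev.psi t := by
  rw [Chebyshev.psi_eq_psi_coe_floor]
  have := (all_fg ⌊t⌋₊).1.2
  have := Nat.lt_floor_add_one t
  linarith

/-! ## Rough numbers and the logarithmic method -/

def Rgh (N n : ℕ) : Prop := ∀ p : ℕ, p.Prime → p ∣ n → N ≤ p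

open Classical in
noncomputable def RS (N : ℕ) (x : ℝ) : Finset ℕ := (Finset.Icc 1 ⌊x⌋₊).filter (Rgh N)

noncomputable def Ph (N : ℕ) (x : ℝ) : ℝ := ((RS N x).card : ℝ)

noncomputable def Jf (N : ℕ) (z : ℝ) : ℝ := ∑ m ∈ RS N z, (1 / (m : ℝ) - 1 / z)

noncomputable def If (N : ℕ) (x : ℝ) : ℝ := ∑ n ∈ RS N x, Real.log (x / n)

noncomputable def ef (N : ℕ) : ℝ := 1.0165 * N + 4 - Chebyshev.psi ((N : ℝ) - 1)

theorem mem_RS {N : ℕ} {x : ℝ} {n : ℕ} (hx : 0 ≤ x) : n ∈ RS N x ↔ 1 ≤ n ∧ (n : ℝ) ≤ x ∧ Rgh N n := by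
  classical
  rw [RS, Finset.mem_filter, Finset.mem_Icc, Nat.le_floor_iff hx, and_assoc]

theorem RS_floor (N : ℕ) (x : ℝ) : RS N x = RS N ((⌊x⌋₊ : ℕ) : ℝ) := by
  rw [RS, RS, Nat.floor_natCast]

theorem Ph_floor (N : ℕ) (x : ℝ) : Ph N x = Ph N ((⌊x⌋₊ : ℕ) : ℝ) := by
  rw [Ph, Ph, RS_floor]

theorem Ph_nonneg (N : ℕ) (x : ℝ) : 0 ≤ Ph N x := Nat.cast_nonneg _

theorem RS_mono (N : ℕ) {x y : ℝ} (h : x ≤ y) : RS N x ⊆ RS N y := by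
  classical
  exact Finset.filter_subset_filter _ (Finset.Icc_subset_Icc_right (Nat.floor_mono h))

theorem Ph_mono (N : ℕ) {x y : ℝ} (h : x ≤ y) : Ph N x ≤ Ph N y := by
  rw [Ph, Ph]; exact_mod_cast Finset.card_le_card (RS_mono N h)

theorem ef_nonneg {N : ℕ} (hN : 1 ≤ N) : 0 ≤ ef N := by
  have h1 : (1:ℝ) ≤ N := by exact_mod_cast hN
  have := psi_up (t := (N:ℝ) - 1) (by linarith)
  rw [ef]; linarith

theorem rgh_dvd {N n m : ℕ} (h : Rgh N n) (hm : m ∣ n) : Rgh N m :=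
  fun p hp hpm => h p hp (hpm.trans hm)

theorem log_sum_bound {N : ℕ} (hN : 1 ≤ N) {x : ℝ} (hx : 0 ≤ x) :
    ∑ n ∈ RS N x, Real.log n ≤
      ∑ m ∈ RS N (x / N), (Chebyshev.psi (x / m) - Chebyshev.psi ((N:ℝ) - 1)) := by
  classical
  have hN' : (0:ℝ) < N := by exact_mod_cast hN
  have h1 : ∀ n ∈ RS N x, Real.log n = ∑ d ∈ n.divisors.filter (fun d => N ≤ d), ArithmeticFunction.vonMangoldt d := by
    intro n hn
    rw [mem_RS hx] at hn
    rw [← ArithmeticFunction.vonMangoldt_sum, Finset.sum_filter]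
    refine Finset.sum_congr rfl fun d hd => ?_
    split_ifs with h
    · rfl
    · rw [ArithmeticFunction.vonMangoldt_eq_zero_iff]
      intro hpp
      apply h
      obtain ⟨p, k, hp, hk, rfl⟩ := hpp
      have hp' := hp.nat_prime
      have : p ∣ n := (dvd_pow_self p hk.ne').trans (Nat.dvd_of_mem_divisors hd)
      exact (hn.2.2 p hp' this).trans (Nat.le_self_pow hk.ne' p)
  have h2 : ∀ m ∈ RS N (x / N), Chebyshev.psi (x / m) - Chebyshev.psi ((N:ℝ) - 1) =
      ∑ d ∈ Finset.Icc N ⌊x / m⌋₊, ArithmeticFunction.vonMangoldt d := by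
    intro m hm
    rw [mem_RS (by positivity)] at hm
    have hm0 : (0:ℝ) < m := by exact_mod_cast hm.1
    have hle : N ≤ ⌊x / m⌋₊ := by
      apply Nat.le_floor
      rw [le_div_iff₀ hm0]
      have := hm.2.1
      rw [le_div_iff₀ hN'] at this
      linarith
    have hf : ⌊(N:ℝ) - 1⌋₊ = N - 1 := by
      have : ((N:ℝ) - 1) = ((N - 1 : ℕ) : ℝ) := by push_cast [Nat.cast_sub hN]; ring
      rw [this, Nat.floor_natCast]
    rw [Chebyshev.psi, Chebyshev.psi, hf, sub_eq_iff_eq_add, add_comm]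
    rw [← Finset.sum_union]
    · apply Finset.sum_congr _ fun _ _ => rfl
      ext d; simp only [Finset.mem_union, Finset.mem_Ioc, Finset.mem_Icc]; omega
    · rw [Finset.disjoint_left]; intro d; simp only [Finset.mem_Ioc, Finset.mem_Icc]; omega
  rw [Finset.sum_congr rfl h1, Finset.sum_congr rfl h2, Finset.sum_sigma', Finset.sum_sigma']
  let f : (Σ _ : ℕ, ℕ) → (Σ _ : ℕ, ℕ) := fun a => ⟨a.1 / a.2, a.2⟩
  set A := (RS N x).sigma (fun n => n.divisors.filter (fun d => N ≤ d)) with hA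
  have hinj : Set.InjOn f A := by
    rintro ⟨a, d⟩ ha ⟨a', d'⟩ ha' h
    simp only [hA, Finset.coe_sigma, Set.mem_sigma_iff, Finset.mem_coe, Finset.mem_filter, Nat.mem_divisors] at ha ha'
    simp only [f, Sigma.mk.injEq, heq_eq_eq] at h
    obtain ⟨h, rfl⟩ := h
    have : a = a' := by
      rw [← Nat.div_mul_cancel ha.2.1.1, ← Nat.div_mul_cancel ha'.2.1.1, h]
    rw [this]
  have : ∑ a ∈ A, ArithmeticFunction.vonMangoldt a.2 = ∑ a ∈ A.image f, ArithmeticFunction.vonMangoldt a.2 := by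
    rw [Finset.sum_image hinj]
  rw [this]
  apply Finset.sum_le_sum_of_subset_of_nonneg
  · intro b hb
    rw [Finset.mem_image] at hb
    obtain ⟨⟨n, d⟩, ha, rfl⟩ := hb
    simp only [hA, Finset.mem_sigma, Finset.mem_filter, Nat.mem_divisors, mem_RS hx] at ha
    obtain ⟨⟨h1, h2, h3⟩, ⟨hd, -⟩, hNd⟩ := ha
    have hd0 : 0 < d := by omega
    obtain ⟨m, rfl⟩ := hd
    have hm : 0 < m := by
      rcases Nat.eq_zero_or_pos m with h | h
      · subst h; omega
      · exact h
    have hmr : (0:ℝ) < m := by exact_mod_cast hm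
    have hNdr : (N:ℝ) ≤ d := by exact_mod_cast hNd
    push_cast at h2
    simp only [f, Finset.mem_sigma, Finset.mem_Icc, Nat.mul_div_cancel_left m hd0]
    rw [mem_RS (by positivity)]
    refine ⟨⟨hm, ?_, rgh_dvd h3 (Dvd.intro_left _ rfl)⟩, hNd, ?_⟩
    · rw [le_div_iff₀ hN']; nlinarith
    · apply Nat.le_floor; rw [le_div_iff₀ hmr]; exact h2
  · intro _ _ _; exact ArithmeticFunction.vonMangoldt_nonneg

theorem log_method {N : ℕ} (hN : 1 ≤ N) {x : ℝ} (hx : 1 ≤ x) :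
    Ph N x * Real.log x ≤ If N x + 1.0165 * x * Jf N (x / N) + ef N * Ph N (x / N) := by
  have hN' : (0:ℝ) < N := by exact_mod_cast hN
  have hx0 : 0 < x := by linarith
  have h1 : Ph N x * Real.log x = If N x + ∑ n ∈ RS N x, Real.log n := by
    rw [If, ← Finset.sum_add_distrib, Ph, ← nsmul_eq_mul, ← Finset.sum_const]
    refine Finset.sum_congr rfl fun n hn => ?_
    rw [mem_RS hx0.le] at hn
    have : (n:ℝ) ≠ 0 := by have := hn.1; positivity
    rw [Real.log_div hx0.ne' this]; ring
  have h2 := log_sum_bound hN hx0.le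
  have h3 : ∑ m ∈ RS N (x / N), (Chebyshev.psi (x / m) - Chebyshev.psi ((N:ℝ) - 1)) ≤
      1.0165 * x * Jf N (x / N) + ef N * Ph N (x / N) := by
    rw [Jf, Ph, mul_comm (ef N), ← nsmul_eq_mul, ← Finset.sum_const, Finset.mul_sum, ← Finset.sum_add_distrib]
    refine Finset.sum_le_sum fun m hm => ?_
    have := psi_up (t := x / m) (by positivity)
    rw [ef]
    have e1 : 1.0165 * x * (1 / (m:ℝ) - 1 / (x / N)) = 1.0165 * (x / m) - 1.0165 * N := by
      field_simp
    rw [e1]; linarith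
  linarith

theorem If_succ (N : ℕ) {k : ℕ} (hk : 1 ≤ k) : If N ((k+1 : ℕ) : ℝ) = If N k + Ph N k * Real.log ((k+1)/k) := by
  classical
  have hk0 : (0:ℝ) < k := by exact_mod_cast hk
  have h : ∀ g : ℕ → ℝ, g (k+1) = 0 → ∑ n ∈ RS N ((k+1 : ℕ) : ℝ), g n = ∑ n ∈ RS N k, g n := by
    intro g hg
    symm
    apply Finset.sum_subset (RS_mono N (by push_cast; linarith))
    intro n hn hn'
    rw [mem_RS (by positivity)] at hn hn'
    have h2 := hn.2.1
    have : n ≤ k + 1 := by exact_mod_cast h2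
    have : n = k + 1 := by
      by_contra hne
      exact hn' ⟨hn.1, by exact_mod_cast (by omega : n ≤ k), hn.2.2⟩
    rw [this, hg]
  rw [If, h _ (by rw [div_self (by positivity)]; simp), If, Ph, ← nsmul_eq_mul, ← Finset.sum_const, ← Finset.sum_add_distrib]
  refine Finset.sum_congr rfl fun n hn => ?_
  rw [mem_RS (by positivity)] at hn
  have : (0:ℝ) < n := by exact_mod_cast hn.1
  rw [← Real.log_mul (by positivity) (by positivity)]
  congr 1; push_cast; field_simp

theorem Jf_step (N : ℕ) {k : ℕ} (hk : 1 ≤ k) {z : ℝ} (h1 : (k:ℝ) ≤ z) (h2 : z ≤ k + 1) :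
    Jf N z = Jf N k + Ph N k * (1 / k - 1 / z) := by
  classical
  have hk0 : (0:ℝ) < k := by exact_mod_cast hk
  have hz : 0 < z := by linarith
  have h : ∑ n ∈ RS N z, (1 / (n : ℝ) - 1 / z) = ∑ n ∈ RS N k, (1 / (n : ℝ) - 1 / z) := by
    symm
    apply Finset.sum_subset (RS_mono N h1)
    intro n hn hn'
    rw [mem_RS (by positivity)] at hn hn'
    have h3 : (n:ℝ) ≤ ((k + 1 : ℕ) : ℝ) := by push_cast; linarith [hn.2.1]
    have : n ≤ k + 1 := by exact_mod_cast h3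
    have : n = k + 1 := by
      by_contra hne
      exact hn' ⟨hn.1, by exact_mod_cast (by omega : n ≤ k), hn.2.2⟩
    have h4 := hn.2.1
    have h5 : z = n := by subst this; push_cast at h4 ⊢; linarith
    rw [h5, sub_self]
  rw [Jf, h, Jf, Ph, ← nsmul_eq_mul, ← Finset.sum_const, ← Finset.sum_add_distrib]
  exact Finset.sum_congr rfl fun n _ => by ring

theorem Jf_mono (N : ℕ) {a b : ℝ} (ha : 0 < a) (h : a ≤ b) : Jf N a ≤ Jf N b := by
  rw [Jf, Jf]
  calc ∑ m ∈ RS N a, (1 / (m : ℝ) - 1 / a) ≤ ∑ m ∈ RS N a, (1 / (m : ℝ) - 1 / b) := by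
        refine Finset.sum_le_sum fun m _ => ?_
        have := one_div_le_one_div_of_le ha h
        linarith
    _ ≤ _ := by
        apply Finset.sum_le_sum_of_subset_of_nonneg (RS_mono N h)
        intro m hm _
        rw [mem_RS (by linarith)] at hm
        have := one_div_le_one_div_of_le (by exact_mod_cast hm.1) hm.2.1
        linarith

theorem one_sub_le_log {r : ℝ} (hr : 0 < r) : 1 - 1 / r ≤ Real.log r := by
  have := Real.log_le_sub_one_of_pos (show 0 < 1 / r by positivity)
  rw [one_div, Real.log_inv] at this
  rw [one_div]; linarith

theorem If_grow {N T : ℕ} {κ : ℝ} (hT : 1 ≤ T) (x : ℕ) (hx : T ≤ x)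
    (h : ∀ k : ℕ, T ≤ k → k < x → Ph N k ≤ κ * k) : If N x ≤ If N T + κ * (x - T) := by
  induction x, hx using Nat.le_induction with
  | base => simp
  | succ k hk ih =>
    have ih := ih fun j h1 h2 => h j h1 (by omega)
    have hk0 : (0:ℝ) < k := by exact_mod_cast (by omega : 0 < k)
    have h1 := h k hk (by omega)
    rw [If_succ N (by omega)]
    have h2 : Real.log ((k+1)/k) ≤ 1 / k := by
      have := Real.log_le_sub_one_of_pos (show (0:ℝ) < (k+1)/k by positivity)
      have e : ((k:ℝ)+1)/k - 1 = 1/k := by field_simp; ring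
      linarith
    have h3 : Ph N k * Real.log ((k+1)/k) ≤ κ := by
      calc _ ≤ Ph N k * (1 / k) := mul_le_mul_of_nonneg_left h2 (Ph_nonneg _ _)
        _ ≤ (κ * k) * (1 / k) := mul_le_mul_of_nonneg_right h1 (by positivity)
        _ = κ := by field_simp
    push_cast; linarith

theorem Jf_inc {N k : ℕ} {κ z : ℝ} (hk : 1 ≤ k) (h : Ph N k ≤ κ * k) (hκ : 0 ≤ κ) (h1 : (k:ℝ) ≤ z) (h2 : z ≤ k + 1) :
    Jf N z ≤ Jf N k + κ * (Real.log z - Real.log k) := by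
  have hk0 : (0:ℝ) < k := by exact_mod_cast hk
  have hz : 0 < z := by linarith
  rw [Jf_step N hk h1 h2, ← Real.log_div hz.ne' hk0.ne']
  have h3 := one_sub_le_log (show 0 < z / k by positivity)
  have h4 : (0:ℝ) ≤ 1 / k - 1 / z := by
    have := one_div_le_one_div_of_le hk0 h1
    linarith
  have : Ph N k * (1 / k - 1 / z) ≤ κ * (1 - 1 / (z / k)) := by
    calc _ ≤ (κ * k) * (1 / k - 1 / z) := mul_le_mul_of_nonneg_right h h4
      _ = _ := by field_simp
  nlinarith

theorem Jf_grow {N T : ℕ} {κ : ℝ} (hT : 1 ≤ T) (hκ : 0 ≤ κ) (x : ℕ) (hx : T ≤ x)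
    (h : ∀ k : ℕ, T ≤ k → k < x → Ph N k ≤ κ * k) : Jf N x ≤ Jf N T + κ * (Real.log x - Real.log T) := by
  induction x, hx using Nat.le_induction with
  | base => simp
  | succ k hk ih =>
    have ih := ih fun j h1 h2 => h j h1 (by omega)
    have := Jf_inc (N := N) (z := ((k+1:ℕ):ℝ)) (by omega) (h k hk (by omega)) hκ (by push_cast; linarith) (by push_cast; linarith)
    linarith

theorem Jf_grow' {N T : ℕ} {κ z : ℝ} (hT : 1 ≤ T) (hκ : 0 ≤ κ) (hz : (T:ℝ) ≤ z)
    (h : ∀ k : ℕ, T ≤ k → (k:ℝ) ≤ z → Ph N k ≤ κ * k) : Jf N z ≤ Jf N T + κ * (Real.log z - Real.log T) := by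
  have h0 : (0:ℝ) ≤ z := le_trans (by positivity) hz
  have hf : T ≤ ⌊z⌋₊ := Nat.le_floor hz
  have h1 := Jf_grow hT hκ ⌊z⌋₊ hf fun k a b => h k a ((Nat.le_floor_iff h0).1 b.le)
  have h2 := Jf_inc (N := N) (k := ⌊z⌋₊) (z := z) (by omega) (h _ hf (Nat.floor_le h0)) hκ (Nat.floor_le h0) (Nat.lt_floor_add_one z).le
  linarith

theorem engine {N : ℕ} (hN : 2 ≤ N) {κ D X : ℝ} (hκ : 0 < κ) (hD0 : 0 ≤ D)
    (hD : If N ((N^2 : ℕ) : ℝ) ≤ κ * (N:ℝ)^2 + D)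
    (hmid : ∀ x : ℕ, N^2 ≤ x → x < N^3 →
      κ + D / x + 1.0165 * Jf N ((x:ℝ) / N) + ef N * Ph N ((x:ℝ) / N) / x ≤ κ * Real.log x)
    (hend : κ + D / (N:ℝ)^3 + 1.0165 * (Jf N ((N^2 : ℕ) : ℝ) + κ * (Real.log X - 3 * Real.log N)) + ef N * κ / N ≤
      κ * Real.log X) :
    ∀ x : ℕ, N^2 ≤ x → (x:ℝ) ≤ X → Ph N x ≤ κ * x := by
  intro x
  induction x using Nat.strong_induction_on with
  | _ x ih =>
  intro hx hX
  have hN' : (0:ℝ) < N := by exact_mod_cast (by omega : 0 < N)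
  have hN4 : 4 ≤ N^2 := by nlinarith
  have hx0 : (0:ℝ) < x := by exact_mod_cast (by omega : 0 < x)
  have hx4 : (4:ℝ) ≤ x := by exact_mod_cast (by omega : 4 ≤ x)
  have hlog : 0 < Real.log x := Real.log_pos (by linarith)
  have hI := If_grow (N := N) (T := N^2) (κ := κ) (by omega) x hx fun k h1 h2 => ih k h2 h1 (le_trans (by exact_mod_cast h2.le) hX)
  have hm := log_method (N := N) (by omega) (x := (x:ℝ)) (by linarith)
  push_cast at hI hD
  have key : κ + D / x + 1.0165 * Jf N ((x:ℝ) / N) + ef N * Ph N ((x:ℝ) / N) / x ≤ κ * Real.log x := by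
    rcases Nat.lt_or_ge x (N^3) with h3 | h3
    · exact hmid x hx h3
    · have h3r : (N:ℝ)^3 ≤ x := by exact_mod_cast h3
      have hz : ((N^2:ℕ):ℝ) ≤ (x:ℝ) / N := by
        rw [le_div_iff₀ hN']; push_cast; nlinarith
      have hlt : (x:ℝ) / N < x := by
        rw [div_lt_iff₀ hN']
        have : (2:ℝ) ≤ N := by exact_mod_cast hN
        nlinarith
      have hih : ∀ k : ℕ, N^2 ≤ k → (k:ℝ) ≤ (x:ℝ)/N → Ph N k ≤ κ * k := fun k h1 h2 => by
        have : (k:ℝ) < x := lt_of_le_of_lt h2 hlt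
        exact ih k (by exact_mod_cast this) h1 (by linarith)
      have hJ := Jf_grow' (N := N) (T := N^2) (by omega) hκ.le hz hih
      have hP : Ph N ((x:ℝ)/N) ≤ κ * ((x:ℝ)/N) := by
        rw [Ph_floor]
        refine (hih _ (Nat.le_floor hz) (Nat.floor_le (by positivity))).trans ?_
        exact mul_le_mul_of_nonneg_left (Nat.floor_le (by positivity)) hκ.le
      have e1 : ef N * Ph N ((x:ℝ) / N) / x ≤ ef N * κ / N := by
        rw [div_le_iff₀ hx0]
        have : ef N * κ / N * x = ef N * (κ * (x / N)) := by ring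
        rw [this]
        exact mul_le_mul_of_nonneg_left hP (ef_nonneg (by omega))
      have e2 : D / x ≤ D / (N:ℝ)^3 := div_le_div_of_nonneg_left hD0 (by positivity) h3r
      have e3 : Real.log x ≤ Real.log X := Real.log_le_log hx0 hX
      rw [Real.log_div hx0.ne' hN'.ne'] at hJ
      push_cast at hJ hend
      rw [Real.log_pow] at hJ
      push_cast at hJ
      have e4 : κ * Real.log x ≤ κ * Real.log X := mul_le_mul_of_nonneg_left e3 hκ.le
      nlinarith
  have hfin : Ph N x * Real.log x ≤ (κ * x) * Real.log x := by
    calc _ ≤ κ * x + D + 1.0165 * x * Jf N (x / N) + ef N * Ph N (x / N) := by linarith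
      _ = x * (κ + D / x + 1.0165 * Jf N ((x:ℝ) / N) + ef N * Ph N ((x:ℝ) / N) / x) := by field_simp
      _ ≤ x * (κ * Real.log x) := mul_le_mul_of_nonneg_left key hx0.le
      _ = _ := by ring
  exact le_of_mul_le_mul_right hfin hlog

/-! ## Sums over primes by partial summation -/

theorem psum_bd {N : ℕ} (hN : 1 ≤ N) (M : ℕ) (hM : N ≤ M) :
    ∑ n ∈ Finset.Icc N M, ArithmeticFunction.vonMangoldt n ≤ 1.0165 * (M - N) + ef N := by
  have hf : ⌊(N:ℝ) - 1⌋₊ = N - 1 := by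
    have : ((N:ℝ) - 1) = ((N - 1 : ℕ) : ℝ) := by push_cast [Nat.cast_sub hN]; ring
    rw [this, Nat.floor_natCast]
  have h1 : Chebyshev.psi (M:ℝ) = Chebyshev.psi ((N:ℝ) - 1) + ∑ n ∈ Finset.Icc N M, ArithmeticFunction.vonMangoldt n := by
    rw [Chebyshev.psi, Chebyshev.psi, hf, Nat.floor_natCast, ← Finset.sum_union]
    · apply Finset.sum_congr _ fun _ _ => rfl
      ext d; simp only [Finset.mem_union, Finset.mem_Ioc, Finset.mem_Icc]; omega
    · rw [Finset.disjoint_left]; intro d; simp only [Finset.mem_Ioc, Finset.mem_Icc]; omega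
  have h2 := psi_up (t := (M:ℝ)) (by positivity)
  rw [ef]; linarith

theorem abel_nat {N : ℕ} (hN : 1 ≤ N) (g G : ℕ → ℝ) (M : ℕ) (hM : N ≤ M)
    (hg0 : ∀ n, N ≤ n → n ≤ M → 0 ≤ g n) (hga : ∀ n, N ≤ n → n < M → g (n+1) ≤ g n)
    (hG : ∀ n, N ≤ n → n < M → g (n+1) ≤ G (n+1) - G n) :
    ∑ n ∈ Finset.Icc N M, ArithmeticFunction.vonMangoldt n * g n ≤ ef N * g N + 1.0165 * (G M - G N) := by
  have key : ∑ n ∈ Finset.Icc N M, ArithmeticFunction.vonMangoldt n * g n +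
      (1.0165 * (M - N) + ef N - ∑ n ∈ Finset.Icc N M, ArithmeticFunction.vonMangoldt n) * g M ≤
      ef N * g N + 1.0165 * (G M - G N) := by
    induction M, hM using Nat.le_induction with
    | base => simp; linarith
    | succ k hk ih =>
      have ih := ih (fun n a b => hg0 n a (by omega)) (fun n a b => hga n a (by omega)) (fun n a b => hG n a (by omega))
      have a1 := hga k hk (by omega)
      have a2 := hG k hk (by omega)
      have a3 := psum_bd hN k hk
      rw [Finset.sum_Icc_succ_top (by omega), Finset.sum_Icc_succ_top (by omega)]
      push_cast
      nlinarith
  have := mul_nonneg (sub_nonneg.2 (psum_bd hN M hM)) (hg0 M hM le_rfl)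
  linarith

theorem abel_real {N : ℕ} (hN : 1 ≤ N) {g G G' : ℝ → ℝ} {z : ℝ} (hz : (N:ℝ) ≤ z)
    (hg0 : ∀ t, (N:ℝ) ≤ t → t ≤ z → 0 ≤ g t)
    (hga : ∀ s t, (N:ℝ) ≤ s → s ≤ t → t ≤ z → g t ≤ g s)
    (hG : ∀ t, (N:ℝ) ≤ t → t ≤ z → HasDerivAt G (G' t) t)
    (hgG : ∀ t, (N:ℝ) ≤ t → t ≤ z → g t ≤ G' t) :
    ∑ n ∈ Finset.Icc N ⌊z⌋₊, ArithmeticFunction.vonMangoldt n * g n ≤ ef N * g N + 1.0165 * (G z - G N) := by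
  have h0 : 0 ≤ z := le_trans (by positivity) hz
  have step : ∀ a b : ℝ, (N:ℝ) ≤ a → a ≤ b → b ≤ z → g b * (b - a) ≤ G b - G a := by
    intro a b ha hab hb
    refine Convex.mul_sub_le_image_sub_of_le_deriv (convex_Icc a b) ?_ ?_ ?_ a ⟨le_rfl, hab⟩ b ⟨hab, le_rfl⟩ hab
    · exact fun t ht => (hG t (ha.trans ht.1) (ht.2.trans hb)).continuousAt.continuousWithinAt
    · intro t ht
      rw [interior_Icc] at ht
      exact (hG t (ha.trans ht.1.le) (ht.2.le.trans hb)).differentiableAt.differentiableWithinAt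
    · intro t ht
      rw [interior_Icc] at ht
      rw [(hG t (ha.trans ht.1.le) (ht.2.le.trans hb)).deriv]
      exact (hga t b (ha.trans ht.1.le) ht.2.le hb).trans (hgG t (ha.trans ht.1.le) (ht.2.le.trans hb))
  have hle : ∀ n : ℕ, n ≤ ⌊z⌋₊ → (n:ℝ) ≤ z := fun n hn => (Nat.le_floor_iff h0).1 hn
  have hcast : ∀ n : ℕ, N ≤ n → (N:ℝ) ≤ n := fun n hn => by exact_mod_cast hn
  have h1 := abel_nat hN (fun n => g n) (fun n => G n) ⌊z⌋₊ (Nat.le_floor hz)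
    (fun n a b => hg0 n (hcast n a) (hle n b))
    (fun n a b => hga _ _ (hcast n a) (by push_cast; linarith) (hle _ b))
    (fun n a b => by
      have := step n ((n+1:ℕ):ℝ) (hcast n a) (by push_cast; linarith) (hle _ b)
      push_cast at this ⊢
      simpa using this)
  have h2 := step ⌊z⌋₊ z (hcast _ (Nat.le_floor hz)) (Nat.floor_le h0) le_rfl
  have h3 : 0 ≤ g z * (z - ⌊z⌋₊) := mul_nonneg (hg0 z hz le_rfl) (sub_nonneg.2 (Nat.floor_le h0))
  linarith

theorem prime_of_rgh {N n : ℕ} (hn : 2 ≤ n) (h : Rgh N n) (hlt : n < N^2) : n.Prime := by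
  by_contra hp
  have h1 := Nat.minFac_sq_le_self (by omega) hp
  have h2 := h n.minFac (Nat.minFac_prime (by omega)) (Nat.minFac_dvd n)
  have := Nat.pow_le_pow_left h2 2
  omega

theorem rsum_le {N : ℕ} (hN : 2 ≤ N) {z : ℝ} (hz0 : 0 ≤ z) (hz : z ≤ (N:ℝ)^2) (f : ℕ → ℝ)
    (hf : ∀ n : ℕ, 1 ≤ n → (n:ℝ) ≤ z → 0 ≤ f n) (hfz : z = (N:ℝ)^2 → f (N^2) = 0) :
    ∑ n ∈ RS N z, f n ≤ f 1 * (if 1 ≤ z then 1 else 0) + ∑ n ∈ Finset.Icc N ⌊z⌋₊, ArithmeticFunction.vonMangoldt n * (f n / Real.log n) := by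
  classical
  have hterm : ∀ n ∈ RS N z, f n ≤ (if n = 1 then f 1 else 0) + (if N ≤ n then ArithmeticFunction.vonMangoldt n * (f n / Real.log n) else 0) := by
    intro n hn
    rw [mem_RS hz0] at hn
    obtain ⟨h1, h2, h3⟩ := hn
    have nn : 0 ≤ (if N ≤ n then ArithmeticFunction.vonMangoldt n * (f n / Real.log n) else 0) := by
      split_ifs
      · have := hf n h1 h2
        have := ArithmeticFunction.vonMangoldt_nonneg (n := n)
        have := Real.log_natCast_nonneg n
        positivity
      · exact le_rfl
    rcases Nat.lt_or_ge n 2 with h | h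
    · have : n = 1 := by omega
      subst this
      simp only [if_true]
      linarith
    · rw [if_neg (by omega)]
      have hle : (n:ℝ) ≤ (N^2:ℕ) := by push_cast; linarith
      have hle' : n ≤ N^2 := by exact_mod_cast hle
      rcases Nat.eq_or_lt_of_le hle' with h4 | h4
      · have : z = (N:ℝ)^2 := by
          apply le_antisymm hz
          rw [h4] at h2; push_cast at h2; exact h2
        rw [h4, hfz this]
        rw [h4, hfz this] at nn
        linarith
      · have hp := prime_of_rgh h h3 h4
        rw [if_pos (h3 n hp dvd_rfl), ArithmeticFunction.vonMangoldt_apply_prime hp]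
        have : 0 < Real.log n := Real.log_pos (by exact_mod_cast h)
        rw [mul_div_cancel₀ _ this.ne']; linarith
  refine (Finset.sum_le_sum hterm).trans ?_
  rw [Finset.sum_add_distrib]
  apply add_le_add
  · rw [Finset.sum_ite_eq']
    split_ifs with h1 h2 h2
    · simp
    · rw [mem_RS hz0] at h1; exact absurd (by simpa using h1.2.1) h2
    · have := hf 1 le_rfl (by simpa using h2); simpa using this
    · simp
  · rw [← Finset.sum_filter]
    apply Finset.sum_le_sum_of_subset_of_nonneg
    · intro n hn
      rw [Finset.mem_filter, mem_RS hz0] at hn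
      rw [Finset.mem_Icc]; exact ⟨hn.2, Nat.le_floor hn.1.2.1⟩
    · intro n hn _
      rw [Finset.mem_Icc] at hn
      have := hf n (by omega) ((Nat.le_floor_iff hz0).1 hn.2)
      have := ArithmeticFunction.vonMangoldt_nonneg (n := n)
      have := Real.log_natCast_nonneg n
      positivity

/-! ## The analytic range: engine input for large N -/

theorem log_pade {t : ℝ} (ht : 0 ≤ t) : Real.log (1 + t) ≤ t * (6 + t) / (6 + 4 * t) := by
  let f : ℝ → ℝ := fun t => t * (6 + t) / (6 + 4 * t) - Real.log (1 + t)
  have hd : ∀ t : ℝ, 0 ≤ t → HasDerivAt f (t^3 / ((1+t) * (3 + 2*t)^2)) t := by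
    intro t ht
    have h1 : HasDerivAt (fun t : ℝ => t * (6 + t)) (1 * (6 + t) + t * 1) t :=
      (hasDerivAt_id t).mul ((hasDerivAt_id t).const_add 6)
    have h2 : HasDerivAt (fun t : ℝ => 6 + 4 * t) (4 * 1) t := ((hasDerivAt_id t).const_mul 4).const_add 6
    have h3 : HasDerivAt (fun t : ℝ => Real.log (1 + t)) (1 / (1 + t)) t :=
      ((hasDerivAt_id t).const_add 1).log (by simp; positivity)
    have e : t^3 / ((1+t) * (3 + 2*t)^2) = ((1 * (6 + t) + t * 1) * (6 + 4 * t) - t * (6 + t) * (4 * 1)) / (6 + 4 * t)^2 - 1 / (1 + t) := by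
      have : 6 + 4 * t = 2 * (3 + 2 * t) := by ring
      rw [this]
      have : 3 + 2 * t ≠ 0 := by positivity
      have : 1 + t ≠ 0 := by positivity
      field_simp
      ring
    rw [e]
    exact (h1.div h2 (by positivity)).sub h3
  have hm : MonotoneOn f (Set.Ici 0) := by
    apply monotoneOn_of_deriv_nonneg (convex_Ici 0)
    · exact fun t ht => (hd t ht).continuousAt.continuousWithinAt
    · intro t ht
      rw [interior_Ici] at ht
      exact (hd t (le_of_lt ht)).differentiableAt.differentiableWithinAt
    · intro t ht
      rw [interior_Ici] at ht
      have : 0 < t := ht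
      rw [(hd t this.le).deriv]; positivity
  have := hm (Set.mem_Ici.2 le_rfl) (Set.mem_Ici.2 ht) ht
  simp [f] at this
  linarith

theorem midA {t : ℝ} (h0 : 0 ≤ t) (h1 : t ≤ 1) :
    0 ≤ 0.6 * (2 + t) - 1.0165 - 1.0165^2 * (t * (6 + t) / (6 + 4 * t)) := by
  have h : 0 < 6 + 4 * t := by positivity
  rw [← mul_div_assoc, sub_div' h.ne']
  apply div_nonneg _ h.le
  nlinarith [mul_nonneg h0 h0, sq_nonneg (t - 0.75)]

theorem midB {t : ℝ} (h0 : 0 ≤ t) (h1 : t ≤ 1) :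
    0 ≤ 0.6 * (2 + t) - 1.0165 - 1.0165^2 * (t * (6 + t) / (6 + 4 * t)) +
      (-0.6509 + 0.968 / (1 + t) - 1.2833 * (1 / (1 + 6 * t + 18 * t^2))) / 6 := by
  have h : 0 < 6 + 4 * t := by positivity
  have h2 : 0 < 1 + 6 * t + 18 * t^2 := by positivity
  have h3 : 0 < 1 + t := by positivity
  have e : 0.6 * (2 + t) - 1.0165 - 1.0165^2 * (t * (6 + t) / (6 + 4 * t)) +
      (-0.6509 + 0.968 / (1 + t) - 1.2833 * (1 / (1 + 6 * t + 18 * t^2))) / 6 = 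
      ((0.6 * (2 + t) - 1.0165 - 0.6509/6) * ((6+4*t)*(1+t)*(1 + 6 * t + 18 * t^2)) - 1.0165^2 * (t * (6 + t))*((1+t)*(1 + 6 * t + 18 * t^2))
       + 0.968/6 * ((6+4*t)*(1 + 6 * t + 18 * t^2)) - 1.2833/6 * ((6+4*t)*(1+t))) / ((6+4*t)*(1+t)*(1 + 6 * t + 18 * t^2)) := by
    field_simp
    ring
  rw [e]
  apply div_nonneg _ (by positivity)
  nlinarith [mul_nonneg h0 h0, mul_nonneg (mul_nonneg h0 h0) h0, mul_nonneg h0 (sq_nonneg (t-0.75)), mul_nonneg (mul_nonneg h0 h0) (sq_nonneg (t - 0.8)), mul_nonneg (mul_nonneg (mul_nonneg h0 h0) h0) (sq_nonneg (t - 0.8)), mul_nonneg h0 (sub_nonneg.2 h1), sq_nonneg (t-0.8)]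


noncomputable def fl (t : ℝ) : ℝ := t / Real.log t + t / Real.log t ^ 2
noncomputable def Fu (t : ℝ) : ℝ := t / Real.log t + t / Real.log t ^ 2 + 4 * (t / Real.log t ^ 3)

theorem hasDeriv_tl {t : ℝ} (ht : 0 < t) (hl : 0 < Real.log t) (k : ℕ) :
    HasDerivAt (fun t => t / Real.log t ^ (k+1)) (1 / Real.log t ^ (k+1) - (k+1) / Real.log t ^ (k+2)) t := by
  have h1 := (Real.hasDerivAt_log ht.ne').pow (k+1)
  have h2 := (hasDerivAt_id t).div h1 (pow_ne_zero _ hl.ne')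
  have e : 1 / Real.log t ^ (k+1) - (k+1) / Real.log t ^ (k+2) =
      (1 * Real.log t ^ (k + 1) - id t * (((k + 1 : ℕ) : ℝ) * Real.log t ^ (k + 1 - 1) * t⁻¹)) / (Real.log t ^ (k + 1)) ^ 2 := by
    simp only [id, Nat.add_sub_cancel]
    field_simp
    push_cast
    ring
  rw [e]
  exact h2

theorem hasDeriv_fl {t : ℝ} (ht : 0 < t) (hl : 0 < Real.log t) :
    HasDerivAt fl (1 / Real.log t - 2 / Real.log t ^ 3) t := by
  have h0 := hasDeriv_tl ht hl 0
  have h1 := hasDeriv_tl ht hl 1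
  have h := h0.add h1
  have e : 1 / Real.log t - 2 / Real.log t ^ 3 = (1 / Real.log t ^ (0 + 1) - ((0:ℕ) + 1) / Real.log t ^ (0 + 2) +
      (1 / Real.log t ^ (1 + 1) - ((1:ℕ) + 1) / Real.log t ^ (1 + 2))) := by
    norm_num
  rw [e]
  refine h.congr_of_eventuallyEq (Filter.Eventually.of_forall fun t => ?_)
  simp [fl]

theorem hasDeriv_Fu {t : ℝ} (ht : 0 < t) (hl : 0 < Real.log t) :
    HasDerivAt Fu (1 / Real.log t + 2 / Real.log t ^ 3 - 12 / Real.log t ^ 4) t := by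
  have h0 := hasDeriv_fl ht hl
  have h1 := (hasDeriv_tl ht hl 2).const_mul 4
  have h := h0.add h1
  have e : 1 / Real.log t + 2 / Real.log t ^ 3 - 12 / Real.log t ^ 4 = (1 / Real.log t - 2 / Real.log t ^ 3 +
      4 * (1 / Real.log t ^ (2 + 1) - ((2:ℕ) + 1) / Real.log t ^ (2 + 2))) := by
    norm_num; ring
  rw [e]
  refine h.congr_of_eventuallyEq (Filter.Eventually.of_forall fun t => ?_)
  simp [Fu, fl]

theorem li_step {l : ℝ} (hl : 6 ≤ l) : 1 / l ≤ 1 / l + 2 / l ^ 3 - 12 / l ^ 4 := by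
  have : 12 / l^4 ≤ 2 / l^3 := by
    rw [div_le_div_iff₀ (by positivity) (by positivity)]
    have : 0 < l^3 := by positivity
    nlinarith
  linarith

theorem Ph_le {N : ℕ} (hL : 6 ≤ Real.log N) (hN : 2 ≤ N) {z : ℝ} (h1 : (N:ℝ) ≤ z) (h2 : z < (N:ℝ)^2) :
    Ph N z ≤ 1 + ef N / Real.log N + 1.0165 * (Fu z - Fu N) := by
  have hN0 : (0:ℝ) < N := by exact_mod_cast (by omega : 0 < N)
  have hN1 : (2:ℝ) ≤ N := by exact_mod_cast hN
  have hlog : ∀ t : ℝ, (N:ℝ) ≤ t → 6 ≤ Real.log t := fun t ht => hL.trans (Real.log_le_log hN0 ht)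
  have h := rsum_le hN (by linarith) h2.le (fun _ => 1) (fun _ _ _ => zero_le_one) (fun h => absurd h h2.ne)
  rw [if_pos (by linarith)] at h
  have ha := abel_real (N := N) (by omega) (g := fun t => 1 / Real.log t) (G := Fu) h1
    (fun t a b => by have := hlog t a; positivity)
    (fun s t a b c => one_div_le_one_div_of_le (by linarith [hlog s a]) (Real.log_le_log (by linarith) b))
    (fun t a b => hasDeriv_Fu (by linarith) (by linarith [hlog t a]))
    (fun t a b => li_step (hlog t a))
  have e : ∑ n ∈ RS N z, (1:ℝ) = Ph N z := by simp [Ph]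
  rw [e] at h
  have e2 : ef N * (1 / Real.log N) = ef N / Real.log N := by ring
  beta_reduce at ha h
  linarith

theorem Jf_le {N : ℕ} (hL : 6 ≤ Real.log N) (hN : 2 ≤ N) {z : ℝ} (h1 : (N:ℝ) ≤ z) (h2 : z ≤ (N:ℝ)^2) :
    Jf N z ≤ 1 + ef N / N / Real.log N +
      1.0165 * (Real.log (Real.log z) - Real.log (Real.log N) - (fl z - fl N) / z) := by
  have hN0 : (0:ℝ) < N := by exact_mod_cast (by omega : 0 < N)
  have hN1 : (2:ℝ) ≤ N := by exact_mod_cast hN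
  have hz0 : 0 < z := by linarith
  have hlog : ∀ t : ℝ, (N:ℝ) ≤ t → 6 ≤ Real.log t := fun t ht => hL.trans (Real.log_le_log hN0 ht)
  have h := rsum_le hN (by linarith) h2 (fun n => 1 / (n:ℝ) - 1 / z)
    (fun n a b => sub_nonneg.2 (one_div_le_one_div_of_le (by exact_mod_cast a) b)) (fun h => by rw [h]; push_cast; simp)
  rw [if_pos (by linarith)] at h
  have ha := abel_real (N := N) (by omega) (g := fun t => (1 / t - 1 / z) / Real.log t)
    (G := fun t => Real.log (Real.log t) - fl t / z) h1
    (fun t a b => by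
      have := hlog t a
      have := one_div_le_one_div_of_le (show 0 < t by linarith) b
      apply div_nonneg <;> linarith)
    (fun s t a b c => by
      have := hlog s a
      have hs : 0 < s := by linarith
      have := one_div_le_one_div_of_le hs b
      have := one_div_le_one_div_of_le (show 0 < s by linarith) (b.trans c)
      apply div_le_div₀ <;> first | linarith | exact Real.log_le_log hs b)
    (fun t a b => (((Real.hasDerivAt_log (by linarith)).log (by linarith [hlog t a])).sub
      ((hasDeriv_fl (by linarith) (by linarith [hlog t a])).div_const z)))
    (fun t a b => by
      have h6 := hlog t a
      have ht : 0 < t := by linarith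
      have e : (1 / t - 1 / z) / Real.log t = t⁻¹ / Real.log t - (1 / Real.log t) / z := by
        field_simp
      rw [e]
      have : (1 / Real.log t - 2 / Real.log t ^ 3) / z ≤ (1 / Real.log t) / z := by
        apply div_le_div_of_nonneg_right _ hz0.le
        have : 0 ≤ 2 / Real.log t ^ 3 := by positivity
        linarith
      linarith)
  beta_reduce at ha h
  have e2 : ef N * ((1 / N - 1 / z) / Real.log N) ≤ ef N / N / Real.log N := by
    have : ef N / N / Real.log N = ef N * ((1 / N) / Real.log N) := by field_simp
    rw [this]
    apply mul_le_mul_of_nonneg_left _ (ef_nonneg (by omega))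
    apply div_le_div_of_nonneg_right _ (by linarith)
    have : 0 ≤ 1 / z := by positivity
    linarith
  have e3 : 0 ≤ 1 / z := by positivity
  have e4 : (fl z - fl N) / z = fl z / z - fl N / z := by ring
  rw [Jf, e4]
  push_cast at h
  linarith

theorem If_le {N : ℕ} (hL : 6 ≤ Real.log N) (hN : 2 ≤ N) :
    If N ((N^2 : ℕ) : ℝ) ≤ 2 * Real.log N + ef N +
      1.0165 * (2 * Real.log N * (Fu ((N:ℝ)^2) - Fu N) - (N:ℝ)^2 + N) := by
  have hN0 : (0:ℝ) < N := by exact_mod_cast (by omega : 0 < N)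
  have hN1 : (2:ℝ) ≤ N := by exact_mod_cast hN
  have hL0 : 0 < Real.log N := by linarith
  have hlog : ∀ t : ℝ, (N:ℝ) ≤ t → 6 ≤ Real.log t := fun t ht => hL.trans (Real.log_le_log hN0 ht)
  have hNN : (N:ℝ) ≤ (N:ℝ)^2 := by nlinarith
  have hlz : Real.log ((N:ℝ)^2) = 2 * Real.log N := by rw [Real.log_pow]; norm_num
  have h := rsum_le hN (z := (N:ℝ)^2) (by positivity) le_rfl (fun n => Real.log ((N:ℝ)^2 / n))
    (fun n a b => Real.log_nonneg (by rw [le_div_iff₀ (by exact_mod_cast a)]; linarith))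
    (fun h => by push_cast; rw [div_self (by positivity)]; simp)
  rw [if_pos (by nlinarith)] at h
  have ha := abel_real (N := N) (by omega) (g := fun t => Real.log ((N:ℝ)^2 / t) / Real.log t)
    (G := fun t => 2 * Real.log N * Fu t - t) hNN
    (fun t a b => by
      have := hlog t a
      apply div_nonneg _ (by linarith)
      exact Real.log_nonneg (by rw [le_div_iff₀ (by linarith)]; linarith))
    (fun s t a b c => by
      have := hlog s a
      have hs : 0 < s := by linarith
      have ht : 0 < t := by linarith
      apply div_le_div₀
      · exact Real.log_nonneg (by rw [le_div_iff₀ (by linarith)]; linarith)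
      · exact Real.log_le_log (by positivity) (div_le_div_of_nonneg_left (by positivity) hs b)
      · linarith
      · exact Real.log_le_log hs b)
    (fun t a b => ((hasDeriv_Fu (by linarith) (by linarith [hlog t a])).const_mul _).sub (hasDerivAt_id t))
    (fun t a b => by
      have h6 := hlog t a
      have ht : 0 < t := by linarith
      rw [Real.log_div (by positivity) ht.ne', hlz, sub_div, div_self (by linarith)]
      have := mul_le_mul_of_nonneg_left (li_step h6) (show 0 ≤ 2 * Real.log N by linarith)
      have e : 2 * Real.log N * (1 / Real.log t) = 2 * Real.log N / Real.log t := by ring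
      linarith)
  beta_reduce at ha h
  have e2 : Real.log ((N:ℝ)^2 / N) / Real.log N = 1 := by
    have : (N:ℝ)^2 / N = N := by field_simp
    rw [this, div_self hL0.ne']
  rw [e2] at ha
  rw [If]
  push_cast at h ⊢
  rw [div_one, hlz] at h
  linarith



theorem exp_quad {t : ℝ} (ht : 0 ≤ t) : Real.exp (-(6 * t)) ≤ 1 / (1 + 6 * t + 18 * t ^ 2) := by
  rw [Real.exp_neg, ← one_div]
  apply one_div_le_one_div_of_le (by positivity)
  have := Real.quadratic_le_exp_of_nonneg (show 0 ≤ 6 * t by positivity)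
  linarith

theorem mid_ineq {w s E ep J P lg : ℝ} (hw0 : 0 < w) (hw : w ≤ 1/6) (hs1 : 1 ≤ s) (hs2 : s ≤ 2)
    (hE0 : 0 ≤ E) (hE : E ≤ Real.exp (-(6 * (s - 1)))) (hep0 : 0 ≤ ep) (hep : ep ≤ 0.05) (hlg : lg ≤ Real.log s)
    (hJ : J ≤ 1 + ep * w + 1.0165 * (lg - (w / s + w^2 / s^2) + E * (w + w^2)))
    (hP : P ≤ 1.3 * w / s) (hP0 : 0 ≤ P) :
    0.6 * w + 0.0777 * w * E + 1.0165 * J + ep * P ≤ 0.6 * (1 + s) := by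
  have hlog := log_pade (t := s - 1) (by linarith)
  have e1 : 1 + (s - 1) = s := by ring
  rw [e1] at hlog
  have hA := midA (t := s - 1) (by linarith) (by linarith)
  have hB := midB (t := s - 1) (by linarith) (by linarith)
  have hq := exp_quad (t := s - 1) (by linarith)
  rw [e1] at hB
  set Q := (s - 1) * (6 + (s - 1)) / (6 + 4 * (s - 1)) with hQ
  set R := 1 / (1 + 6 * (s - 1) + 18 * (s - 1) ^ 2) with hR
  have hER : E ≤ R := hE.trans hq
  have hepw : ep * w ≤ 0.05 * w := mul_le_mul_of_nonneg_right hep hw0.le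
  have hepP : ep * P ≤ 0.065 * (w / s) := by
    have h1 : ep * P ≤ 0.05 * P := mul_le_mul_of_nonneg_right hep hP0
    have : 1.3 * w / s = 1.3 * (w / s) := by ring
    rw [this] at hP
    linarith
  have hww : E * (w + w^2) ≤ R * (w * (7/6)) := by
    apply mul_le_mul hER _ (by positivity) (hE0.trans hER)
    nlinarith
  have hwE : w * E ≤ w * R := mul_le_mul_of_nonneg_left hER hw0.le
  have hw2 : 0 ≤ w^2 / s^2 := by positivity
  have hws : w / s = w * (1/s) := by ring
  have hB' : 0.968 / s = 0.968 * (1/s) := by ring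
  rw [hws] at hJ hepP
  rw [hB'] at hB
  set S := 1/s
  set wS := w * S with hwS
  set wR := w * R with hwR
  -- linear in w
  have hlin : 0 ≤ (0.6 * (2 + (s-1)) - 1.0165 - 1.0165^2 * Q) + w * (-0.6509 + 0.968 * S - 1.2833 * R) := by
    rcases le_total 0 (-0.6509 + 0.968 * S - 1.2833 * R) with h | h
    · have := mul_nonneg hw0.le h
      linarith
    · nlinarith
  have hlin2 : w * (-0.6509 + 0.968 * S - 1.2833 * R) = -0.6509 * w + 0.968 * wS - 1.2833 * wR := by
    rw [hwS, hwR]; ring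
  rw [hlin2] at hlin
  have hwS0 : 0 ≤ wS := by positivity
  have hwR0 : 0 ≤ wR := by
    have : 0 ≤ R := hE0.trans hER
    positivity
  have hlgQ : lg ≤ Q := hlg.trans hlog
  have : R * (w * (7/6)) = 7/6 * wR := by rw [hwR]; ring
  rw [this] at hww
  have h5 : 0.0777 * w * E ≤ 0.0777 * wR := by linarith
  linarith

theorem end_ineq {w ep J : ℝ} (hw0 : 0 < w) (hw : w ≤ 1/6) (hep0 : 0 ≤ ep) (hep : ep ≤ 0.05) {n : ℝ} (hn0 : 0 ≤ n) (hn : n ≤ 1/400)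
    (hJ : J ≤ 1 + ep * w + 1.0165 * (Real.log 2 - (w / 2 + w^2 / 4) + n * (w + w^2))) :
    0.6 * w + 0.0777 * w * n + 1.0165 * (J + 0.6 * 3.75) + ep * (0.6 * w) ≤ 0.6 * 6.75 := by
  have := Real.log_two_lt_d9
  have h1 : ep * w ≤ 0.05 * w := mul_le_mul_of_nonneg_right hep hw0.le
  have h2 : n * (w + w^2) ≤ 1/400 * (w * (7/6)) := by
    apply mul_le_mul hn _ (by positivity) (by norm_num)
    nlinarith
  have h3 : w * n ≤ w * (1/400) := mul_le_mul_of_nonneg_left hn hw0.le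
  nlinarith

lemma quad_aux {q : ℝ} (h0 : 0 ≤ q) (h : q ≤ 1/6) : q + q^2 + 4 * q^3 ≤ q * (1 + 1/6 + 1/9) := by
  have h2 : q^2 ≤ q * (1/6) := by nlinarith
  have h3 : q^3 ≤ q * (1/36) := by nlinarith
  linarith

set_option maxHeartbeats 2000000 in
theorem engine_large {N : ℕ} (hN : 410 ≤ N) (hL : 6 ≤ Real.log N) (hef : ef N ≤ 0.05 * N) :
    ∀ x : ℕ, N^2 ≤ x → (x:ℝ) ≤ Real.exp (6.75 * Real.log N) → Ph N x ≤ 0.6 / Real.log N * x := by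
  have hN0 : (0:ℝ) < N := by exact_mod_cast (by omega : 0 < N)
  have hN1 : (410:ℝ) ≤ N := by exact_mod_cast hN
  set L := Real.log N with hLdef
  have hL0 : 0 < L := by linarith
  set w := 1 / L with hw
  have hwL : w * L = 1 := by rw [hw]; field_simp
  have hw0 : 0 < w := by positivity
  have hw6 : w ≤ 1/6 := one_div_le_one_div_of_le (by norm_num) hL
  have hlz : Real.log ((N:ℝ)^2) = 2 * L := by rw [Real.log_pow]; norm_num [hLdef]
  have hef0 : 0 ≤ ef N := ef_nonneg (by omega)
  set ep := ef N / N with hepd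
  have hep0 : 0 ≤ ep := by positivity
  have hep : ep ≤ 0.05 := by rw [hepd, div_le_iff₀ hN0]; exact hef
  have hefe : ef N = ep * N := by rw [hepd]; field_simp
  have hκ : 0.6 / L = 0.6 * w := by rw [hw]; ring
  have hLN : L ≤ 0.02 * N := by
    have := Real.log_le_sub_one_of_pos (show 0 < (N:ℝ) / 410 by positivity)
    rw [Real.log_div hN0.ne' (by norm_num)] at this
    have h410 : Real.log 410 ≤ 7 := by
      rw [Real.log_le_iff_le_exp (by norm_num)]
      have h := Real.exp_one_gt_d9
      have e : Real.exp 7 = Real.exp 1 ^ 7 := by rw [← Real.exp_nat_mul]; norm_num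
      rw [e]
      calc (410:ℝ) ≤ 2.7 ^ 7 := by norm_num
        _ ≤ _ := by gcongr; linarith
    linarith
  rw [hκ]
  refine engine (by omega) (D := 0.0777 * w * (N:ℝ)^2) (by positivity) (by positivity) ?_ ?_ ?_
  · refine (If_le hL (by omega)).trans ?_
    rw [← hLdef]
    have e1 : 2 * L * (Fu ((N:ℝ)^2)) = (N:ℝ)^2 * (1 + w / 2 + w^2) := by
      rw [Fu, hlz, hw]; field_simp; ring
    have e2 : 2 * L * Fu N = N * (2 + 2 * w + 8 * w^2) := by
      rw [Fu, ← hLdef, hw]; field_simp; ring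
    rw [mul_sub, e1, e2]
    have h1 : (N:ℝ)^2 * (1.0165 * (w/2 + w^2)) ≤ (N:ℝ)^2 * (0.6777 * w) := by
      apply mul_le_mul_of_nonneg_left _ (by positivity)
      nlinarith
    have h2 : 0 ≤ N * (2 * w + 8 * w^2) := by positivity
    nlinarith
  · intro x hx1 hx2
    have hx1r : (N:ℝ)^2 ≤ x := by exact_mod_cast hx1
    have hx2r : (x:ℝ) < (N:ℝ)^3 := by exact_mod_cast hx2
    have hx0 : (0:ℝ) < x := by nlinarith
    set z := (x:ℝ) / N with hz
    have hxz : (x:ℝ) = z * N := by rw [hz]; field_simp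
    have hz1 : (N:ℝ) ≤ z := by rw [hz, le_div_iff₀ hN0]; nlinarith
    have hz2 : z < (N:ℝ)^2 := by rw [hz, div_lt_iff₀ hN0]; nlinarith
    have hz0 : 0 < z := by linarith
    have hl1 : L ≤ Real.log z := Real.log_le_log hN0 hz1
    have hl2 : Real.log z ≤ 2 * L := by rw [← hlz]; exact Real.log_le_log hz0 hz2.le
    set l := Real.log z with hl
    set s := l * w with hs
    have hl0 : 0 < l := by linarith
    have hlL : l = s * L := by rw [hs, mul_assoc, hwL, mul_one]
    have hs1 : 1 ≤ s := by nlinarith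
    have hs2 : s ≤ 2 := by nlinarith
    have hs0 : 0 < s := by linarith
    set E := N / z with hEd
    have hE0 : 0 ≤ E := by positivity
    have hE1 : E ≤ 1 := by rw [hEd, div_le_one hz0]; exact hz1
    have hEexp : E = Real.exp (-(L * (s - 1))) := by
      have : -(L * (s-1)) = L - l := by rw [hlL]; ring
      rw [this, Real.exp_sub, hl, hLdef, Real.exp_log hN0, Real.exp_log hz0]
    have hE : E ≤ Real.exp (-(6 * (s - 1))) := by
      rw [hEexp, Real.exp_le_exp]; nlinarith
    have hJ := Jf_le hL (by omega) hz1 hz2.le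
    have hP := Ph_le hL (by omega) hz1 hz2
    rw [← hLdef, ← hl] at hJ
    rw [← hLdef] at hP
    have f1 : fl z = z * (w / s + w^2 / s^2) := by
      rw [fl, ← hl, hlL, hw]; field_simp
    have f2 : fl N = N * (w + w^2) := by
      rw [fl, ← hLdef, hw]; field_simp
    have f3 : Fu z = z * (w / s + w^2 / s^2 + 4 * (w^3 / s^3)) := by
      rw [Fu, ← hl, hlL, hw]; field_simp
    have f4 : Fu N = N * (w + w^2 + 4 * w^3) := by
      rw [Fu, ← hLdef, hw]; field_simp
    have hlog : Real.log l - Real.log L = Real.log s := by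
      rw [hlL, Real.log_mul hs0.ne' hL0.ne']; ring
    have hm := mid_ineq (w := w) (s := s) (E := E) (ep := ep) (J := Jf N z) (P := Ph N z / z) (lg := Real.log s)
      hw0 hw6 hs1 hs2 hE0 hE hep0 hep le_rfl ?_ ?_ (by have := Ph_nonneg N z; positivity)
    · have e1 : 0.0777 * w * (N:ℝ)^2 / x = 0.0777 * w * E := by
        rw [hEd, hxz]; field_simp
      have e2 : ef N * Ph N z / x = ep * (Ph N z / z) := by
        rw [hefe, hxz]; field_simp
      have e3 : Real.log x = L * (1 + s) := by
        rw [hxz, Real.log_mul hz0.ne' hN0.ne', ← hl, ← hLdef, hlL]; ring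
      rw [e1, e2, e3]
      have e4 : 0.6 * w * (L * (1 + s)) = 0.6 * (1 + s) := by
        calc _ = 0.6 * (w * L) * (1 + s) := by ring
          _ = _ := by rw [hwL]; ring
      rw [e4]; linarith
    · refine hJ.trans (le_of_eq ?_)
      rw [hlog, f1, f2]
      have e1 : ep / L = ep * w := by rw [hw]; ring
      have e2 : (z * (w / s + w^2 / s^2) - N * (w + w^2)) / z = (w / s + w^2 / s^2) - E * (w + w^2) := by
        rw [hEd]; field_simp
      rw [e1, e2]; ring
    · rw [div_le_iff₀ hz0]
      refine hP.trans ?_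
      rw [f3, f4]
      have e1 : ef N / L = N * (ep * w) := by rw [hefe, hw]; ring
      rw [e1]
      have h1 : 1 + N * (ep * w) ≤ 1.0165 * (N * (w + w^2 + 4 * w^3)) := by
        have a1 : N * (ep * w) ≤ N * (0.05 * w) :=
          mul_le_mul_of_nonneg_left (mul_le_mul_of_nonneg_right hep hw0.le) hN0.le
        have a2 : 0 ≤ N * (w^2 + 4 * w^3) := by positivity
        have a3 : 50 ≤ N * w := by
          have : 50 * L ≤ N := by linarith
          calc (50:ℝ) = 50 * L * w := by rw [mul_assoc, mul_comm L, hwL]; ring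
            _ ≤ N * w := by gcongr
        nlinarith
      have h2 : w / s + w^2 / s^2 + 4 * (w^3 / s^3) ≤ w / s * (1 + 1/6 + 1/9) := by
        have hs' : w / s ≤ 1/6 := by
          rw [div_le_iff₀ hs0]; nlinarith
        have g2 : w^2 / s^2 = (w/s)^2 := by ring
        have g3 : w^3 / s^3 = (w/s)^3 := by ring
        have h0 : 0 ≤ w / s := by positivity
        rw [g2, g3]
        exact quad_aux h0 hs'
      have h3 := mul_le_mul_of_nonneg_left h2 hz0.le
      have h4 : 1.3 * w / s * z = 1.3 * (z * (w/s)) := by ring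
      have h5 : 0 ≤ z * (w/s) := by positivity
      rw [h4]
      linarith
  · have hNN : (N:ℝ) ≤ (N:ℝ)^2 := by nlinarith
    have hJ := Jf_le hL (by omega) hNN le_rfl
    rw [← hLdef, hlz] at hJ
    have f1 : fl ((N:ℝ)^2) = (N:ℝ)^2 * (w / 2 + w^2 / 4) := by
      rw [fl, hlz, hw]; field_simp; ring
    have f2 : fl N = N * (w + w^2) := by
      rw [fl, ← hLdef, hw]; field_simp
    rw [f1, f2, Real.log_mul (by norm_num) hL0.ne'] at hJ
    have e1 : ep / L = ep * w := by rw [hw]; ring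
    have e2 : ((N:ℝ)^2 * (w / 2 + w^2 / 4) - N * (w + w^2)) / (N:ℝ)^2 = (w / 2 + w^2 / 4) - 1 / N * (w + w^2) := by
      field_simp
    rw [e1, e2] at hJ
    have hm := end_ineq (J := Jf N ((N:ℝ)^2)) hw0 hw6 hep0 hep (n := 1 / (N:ℝ)) (by positivity)
      (one_div_le_one_div_of_le (by norm_num) (by linarith)) (by linarith)
    rw [Real.log_exp, ← hLdef]
    push_cast
    have e3 : 0.0777 * w * (N:ℝ)^2 / (N:ℝ)^3 = 0.0777 * w * (1 / N) := by field_simp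
    have e4 : ef N * (0.6 * w) / N = ep * (0.6 * w) := by rw [hefe]; field_simp
    have e5 : 0.6 * w * (6.75 * L - 3 * L) = 0.6 * 3.75 * (w * L) := by ring
    have e6 : 0.6 * w * (6.75 * L) = 0.6 * 6.75 * (w * L) := by ring
    rw [e3, e4, e5, e6, hwL]
    linarith


/-! ### Selberg sieve -/
section Selberg
open ArithmeticFunction ArithmeticFunction.Moebius

open scoped Classical in
noncomputable def SD (N ξ : ℕ) : Finset ℕ :=
  (Finset.Icc 1 ξ).filter (fun k => Squarefree k ∧ ∀ p : ℕ, p.Prime → p ∣ k → p < N)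

noncomputable def Sg (N ξ : ℕ) : ℝ := ∑ k ∈ SD N ξ, 1 / (Nat.totient k : ℝ)

noncomputable def Tg (N ξ d : ℕ) : ℝ := ∑ k ∈ SD N ξ with d ∣ k, 1 / (Nat.totient k : ℝ)

lemma mem_SD {N ξ k : ℕ} : k ∈ SD N ξ ↔ (1 ≤ k ∧ k ≤ ξ) ∧ Squarefree k ∧ ∀ p : ℕ, p.Prime → p ∣ k → p < N := by
  simp [SD]

lemma SD_dvd {N ξ k d : ℕ} (hk : k ∈ SD N ξ) (h : d ∣ k) : d ∈ SD N ξ := by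
  rw [mem_SD] at hk ⊢
  obtain ⟨⟨h1, h2⟩, h3, h4⟩ := hk
  exact ⟨⟨Nat.pos_of_dvd_of_pos h h1, (Nat.le_of_dvd h1 h).trans h2⟩, h3.squarefree_of_dvd h,
    fun p hp hpd => h4 p hp (hpd.trans h)⟩

lemma one_mem_SD {N ξ : ℕ} (h : 1 ≤ ξ) : 1 ∈ SD N ξ := by
  rw [mem_SD]
  refine ⟨⟨le_rfl, h⟩, squarefree_one, fun p hp h1 => ?_⟩
  exact absurd (Nat.dvd_one.1 h1) hp.one_lt.ne'

lemma Sg_pos {N ξ : ℕ} (h : 1 ≤ ξ) : 0 < Sg N ξ := by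
  unfold Sg
  apply Finset.sum_pos
  · intro k hk
    have : 0 < Nat.totient k := Nat.totient_pos.2 (mem_SD.1 hk).1.1
    positivity
  · exact ⟨1, one_mem_SD h⟩

lemma Tg_nonneg {N ξ d : ℕ} : 0 ≤ Tg N ξ d := by
  unfold Tg; exact Finset.sum_nonneg fun k _ => by positivity

lemma tot_div {l k : ℕ} (hk : Squarefree k) (hl : l ∣ k) : Nat.totient k = Nat.totient l * Nat.totient (k / l) := by
  obtain ⟨m, rfl⟩ := hl
  have hl0 : 0 < l := Nat.pos_of_ne_zero (by rintro rfl; simp at hk)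
  rw [Nat.mul_div_cancel_left m hl0, Nat.totient_mul (Nat.coprime_of_squarefree_mul hk)]

lemma Tg_le {N ξ d : ℕ} (hd : d ∈ SD N ξ) : d * Tg N ξ d ≤ Sg N ξ := by
  have hd0 : 0 < d := (mem_SD.1 hd).1.1
  have e1 : (d:ℝ) = ∑ l ∈ d.divisors, (Nat.totient l : ℝ) := by
    exact_mod_cast (Nat.sum_totient d).symm
  rw [e1, Tg, Finset.sum_mul_sum, ← Finset.sum_product']
  have key : ∀ q ∈ d.divisors ×ˢ (SD N ξ).filter (fun k => d ∣ k),
      (Nat.totient q.1 : ℝ) * (1 / (Nat.totient q.2 : ℝ)) = 1 / (Nat.totient (q.2 / q.1) : ℝ) := by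
    rintro ⟨l, k⟩ hq
    simp only [Finset.mem_product, Nat.mem_divisors, Finset.mem_filter] at hq
    obtain ⟨⟨hl, _⟩, hk, hdk⟩ := hq
    have hs := (mem_SD.1 hk).2.1
    have ht := tot_div hs (hl.trans hdk)
    have h1 : 0 < Nat.totient l := Nat.totient_pos.2 (Nat.pos_of_dvd_of_pos hl hd0)
    simp only
    rw [ht]; push_cast
    have : (Nat.totient l : ℝ) ≠ 0 := by positivity
    field_simp
  rw [Finset.sum_congr rfl key]
  have hinj : Set.InjOn (fun q : ℕ × ℕ => q.2 / q.1) (d.divisors ×ˢ (SD N ξ).filter (fun k => d ∣ k) : Finset (ℕ × ℕ)) := by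
    have aux : ∀ l k : ℕ, l ∣ d → k ∈ SD N ξ → d ∣ k → Nat.gcd (k / l) d * l = d := by
      intro l k hl hk hdk
      have hs := (mem_SD.1 hk).2.1
      obtain ⟨a, rfl⟩ := hl
      obtain ⟨b, rfl⟩ := hdk
      have hl0 : 0 < l := Nat.pos_of_mul_pos_right hd0
      rw [mul_assoc l a b, Nat.mul_div_cancel_left _ hl0, mul_comm l a, Nat.gcd_mul_left]
      have : Nat.Coprime b l := by
        have := Nat.coprime_of_squarefree_mul hs
        exact (Nat.Coprime.coprime_mul_right this).symm
      rw [this, mul_one]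
    rintro ⟨l, k⟩ h1 ⟨l', k'⟩ h2 heq
    simp only [Finset.coe_product, Set.mem_prod, Finset.mem_coe, Nat.mem_divisors, Finset.mem_filter] at h1 h2
    simp only at heq
    obtain ⟨⟨hl, _⟩, hk, hdk⟩ := h1
    obtain ⟨⟨hl', _⟩, hk', hdk'⟩ := h2
    have a1 := aux l k hl hk hdk
    have a2 := aux l' k' hl' hk' hdk'
    rw [← heq] at a2
    have hg : 0 < Nat.gcd (k / l) d := Nat.gcd_pos_of_pos_right _ hd0
    have hll : l = l' := Nat.eq_of_mul_eq_mul_left hg (a1.trans a2.symm)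
    subst hll
    have hkk : k = k' := by
      rw [← Nat.div_mul_cancel (hl.trans hdk), heq, Nat.div_mul_cancel (hl.trans hdk')]
    rw [hkk]
  rw [← Finset.sum_image (f := fun j : ℕ => 1 / (Nat.totient j : ℝ)) hinj]
  unfold Sg
  apply Finset.sum_le_sum_of_subset_of_nonneg
  · intro j hj
    simp only [Finset.mem_image, Finset.mem_product, Nat.mem_divisors, Finset.mem_filter] at hj
    obtain ⟨⟨l, k⟩, ⟨⟨hl, _⟩, hk, hdk⟩, rfl⟩ := hj
    exact SD_dvd hk (Nat.div_dvd_of_dvd (hl.trans hdk))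
  · intros; positivity

lemma mu_sum {k l : ℕ} (hk : Squarefree k) (hl : l ∣ k) :
    ∑ d ∈ k.divisors with l ∣ d, (μ d : ℝ) = if k = l then (μ l : ℝ) else 0 := by
  obtain ⟨m, rfl⟩ := hl
  have hl0 : 0 < l := Nat.pos_of_ne_zero (by rintro rfl; simp at hk)
  have hm0 : 0 < m := Nat.pos_of_ne_zero (by rintro rfl; simp at hk)
  have hc := Nat.coprime_of_squarefree_mul hk
  have e : (l * m).divisors.filter (fun d => l ∣ d) = m.divisors.image (fun e => l * e) := by
    ext d
    simp only [Finset.mem_filter, Nat.mem_divisors, Finset.mem_image]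
    constructor
    · rintro ⟨⟨h1, h2⟩, e, rfl⟩
      exact ⟨e, ⟨Nat.dvd_of_mul_dvd_mul_left hl0 h1, hm0.ne'⟩, rfl⟩
    · rintro ⟨e, ⟨h1, h2⟩, rfl⟩
      exact ⟨⟨Nat.mul_dvd_mul_left l h1, (Nat.mul_pos hl0 hm0).ne'⟩, Dvd.intro e rfl⟩
  rw [e, Finset.sum_image (by intro a _ b _ h; exact Nat.eq_of_mul_eq_mul_left hl0 h)]
  have e2 : ∀ e ∈ m.divisors, (μ (l * e) : ℝ) = (μ l : ℝ) * (μ e : ℝ) := by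
    intro e he
    have : Nat.Coprime l e := hc.coprime_dvd_right (Nat.dvd_of_mem_divisors he)
    rw [isMultiplicative_moebius.map_mul_of_coprime this]; push_cast; rfl
  rw [Finset.sum_congr rfl e2, ← Finset.mul_sum]
  have e3 : ∑ e ∈ m.divisors, (μ e : ℝ) = if m = 1 then 1 else 0 := by
    have h := congrArg (fun f => f m) moebius_mul_coe_zeta
    simp only [coe_mul_zeta_apply, one_apply] at h
    exact_mod_cast h
  rw [e3]
  by_cases h1 : m = 1
  · simp [h1]
  · have : l * m ≠ l := by
      intro h; apply h1; exact Nat.eq_of_mul_eq_mul_left hl0 (by rw [h, mul_one])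
    simp [h1, this]

lemma Tg_mu {N ξ l : ℕ} (hl : l ∈ SD N ξ) :
    ∑ d ∈ SD N ξ with l ∣ d, (μ d : ℝ) * Tg N ξ d = (μ l : ℝ) / Nat.totient l := by
  have e1 : ∑ d ∈ SD N ξ with l ∣ d, (μ d : ℝ) * Tg N ξ d
      = ∑ k ∈ SD N ξ, (∑ d ∈ SD N ξ with (l ∣ d ∧ d ∣ k), (μ d : ℝ)) * (1 / (Nat.totient k : ℝ)) := by
    unfold Tg
    simp_rw [Finset.mul_sum, Finset.sum_mul, Finset.sum_filter]
    have e0 : ∀ d : ℕ, (if l ∣ d then ∑ k ∈ SD N ξ, (if d ∣ k then (μ d : ℝ) * (1 / (Nat.totient k : ℝ)) else 0) else 0)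
        = ∑ k ∈ SD N ξ, (if l ∣ d then (if d ∣ k then (μ d : ℝ) * (1 / (Nat.totient k : ℝ)) else 0) else 0) := by
      intro d; split_ifs <;> simp
    simp_rw [e0]
    rw [Finset.sum_comm]
    refine Finset.sum_congr rfl fun k _ => ?_
    refine Finset.sum_congr rfl fun d _ => ?_
    by_cases h1 : l ∣ d <;> by_cases h2 : d ∣ k <;> simp [h1, h2]
  rw [e1, Finset.sum_eq_single_of_mem l hl]
  · have : (SD N ξ).filter (fun d => l ∣ d ∧ d ∣ l) = {l} := by
      ext d
      simp only [Finset.mem_filter, Finset.mem_singleton]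
      constructor
      · rintro ⟨_, h1, h2⟩; exact Nat.dvd_antisymm h2 h1
      · rintro rfl; exact ⟨hl, dvd_rfl, dvd_rfl⟩
    rw [this, Finset.sum_singleton]; ring
  · intro k hk hkl
    have hs := (mem_SD.1 hk)
    by_cases h : l ∣ k
    · have : (SD N ξ).filter (fun d => l ∣ d ∧ d ∣ k) = k.divisors.filter (fun d => l ∣ d) := by
        ext d
        simp only [Finset.mem_filter, Nat.mem_divisors]
        constructor
        · rintro ⟨_, h1, h2⟩; exact ⟨⟨h2, by have := hs.1.1; omega⟩, h1⟩
        · rintro ⟨⟨h1, _⟩, h2⟩; exact ⟨SD_dvd hk h1, h2, h1⟩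
      rw [this, mu_sum hs.2.1 h, if_neg hkl, zero_mul]
    · have : (SD N ξ).filter (fun d => l ∣ d ∧ d ∣ k) = ∅ := by
        rw [Finset.filter_eq_empty_iff]
        rintro d _ ⟨h1, h2⟩
        exact h (h1.trans h2)
      rw [this, Finset.sum_empty, zero_mul]

noncomputable def lamS (N ξ d : ℕ) : ℝ := (μ d : ℝ) * d * Tg N ξ d / Sg N ξ

lemma lamS_one {N ξ : ℕ} (h : 1 ≤ ξ) : lamS N ξ 1 = 1 := by
  unfold lamS
  have : Tg N ξ 1 = Sg N ξ := by unfold Tg Sg; simp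
  rw [this]
  simp [(Sg_pos h).ne']

lemma lamS_abs {N ξ d : ℕ} (hd : d ∈ SD N ξ) : |lamS N ξ d| ≤ 1 := by
  have hξ : 1 ≤ ξ := (mem_SD.1 hd).1.1.trans (mem_SD.1 hd).1.2
  have h0 := Sg_pos (N := N) hξ
  unfold lamS
  rw [abs_div, abs_of_pos h0, div_le_one h0, mul_assoc, abs_mul]
  have h1 : |(μ d : ℝ)| ≤ 1 := by
    have := abs_moebius_le_one (n := d)
    exact_mod_cast this
  have h2 : 0 ≤ d * Tg N ξ d := mul_nonneg (by positivity) Tg_nonneg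
  rw [abs_of_nonneg h2]
  calc |(μ d : ℝ)| * (d * Tg N ξ d) ≤ 1 * (d * Tg N ξ d) := mul_le_mul_of_nonneg_right h1 h2
    _ ≤ _ := by rw [one_mul]; exact Tg_le hd

lemma lamS_quad {N ξ : ℕ} (hξ : 1 ≤ ξ) :
    ∑ d ∈ SD N ξ, ∑ e ∈ SD N ξ, lamS N ξ d * lamS N ξ e / (Nat.lcm d e : ℝ) = 1 / Sg N ξ := by
  have h0 := Sg_pos (N := N) hξ
  have e1 : ∀ d ∈ SD N ξ, ∀ e ∈ SD N ξ, lamS N ξ d * lamS N ξ e / (Nat.lcm d e : ℝ)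
      = ∑ l ∈ SD N ξ, (Nat.totient l : ℝ) * (if l ∣ d then lamS N ξ d / d else 0) * (if l ∣ e then lamS N ξ e / e else 0) := by
    intro d hd e he
    have hd0 : 0 < d := (mem_SD.1 hd).1.1
    have he0 : 0 < e := (mem_SD.1 he).1.1
    have hg : (Nat.gcd d e : ℝ) = ∑ l ∈ SD N ξ, if l ∣ d ∧ l ∣ e then (Nat.totient l : ℝ) else 0 := by
      rw [← Finset.sum_filter]
      have : (SD N ξ).filter (fun l => l ∣ d ∧ l ∣ e) = (Nat.gcd d e).divisors := by
        ext l
        simp only [Finset.mem_filter, Nat.mem_divisors, Nat.dvd_gcd_iff]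
        constructor
        · rintro ⟨_, h⟩; exact ⟨h, (Nat.gcd_pos_of_pos_left _ hd0).ne'⟩
        · rintro ⟨h, _⟩; exact ⟨SD_dvd hd h.1, h⟩
      rw [this]; exact_mod_cast (Nat.sum_totient _).symm
    have hl : (Nat.lcm d e : ℝ) = d * e / Nat.gcd d e := by
      rw [eq_div_iff (by exact_mod_cast (Nat.gcd_pos_of_pos_left _ hd0).ne')]
      rw [mul_comm]; exact_mod_cast Nat.gcd_mul_lcm d e
    have hd0' : (d:ℝ) ≠ 0 := by positivity
    have he0' : (e:ℝ) ≠ 0 := by positivity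
    calc lamS N ξ d * lamS N ξ e / (Nat.lcm d e : ℝ) = (Nat.gcd d e : ℝ) * (lamS N ξ d / d * (lamS N ξ e / e)) := by
          rw [hl]
          field_simp
      _ = _ := by
          rw [hg, Finset.sum_mul]
          refine Finset.sum_congr rfl fun l _ => ?_
          by_cases h1 : l ∣ d <;> by_cases h2 : l ∣ e <;> simp [h1, h2, mul_assoc]
  rw [Finset.sum_congr rfl fun d hd => Finset.sum_congr rfl fun e he => e1 d hd e he]
  have e2 : ∀ l ∈ SD N ξ, (∑ d ∈ SD N ξ, ∑ e ∈ SD N ξ, (Nat.totient l : ℝ) * (if l ∣ d then lamS N ξ d / d else 0) * (if l ∣ e then lamS N ξ e / e else 0))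
      = 1 / (Nat.totient l : ℝ) * (1 / (Sg N ξ)^2) := by
    intro l hl
    have f : ∑ d ∈ SD N ξ, (if l ∣ d then lamS N ξ d / d else 0) = (μ l : ℝ) / Nat.totient l / Sg N ξ := by
      rw [← Tg_mu hl, ← Finset.sum_filter, Finset.sum_div]
      refine Finset.sum_congr rfl fun d hd => ?_
      have hd0 : (d:ℝ) ≠ 0 := by
        have := (mem_SD.1 (Finset.mem_filter.1 hd).1).1.1
        positivity
      unfold lamS; field_simp
    simp_rw [← Finset.mul_sum]
    rw [← Finset.sum_mul, ← Finset.mul_sum, f]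
    have hm : (μ l : ℝ)^2 = 1 := by
      have := moebius_sq_eq_one_of_squarefree (mem_SD.1 hl).2.1
      exact_mod_cast this
    have ht : (Nat.totient l : ℝ) ≠ 0 := by
      have := Nat.totient_pos.2 (mem_SD.1 hl).1.1
      positivity
    field_simp
    exact hm
  have e3 : ∀ F : ℕ → ℕ → ℕ → ℝ, ∑ d ∈ SD N ξ, ∑ e ∈ SD N ξ, ∑ l ∈ SD N ξ, F d e l = ∑ l ∈ SD N ξ, ∑ d ∈ SD N ξ, ∑ e ∈ SD N ξ, F d e l := by
    intro F
    rw [Finset.sum_congr rfl fun d _ => Finset.sum_comm]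
    rw [Finset.sum_comm]
  rw [e3, Finset.sum_congr rfl e2, ← Finset.sum_mul]
  change Sg N ξ * _ = _
  field_simp

theorem selberg {N ξ : ℕ} (hξ : 1 ≤ ξ) (x : ℕ) : Ph N x ≤ x / Sg N ξ + (ξ:ℝ)^2 := by
  have step1 : Ph N x ≤ ∑ n ∈ Finset.Icc 1 x, (∑ d ∈ SD N ξ, if d ∣ n then lamS N ξ d else 0)^2 := by
    have e0 : Ph N x = ∑ n ∈ RS N x, (1:ℝ) := by simp [Ph]
    rw [e0]
    have hsub : RS N x ⊆ Finset.Icc 1 x := by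
      intro n hn
      rw [mem_RS (by positivity)] at hn
      simp only [Finset.mem_Icc]
      exact ⟨hn.1, by exact_mod_cast hn.2.1⟩
    refine le_trans (Finset.sum_le_sum ?_) (Finset.sum_le_sum_of_subset_of_nonneg hsub fun n _ _ => sq_nonneg _)
    intro n hn
    rw [mem_RS (by positivity)] at hn
    rw [Finset.sum_eq_single_of_mem 1 (one_mem_SD hξ)]
    · simp [lamS_one hξ]
    · intro d hd hd1
      rw [if_neg]
      intro hdn
      obtain ⟨p, hp, hpd⟩ := Nat.exists_prime_and_dvd hd1
      have h1 := (mem_SD.1 hd).2.2 p hp hpd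
      have h2 := hn.2.2 p hp (hpd.trans hdn)
      omega
  refine step1.trans ?_
  have e1 : ∑ n ∈ Finset.Icc 1 x, (∑ d ∈ SD N ξ, if d ∣ n then lamS N ξ d else 0)^2
      = ∑ d ∈ SD N ξ, ∑ e ∈ SD N ξ, lamS N ξ d * lamS N ξ e * ((x / Nat.lcm d e : ℕ) : ℝ) := by
    simp_rw [sq, Finset.sum_mul_sum]
    rw [Finset.sum_comm]
    refine Finset.sum_congr rfl fun d hd => ?_
    rw [Finset.sum_comm]
    refine Finset.sum_congr rfl fun e he => ?_
    have : ∀ n ∈ Finset.Icc 1 x, (if d ∣ n then lamS N ξ d else 0) * (if e ∣ n then lamS N ξ e else 0)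
        = if Nat.lcm d e ∣ n then lamS N ξ d * lamS N ξ e else 0 := by
      intro n _
      have h0 := Nat.lcm_dvd_iff (m := d) (n := e) (k := n)
      by_cases h1 : d ∣ n <;> by_cases h2 : e ∣ n <;> simp [h0, h1, h2]
    rw [Finset.sum_congr rfl this, ← Finset.sum_filter, Finset.sum_const, nsmul_eq_mul, mul_comm]
    congr 2
    have := Nat.Ioc_filter_dvd_card_eq_div x (Nat.lcm d e)
    rw [← this]; rfl
  rw [e1]
  have e2 : ∀ d ∈ SD N ξ, ∀ e ∈ SD N ξ, lamS N ξ d * lamS N ξ e * ((x / Nat.lcm d e : ℕ) : ℝ)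
      ≤ x * (lamS N ξ d * lamS N ξ e / (Nat.lcm d e : ℝ)) + 1 := by
    intro d hd e he
    have hl0 : 0 < Nat.lcm d e := Nat.lcm_pos (mem_SD.1 hd).1.1 (mem_SD.1 he).1.1
    have hl0' : (0:ℝ) < Nat.lcm d e := by exact_mod_cast hl0
    have a1 : ((x / Nat.lcm d e : ℕ) : ℝ) ≤ (x:ℝ) / (Nat.lcm d e : ℝ) := Nat.cast_div_le
    have a2 : (x:ℝ) / (Nat.lcm d e : ℝ) - 1 ≤ ((x / Nat.lcm d e : ℕ) : ℝ) := by
      rw [sub_le_iff_le_add, div_le_iff₀ hl0']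
      have := Nat.lt_mul_div_succ x hl0
      have h : (x:ℝ) < (Nat.lcm d e : ℝ) * (((x / Nat.lcm d e : ℕ) : ℝ) + 1) := by exact_mod_cast this
      linarith
    have a3 : |lamS N ξ d * lamS N ξ e| ≤ 1 := by
      rw [abs_mul]
      calc _ ≤ (1:ℝ) * 1 := mul_le_mul (lamS_abs hd) (lamS_abs he) (abs_nonneg _) zero_le_one
        _ = 1 := one_mul 1
    have a4 := abs_le.1 a3
    have e3 : (x:ℝ) * (lamS N ξ d * lamS N ξ e / (Nat.lcm d e : ℝ)) = lamS N ξ d * lamS N ξ e * ((x:ℝ) / (Nat.lcm d e : ℝ)) := by ring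
    rw [e3]
    generalize lamS N ξ d * lamS N ξ e = t at *
    generalize (x:ℝ) / (Nat.lcm d e : ℝ) = u at *
    generalize ((x / Nat.lcm d e : ℕ) : ℝ) = v at *
    nlinarith
  refine (Finset.sum_le_sum fun d hd => Finset.sum_le_sum fun e he => e2 d hd e he).trans ?_
  simp_rw [Finset.sum_add_distrib, ← Finset.mul_sum]
  rw [lamS_quad hξ]
  have hc : ((SD N ξ).card : ℝ) ≤ ξ := by
    have h2 : (SD N ξ).card ≤ ξ := by
      calc _ ≤ (Finset.Icc 1 ξ).card := Finset.card_le_card (fun k hk => Finset.mem_Icc.2 (mem_SD.1 hk).1)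
        _ = ξ := by simp
    exact_mod_cast h2
  simp only [Finset.sum_const, nsmul_eq_mul, mul_one]
  have : ((SD N ξ).card : ℝ) * ((SD N ξ).card : ℝ) ≤ (ξ:ℝ)^2 := by
    rw [sq]; gcongr
  have h4 : (x:ℝ) * (1 / Sg N ξ) = x / Sg N ξ := by ring
  rw [h4]; linarith
end Selberg


section Selberg2
open scoped Classical in
noncomputable def SM (N ξ : ℕ) : Finset ℕ :=
  (Finset.Icc 1 ξ).filter (fun k => ∀ p : ℕ, p.Prime → p ∣ k → p < N)

lemma mem_SM {N ξ k : ℕ} : k ∈ SM N ξ ↔ (1 ≤ k ∧ k ≤ ξ) ∧ ∀ p : ℕ, p.Prime → p ∣ k → p < N := by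
  simp [SM]

lemma rad_sum {k : ℕ} (hk : Squarefree k) (A : Finset ℕ) (hA : ∀ n ∈ A, n ≠ 0 ∧ n.primeFactors = k.primeFactors) :
    ∑ n ∈ A, 1 / (n:ℝ) ≤ 1 / (Nat.totient k : ℝ) := by
  have hk0 : k ≠ 0 := hk.ne_zero
  let f : ℕ →* ℝ := ⟨⟨fun n => ((n:ℝ))⁻¹, by simp⟩, by intro a b; simp [mul_comm]⟩
  have hf : ∀ {p : ℕ}, p.Prime → ‖f p‖ < 1 := by
    intro p hp
    change ‖((p:ℝ))⁻¹‖ < 1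
    rw [norm_inv, Real.norm_natCast]
    exact inv_lt_one_of_one_lt₀ (by exact_mod_cast hp.one_lt)
  have h := (EulerProduct.summable_and_hasSum_factoredNumbers_prod_filter_prime_geometric hf k.primeFactors).2
  have hfil : k.primeFactors.filter Nat.Prime = k.primeFactors :=
    Finset.filter_true_of_mem fun p hp => Nat.prime_of_mem_primeFactors hp
  rw [hfil] at h
  have hkd : ∀ n ∈ A, k ∣ n := by
    intro n hn
    have := Nat.prod_primeFactors_dvd n
    rw [(hA n hn).2, Nat.prod_primeFactors_of_squarefree hk] at this
    exact this
  have hmem : ∀ n ∈ A, n / k ∈ Nat.factoredNumbers k.primeFactors := by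
    intro n hn
    rw [Nat.mem_factoredNumbers']
    intro p hp hpd
    rw [← (hA n hn).2, Nat.mem_primeFactors]
    exact ⟨hp, hpd.trans (Nat.div_dvd_of_dvd (hkd n hn)), (hA n hn).1⟩
  have h2 := sum_le_hasSum (A.attach.image (fun n => (⟨n.1 / k, hmem n.1 n.2⟩ : Nat.factoredNumbers k.primeFactors)))
    (fun i _ => by change 0 ≤ (((i:ℕ):ℝ))⁻¹; positivity) h
  rw [Finset.sum_image] at h2
  · have e : ∑ x ∈ A.attach, f (x.1 / k) = ∑ n ∈ A, f (n / k) := Finset.sum_attach A (fun n => f (n / k))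
    rw [e] at h2
    have e2 : ∑ n ∈ A, f (n / k) = k * ∑ n ∈ A, 1 / (n:ℝ) := by
      rw [Finset.mul_sum]
      refine Finset.sum_congr rfl fun n hn => ?_
      change (((n / k : ℕ) : ℝ))⁻¹ = _
      rw [Nat.cast_div (hkd n hn) (by exact_mod_cast hk0), inv_div]; ring
    rw [e2] at h2
    have e3 : (Nat.totient k : ℝ) = k * ∏ p ∈ k.primeFactors, (1 - f p) := by
      have := Nat.totient_eq_mul_prod_factors k
      have h3 : ((Nat.totient k : ℚ) : ℝ) = ((k * ∏ p ∈ k.primeFactors, (1 - (p:ℚ)⁻¹) : ℚ) : ℝ) := by rw [this]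
      push_cast at h3
      exact h3
    have hP : 0 < ∏ p ∈ k.primeFactors, (1 - f p) := by
      apply Finset.prod_pos
      intro p hp
      have := hf (Nat.prime_of_mem_primeFactors hp)
      have h4 := (le_abs_self (f p))
      rw [Real.norm_eq_abs] at this
      linarith
    have hk1 : (0:ℝ) < k := by exact_mod_cast Nat.pos_of_ne_zero hk0
    rw [e3, le_div_iff₀ (mul_pos hk1 hP)]
    rw [Finset.prod_inv_distrib] at h2
    have := mul_le_mul_of_nonneg_right h2 hP.le
    rw [inv_mul_cancel₀ hP.ne'] at this
    linarith
  · rintro ⟨a, ha⟩ _ ⟨b, hb⟩ _ hab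
    simp only [Subtype.mk.injEq] at hab ⊢
    rw [← Nat.div_mul_cancel (hkd a ha), hab, Nat.div_mul_cancel (hkd b hb)]

lemma SM_le_Sg (N ξ : ℕ) : ∑ n ∈ SM N ξ, 1 / (n:ℝ) ≤ Sg N ξ := by
  have hmap : ∀ n ∈ SM N ξ, (∏ p ∈ n.primeFactors, p) ∈ SD N ξ := by
    intro n hn
    rw [mem_SM] at hn
    have hd := Nat.prod_primeFactors_dvd n
    rw [mem_SD]
    refine ⟨⟨Nat.pos_of_dvd_of_pos hd hn.1.1, (Nat.le_of_dvd hn.1.1 hd).trans hn.1.2⟩, ?_,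
      fun p hp h => hn.2 p hp (h.trans hd)⟩
    rw [Nat.squarefree_iff_prime_squarefree]
    intro p hp hpp
    have hsq : Squarefree (∏ p ∈ n.primeFactors, p) := by
      apply Finset.squarefree_prod_of_pairwise_isCoprime
      · intro a ha b hb hab
        rw [Function.onFun, ← Nat.coprime_iff_isRelPrime]
        exact (Nat.coprime_primes (Nat.prime_of_mem_primeFactors ha) (Nat.prime_of_mem_primeFactors hb)).2 hab
      · intro a ha; exact (Nat.prime_of_mem_primeFactors ha).squarefree
    exact hp.one_lt.ne' (Nat.isUnit_iff.1 (hsq p hpp))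
  rw [← Finset.sum_fiberwise_of_maps_to hmap]
  unfold Sg
  refine Finset.sum_le_sum fun k hk => ?_
  apply rad_sum (mem_SD.1 hk).2.1
  intro n hn
  rw [Finset.mem_filter] at hn
  refine ⟨by have := (mem_SM.1 hn.1).1.1; omega, ?_⟩
  rw [← hn.2, Nat.primeFactors_prod fun p hp => Nat.prime_of_mem_primeFactors hp]

noncomputable def Hr (t : ℝ) : ℝ := ∑ n ∈ Finset.Icc 1 ⌊t⌋₊, 1 / (n:ℝ)

lemma Hr_eq (t : ℝ) : Hr t = (harmonic ⌊t⌋₊ : ℝ) := by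
  rw [harmonic_eq_sum_Icc, Hr]; push_cast; simp

lemma Hr_le {t : ℝ} (ht : 0 < t) : Hr t ≤ Real.log t + Real.eulerMascheroniConstant + 1 / t := by
  have h := Real.eulerMascheroniSeq_lt_eulerMascheroniConstant ⌊t⌋₊
  rw [Real.eulerMascheroniSeq, ← Hr_eq] at h
  have h1 : Real.log ((⌊t⌋₊ : ℝ) + 1) ≤ Real.log (t + 1) := Real.log_le_log (by positivity) (by linarith [Nat.floor_le ht.le])
  have h2 : Real.log (t + 1) ≤ Real.log t + 1 / t := by
    have e : t + 1 = t * (1 + 1 / t) := by field_simp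
    rw [e, Real.log_mul ht.ne' (by positivity)]
    have := Real.log_le_sub_one_of_pos (show 0 < 1 + 1 / t by positivity)
    linarith
  linarith

lemma Hr_ge {ξ : ℕ} (hξ : 1 ≤ ξ) : Real.log ξ + Real.eulerMascheroniConstant ≤ Hr ξ := by
  have h := Real.eulerMascheroniConstant_lt_eulerMascheroniSeq' ξ
  rw [Real.eulerMascheroniSeq', if_neg (by omega)] at h
  rw [Hr_eq, Nat.floor_natCast]; linarith

lemma SM_ge {N ξ : ℕ} (hN : 2 ≤ N) :
    Hr ξ - ∑ n ∈ Finset.Icc N ξ, ArithmeticFunction.vonMangoldt n * (Hr ((ξ:ℝ) / n) / (n * Real.log n)) ≤ ∑ n ∈ SM N ξ, 1 / (n:ℝ) := by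
  classical
  have hpt : ∀ n ∈ Finset.Icc 1 ξ, 1 / (n:ℝ) ≤ (if n ∈ SM N ξ then 1 / (n:ℝ) else 0) +
      ∑ p ∈ (Finset.Icc N ξ).filter Nat.Prime, (if p ∣ n then 1 / (n:ℝ) else 0) := by
    intro n hn
    rw [Finset.mem_Icc] at hn
    have hnn : ∀ p ∈ (Finset.Icc N ξ).filter Nat.Prime, (0:ℝ) ≤ (if p ∣ n then 1 / (n:ℝ) else 0) := by
      intro p _; split_ifs <;> positivity
    by_cases h : ∀ p : ℕ, p.Prime → p ∣ n → p < N
    · rw [if_pos (mem_SM.2 ⟨hn, h⟩)]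
      have := Finset.sum_nonneg hnn
      linarith
    · push Not at h
      obtain ⟨p, hp, hpn, hpN⟩ := h
      have hpm : p ∈ (Finset.Icc N ξ).filter Nat.Prime := by
        simp only [Finset.mem_filter, Finset.mem_Icc]
        exact ⟨⟨hpN, (Nat.le_of_dvd hn.1 hpn).trans hn.2⟩, hp⟩
      have h1 := Finset.single_le_sum hnn hpm
      rw [if_pos hpn] at h1
      have : (0:ℝ) ≤ (if n ∈ SM N ξ then 1 / (n:ℝ) else 0) := by split_ifs <;> positivity
      linarith
  have h1 : Hr ξ ≤ ∑ n ∈ SM N ξ, 1 / (n:ℝ) + ∑ p ∈ (Finset.Icc N ξ).filter Nat.Prime, Hr ((ξ:ℝ) / p) / p := by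
    rw [Hr, Nat.floor_natCast]
    refine (Finset.sum_le_sum hpt).trans ?_
    rw [Finset.sum_add_distrib, ← Finset.sum_filter, Finset.sum_comm]
    refine add_le_add (le_of_eq ?_) (Finset.sum_le_sum fun p hp => ?_)
    · refine Finset.sum_congr ?_ fun _ _ => rfl
      ext n; simp only [Finset.mem_filter, Finset.mem_Icc]
      exact ⟨fun h => h.2, fun h => ⟨(mem_SM.1 h).1, h⟩⟩
    · have hp0 : 0 < p := (Finset.mem_filter.1 hp).2.pos
      rw [← Finset.sum_filter]
      have hs : (Finset.Icc 1 ξ).filter (fun n => p ∣ n) ⊆ (Finset.Icc 1 (ξ / p)).image (fun m => p * m) := by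
        intro n hn
        simp only [Finset.mem_filter, Finset.mem_Icc, Finset.mem_image] at hn ⊢
        obtain ⟨h, m, rfl⟩ := hn
        refine ⟨m, ⟨Nat.pos_of_ne_zero (by rintro rfl; omega), ?_⟩, rfl⟩
        rw [Nat.le_div_iff_mul_le hp0, mul_comm]; exact h.2
      refine (Finset.sum_le_sum_of_subset_of_nonneg hs fun _ _ _ => by positivity).trans (le_of_eq ?_)
      rw [Finset.sum_image (by intro a _ b _ h; exact Nat.eq_of_mul_eq_mul_left hp0 h), Hr, Nat.floor_div_natCast,
        Nat.floor_natCast, Finset.sum_div]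
      refine Finset.sum_congr rfl fun m _ => ?_
      push_cast; rw [div_div, mul_comm]
  have h2 : ∑ p ∈ (Finset.Icc N ξ).filter Nat.Prime, Hr ((ξ:ℝ) / p) / p ≤
      ∑ n ∈ Finset.Icc N ξ, ArithmeticFunction.vonMangoldt n * (Hr ((ξ:ℝ) / n) / (n * Real.log n)) := by
    have hH : ∀ t, 0 ≤ Hr t := fun t => Finset.sum_nonneg fun _ _ => by positivity
    rw [Finset.sum_filter]
    refine Finset.sum_le_sum fun n hn => ?_
    rw [Finset.mem_Icc] at hn
    have hl : 0 < Real.log n := Real.log_pos (by exact_mod_cast (by omega : 1 < n))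
    split_ifs with hp
    · rw [ArithmeticFunction.vonMangoldt_apply_prime hp]
      apply le_of_eq; field_simp
    · have := hH ((ξ:ℝ) / n)
      have := ArithmeticFunction.vonMangoldt_nonneg (n := n)
      positivity
  linarith
end Selberg2


theorem Sg_lower {N ξ : ℕ} (hN : 2 ≤ N) (hL : 6 ≤ Real.log N) (hNξ : N ≤ ξ) :
    Real.log ξ + Real.eulerMascheroniConstant
      - (ef N * ((Real.log ξ + Real.eulerMascheroniConstant - Real.log N) / (N * Real.log N) + 1 / (ξ * Real.log N))
      + 1.0165 * ((Real.log ξ + Real.eulerMascheroniConstant) * (Real.log (Real.log ξ) - Real.log (Real.log N))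
        - (Real.log ξ - Real.log N) + 1 / ξ * (Fu ξ - Fu N))) ≤ Sg N ξ := by
  set γ := Real.eulerMascheroniConstant with hγ
  have hγ0 : 0 < γ := by have := Real.one_half_lt_eulerMascheroniConstant; linarith
  have hN0 : (0:ℝ) < N := by exact_mod_cast (by omega : 0 < N)
  have hNξ' : (N:ℝ) ≤ ξ := by exact_mod_cast hNξ
  have hξ0 : (0:ℝ) < ξ := by linarith
  set Q := Real.log ξ with hQ
  have hlog : ∀ t : ℝ, (N:ℝ) ≤ t → 6 ≤ Real.log t := fun t h => hL.trans (Real.log_le_log hN0 h)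
  have hlogξ : ∀ t : ℝ, (N:ℝ) ≤ t → t ≤ ξ → Real.log t ≤ Q := fun t h h' => Real.log_le_log (by linarith) h'
  have ha := abel_real (N := N) (by omega) (g := fun t => (Q + γ - Real.log t) / (t * Real.log t) + 1 / (ξ * Real.log t))
    (G := fun t => (Q + γ) * Real.log (Real.log t) - Real.log t + 1 / ξ * Fu t)
    (G' := fun t => (Q + γ) * (1 / t / Real.log t) - 1 / t + 1 / ξ * (1 / Real.log t + 2 / Real.log t ^ 3 - 12 / Real.log t ^ 4))
    hNξ'
    (fun t a b => by
      have h1 := hlog t a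
      have h2 := hlogξ t a b
      have ht : 0 < t := by linarith
      have : 0 ≤ Q + γ - Real.log t := by linarith
      positivity)
    (fun s t a b c => by
      have h1 := hlog s a
      have hs : 0 < s := by linarith
      have hst : Real.log s ≤ Real.log t := Real.log_le_log hs b
      have h2 := hlogξ t (a.trans b) c
      beta_reduce
      gcongr <;> linarith)
    (fun t a b => by
      have h1 := hlog t a
      have ht : 0 < t := by linarith
      have d1 := ((Real.hasDerivAt_log ht.ne').log (by linarith)).const_mul (Q + γ)
      have d2 := (hasDeriv_Fu ht (by linarith)).const_mul (1 / (ξ:ℝ))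
      have d := (d1.sub (Real.hasDerivAt_log ht.ne')).add d2
      rw [← one_div] at d
      exact d)
    (fun t a b => by
      have h1 := hlog t a
      have ht : 0 < t := by linarith
      have hl0 : Real.log t ≠ 0 := by linarith
      have e1 : (Q + γ - Real.log t) / (t * Real.log t) = (Q + γ) * (1 / t / Real.log t) - 1 / t := by
        field_simp
      have e2 : 1 / (ξ * Real.log t) = 1 / ξ * (1 / Real.log t) := by field_simp
      beta_reduce
      rw [e1, e2]
      have := mul_le_mul_of_nonneg_left (li_step h1) (show 0 ≤ 1 / (ξ:ℝ) by positivity)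
      linarith)
  rw [Nat.floor_natCast] at ha
  have h1 := Hr_ge (ξ := ξ) (by omega)
  have h2 := SM_ge (N := N) (ξ := ξ) hN
  have h3 := SM_le_Sg N ξ
  have h4 : ∑ n ∈ Finset.Icc N ξ, ArithmeticFunction.vonMangoldt n * (Hr ((ξ:ℝ) / n) / (n * Real.log n))
      ≤ ∑ n ∈ Finset.Icc N ξ, ArithmeticFunction.vonMangoldt n * ((Q + γ - Real.log n) / (n * Real.log n) + 1 / (ξ * Real.log n)) := by
    refine Finset.sum_le_sum fun n hn => mul_le_mul_of_nonneg_left ?_ ArithmeticFunction.vonMangoldt_nonneg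
    rw [Finset.mem_Icc] at hn
    have hn' : (N:ℝ) ≤ n := by exact_mod_cast hn.1
    have hl := hlog n hn'
    have hn0 : (0:ℝ) < n := by linarith
    have h := Hr_le (t := (ξ:ℝ) / n) (by positivity)
    rw [Real.log_div hξ0.ne' hn0.ne', one_div_div] at h
    have e : (Q + γ - Real.log n) / (n * Real.log n) + 1 / (ξ * Real.log n) = (Q - Real.log n + γ + n / ξ) / (n * Real.log n) := by
      have : Real.log n ≠ 0 := by linarith
      field_simp; ring
    rw [e]; gcongr
  beta_reduce at ha
  linarith

/-- numerical core -/
theorem selb_num {w u ep γ lu FF d : ℝ} (hw0 : 0 < w) (hw : w ≤ 1/6) (hu1 : 2.599 ≤ u) (hu2 : u ≤ 2.6)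
    (hep : ep ≤ 0.05) (hep0 : 0 ≤ ep) (hγ1 : 0 < γ) (hγ2 : γ ≤ 2/3) (hlu : lu ≤ 0.95552) (hlu0 : 0 ≤ lu) (hd : d ≤ 0.001)
    (hF : FF ≤ 0.42 * w) :
    1.669 ≤ u + γ * w - (ep * ((u + γ * w - 1) * w + d * w) + 1.0165 * ((u + γ * w) * lu - (u - 1) + w * FF)) := by
  have a0 : 0 < γ * w := by positivity
  have a1 : γ * w ≤ 1/9 := by nlinarith
  have a2 : (u + γ * w) * lu ≤ (u + γ * w) * 0.95552 := mul_le_mul_of_nonneg_left hlu (by linarith)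
  have a3 : (u + γ * w - 1) * w + d * w ≤ 1.713 * w := by nlinarith
  have a4 : ep * ((u + γ * w - 1) * w + d * w) ≤ 0.05 * (1.713 * w) := by
    calc _ ≤ ep * (1.713 * w) := mul_le_mul_of_nonneg_left a3 hep0
      _ ≤ _ := mul_le_mul_of_nonneg_right hep (by positivity)
  have a5 : w * FF ≤ 0.42 * w * (1/6) := by nlinarith
  nlinarith

theorem FF_aux {w u : ℝ} (hw0 : 0 < w) (hw6 : w ≤ 1/6) (hu1 : 2.599 ≤ u) :
    w / u + (w / u)^2 + 4 * (w / u)^3 ≤ 0.42 * w := by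
  have hu0 : 0 < u := by linarith
  have h1 : w / u ≤ 0.38477 * w := by
    rw [div_le_iff₀ hu0]; nlinarith
  have h0 : 0 ≤ w / u := by positivity
  have h2 : (w / u)^2 ≤ (0.38477 * w)^2 := by gcongr
  have h3 : (w / u)^3 ≤ (0.38477 * w)^3 := by gcongr
  have h4 : w^2 ≤ w * (1/6) := by nlinarith
  have h5 : w^3 ≤ w * (1/36) := by nlinarith
  rw [mul_pow] at h2 h3
  linarith

set_option maxHeartbeats 1000000 in
theorem selberg_large {N : ℕ} (hN : 410 ≤ N) (hL : 6 ≤ Real.log N) (hef : ef N ≤ 0.05 * N) (x : ℕ)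
    (hx : Real.exp (6.75 * Real.log N) ≤ x) : Ph N x ≤ 0.6 / Real.log N * x := by
  have hN0 : (0:ℝ) < N := by exact_mod_cast (by omega : 0 < N)
  have hN1 : (410:ℝ) ≤ N := by exact_mod_cast hN
  set L := Real.log N with hLdef
  have hL0 : 0 < L := by linarith
  set w := 1 / L with hw
  have hwL : w * L = 1 := by rw [hw]; field_simp
  have hw0 : 0 < w := by positivity
  have hw6 : w ≤ 1/6 := one_div_le_one_div_of_le (by norm_num) hL
  set R := Real.exp (2.6 * L) with hR
  set ξ := ⌊R⌋₊ with hξ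
  have hRN : (N:ℝ) * 1001 ≤ R := by
    have e : R = Real.exp L * Real.exp (1.6 * L) := by rw [hR, ← Real.exp_add]; ring_nf
    rw [e, hLdef, Real.exp_log hN0, ← hLdef]
    have : Real.exp 9 ≤ Real.exp (1.6 * L) := Real.exp_le_exp.2 (by linarith)
    have e9 : Real.exp 9 = Real.exp 1 ^ 9 := by rw [← Real.exp_nat_mul]; norm_num
    have h1 := Real.exp_one_gt_d9
    have : (2.7:ℝ)^9 ≤ Real.exp 1 ^ 9 := by gcongr; linarith
    have : (1001:ℝ) ≤ 2.7^9 := by norm_num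
    gcongr; linarith
  have hξ1 : R - 1 ≤ ξ := (Nat.sub_one_lt_floor R).le
  have hξ2 : (ξ:ℝ) ≤ R := Nat.floor_le (by positivity)
  have hξN : (N:ℝ) * 1000 ≤ ξ := by linarith
  have hξ0 : (0:ℝ) < ξ := by linarith
  have hNξ : N ≤ ξ := by
    have : (N:ℝ) ≤ ξ := by linarith
    exact_mod_cast this
  set Q := Real.log ξ with hQ
  have hQ2 : Q ≤ 2.6 * L := by
    have := Real.log_le_log hξ0 hξ2
    rwa [hR, Real.log_exp] at this
  have hQ1 : 2.599 * L ≤ Q := by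
    have h1 : Real.log (R * (1 - 1/1001)) ≤ Q := by
      apply Real.log_le_log (by have : 0 < R := Real.exp_pos _
                                positivity)
      nlinarith
    rw [Real.log_mul (Real.exp_pos _).ne' (by norm_num), Real.log_exp] at h1
    have h2 := Real.one_sub_inv_le_log_of_pos (show (0:ℝ) < 1 - 1/1001 by norm_num)
    norm_num at h2 h1
    linarith
  have hlow := Sg_lower (by omega) hL hNξ
  rw [← hLdef, ← hQ] at hlow
  have hγ1 := Real.one_half_lt_eulerMascheroniConstant
  have hγ2 := Real.eulerMascheroniConstant_lt_two_thirds
  set γ := Real.eulerMascheroniConstant with hγ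
  have hef0 : 0 ≤ ef N := ef_nonneg (by omega)
  set ep := ef N / N with hepd
  have hep0 : 0 ≤ ep := by positivity
  have hep : ep ≤ 0.05 := by rw [hepd, div_le_iff₀ hN0]; exact hef
  have hefe : ef N = ep * N := by rw [hepd]; field_simp
  set u := Q * w with hu
  have hQu : Q = u * L := by rw [hu, mul_assoc, hwL, mul_one]
  have hu1 : 2.599 ≤ u := by rw [hu, hw]; rw [mul_one_div, le_div_iff₀ hL0]; exact hQ1
  have hu2 : u ≤ 2.6 := by rw [hu, hw]; rw [mul_one_div, div_le_iff₀ hL0]; exact hQ2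
  have hu0 : 0 < u := by linarith
  have hQ0 : 0 < Q := by rw [hQu]; positivity
  have hlu : Real.log Q - Real.log L = Real.log u := by
    rw [hQu, Real.log_mul hu0.ne' hL0.ne']; ring
  have hlu2 : Real.log u ≤ 0.95552 := by
    refine (Real.log_le_log hu0 hu2).trans ?_
    rw [Real.log_le_iff_le_exp (by norm_num)]
    have := Real.sum_le_exp_of_nonneg (x := 0.95552) (by norm_num) 12
    refine le_trans ?_ this
    simp only [Finset.sum_range_succ, Finset.sum_range_zero, Nat.factorial]
    norm_num
  have hlu0 : 0 ≤ Real.log u := Real.log_nonneg (by linarith)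
  have hFN : 0 ≤ Fu N := by unfold Fu; positivity
  have hFF : 1 / (ξ:ℝ) * Fu ξ ≤ 0.42 * w := by
    have e : 1 / (ξ:ℝ) * Fu ξ = w / u + (w / u)^2 + 4 * (w / u)^3 := by
      rw [Fu, ← hQ, hQu, hw]; field_simp
    rw [e]
    exact FF_aux hw0 hw6 hu1
  have hdd : (N:ℝ) / ξ * w ≤ 0.001 := by
    have h1 : (N:ℝ) / ξ ≤ 0.001 := by rw [div_le_iff₀ hξ0]; linarith
    calc (N:ℝ) / ξ * w ≤ 0.001 * 1 := mul_le_mul h1 (by linarith) hw0.le (by norm_num)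
      _ = _ := by norm_num
  have hnum := selb_num (d := (N:ℝ) / ξ * w) (FF := 1 / (ξ:ℝ) * Fu ξ) hw0 hw6 hu1 hu2 hep hep0 (by linarith : 0 < γ) hγ2.le hlu2 hlu0
    hdd hFF
  have hS : 1.669 * L ≤ Sg N ξ := by
    refine le_trans ?_ hlow
    rw [hlu]
    have e1 : ef N * ((Q + γ - L) / (N * L) + 1 / (ξ * L)) = ep * ((u + γ * w - 1) * w + (N:ℝ) / ξ * w * w) * L := by
      rw [hefe, hQu, hw]; field_simp
    rw [e1]
    have e2 : (Q + γ) * Real.log u - (Q - L) = ((u + γ * w) * Real.log u - (u - 1)) * L := by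
      have : γ = γ * (w * L) := by rw [hwL, mul_one]
      rw [hQu]
      linear_combination Real.log u * this
    have e3 : 1 / (ξ:ℝ) * (Fu ξ - Fu N) ≤ w * (1 / (ξ:ℝ) * Fu ξ) * L := by
      have : w * (1 / (ξ:ℝ) * Fu ξ) * L = 1 / (ξ:ℝ) * Fu ξ := by
        calc _ = (w * L) * (1 / (ξ:ℝ) * Fu ξ) := by ring
          _ = _ := by rw [hwL, one_mul]
      rw [this]
      exact mul_le_mul_of_nonneg_left (by linarith) (by positivity)
    have e4 : Q + γ = (u + γ * w) * L := by
      have : γ = γ * (w * L) := by rw [hwL, mul_one]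
      linear_combination hQu + this
    rw [e2]
    have := mul_le_mul_of_nonneg_right hnum hL0.le
    clear hnum hlow
    rw [e4]
    linarith
  have hx0 : (0:ℝ) < x := lt_of_lt_of_le (Real.exp_pos _) hx
  refine (selberg (by omega : 1 ≤ ξ) x).trans ?_
  have hd : (x:ℝ) / Sg N ξ ≤ x * (0.5992 * w) := by
    rw [div_le_iff₀ (lt_of_lt_of_le (by positivity) hS)]
    have : 1 ≤ 0.5992 * w * Sg N ξ := by
      calc (1:ℝ) ≤ 0.5992 * 1.669 * (w * L) := by rw [hwL]; norm_num
        _ = 0.5992 * w * (1.669 * L) := by ring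
        _ ≤ _ := by gcongr
    nlinarith
  have hsq : (ξ:ℝ)^2 ≤ x * (0.0008 * w) := by
    have h1 : (ξ:ℝ)^2 ≤ R^2 := by gcongr
    have h2 : R^2 * Real.exp (1.55 * L) ≤ x := by
      refine le_trans (le_of_eq ?_) hx
      rw [hR, sq, ← Real.exp_add, ← Real.exp_add]; ring_nf
    have h3 : 1250 * L ≤ Real.exp (1.55 * L) := by
      have e : Real.exp (1.55 * L) = Real.exp 9 * Real.exp (1.55 * L - 9) := by
        rw [← Real.exp_add]; ring_nf
      have e9 : Real.exp 9 = Real.exp 1 ^ 9 := by rw [← Real.exp_nat_mul]; norm_num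
      have h1 := Real.exp_one_gt_d9
      have h4 : (2.718:ℝ)^9 ≤ Real.exp 1 ^ 9 := by gcongr; linarith
      have h5 : (8000:ℝ) ≤ 2.718^9 := by norm_num
      have h6 := Real.add_one_le_exp (1.55 * L - 9)
      have h7 : (8000:ℝ) ≤ Real.exp 9 := by rw [e9]; linarith
      rw [e]
      calc 1250 * L ≤ 8000 * (1.55 * L - 9 + 1) := by linarith
        _ ≤ _ := mul_le_mul h7 h6 (by linarith) (by positivity)
    have h4 : R^2 * (1250 * L) ≤ x := le_trans (mul_le_mul_of_nonneg_left h3 (by positivity)) h2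
    have h5 : R^2 = R^2 * (1250 * L) * (0.0008 * w) := by
      calc R^2 = R^2 * (w * L) := by rw [hwL, mul_one]
        _ = _ := by ring
    calc (ξ:ℝ)^2 ≤ R^2 := h1
      _ = R^2 * (1250 * L) * (0.0008 * w) := h5
      _ ≤ _ := by gcongr
  have : 0.6 / L * x = x * (0.5992 * w) + x * (0.0008 * w) := by rw [hw]; ring
  rw [this]; linarith

/-! ## Bound for `ef` -/
def eb (f : ℕ) : ℕ → ℕ → Bool :=
  Nat.rec (fun _ _ => true) (fun _ ih L a =>
    force (Nat.mul (Nat.succ L) (pt 0 L a)) fun L' =>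
      and (or (Nat.ble a 27) (Nat.ble (Nat.pow 2 (Nat.add (Nat.div (Nat.mul 111550 (Nat.succ a)) 10000) 48))
          (Nat.mul (Nat.pow (Nat.succ L') 8) (Nat.pow 2 (cond (Nat.ble a 228) 98 (cond (Nat.ble a 408) 46 0))))))
        (ih L' (Nat.succ a))) f

def ebs (m : ℕ) : ℕ := cond (Nat.ble m 228) 98 (cond (Nat.ble m 408) 46 0)

open Chebyshev Nat in
theorem eb_spec (f : ℕ) : ∀ L n, L + 1 = lcmUpto n → 0 < n → eb f L (n+1) = true →
    (∀ m, n < m → m ≤ n + f → 28 ≤ m → 2 ^ (111550 * (m+1) / 10000 + 48) ≤ (lcmUpto m)^8 * 2 ^ (ebs m)) := by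
  induction f with
  | zero =>
    intro L n hL _ h m h1 h2
    omega
  | succ f ih =>
    intro L n hL h0 h
    have h' : (force ((L+1) * pt 0 L (n+1)) fun L' =>
      ((Nat.ble (n+1) 27) || (Nat.ble (2 ^ (111550 * (n+1+1) / 10000 + 48)) ((L'+1)^8 * 2^(ebs (n+1)))))
        && eb f L' (n+1+1)) = true := h
    obtain ⟨L', hL', hf'⟩ := force_spec h'
    rw [Bool.and_eq_true, Bool.or_eq_true] at hf'
    obtain ⟨hlo, hrec⟩ := hf'
    have hstep := pt_lcm 0 L n n hL le_rfl (by simp; omega)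
    rw [← hL, hL', pow_zero] at hstep
    have hg := ih L' (n + 1) hstep (by omega) hrec
    intro m h1 h2 h28
    rcases Nat.lt_or_ge (n + 1) m with h3 | h3
    · exact hg m h3 (by omega) h28
    · have : m = n + 1 := by omega
      subst this
      rcases hlo with hlo | hlo
      · have := Nat.le_of_ble_eq_true hlo
        omega
      · have hlo := Nat.le_of_ble_eq_true hlo
        rw [← hstep]; exact hlo

set_option maxRecDepth 100000 in
theorem eb_run : eb 2047 0 2 = true := by decide +kernel

open Chebyshev Nat in
theorem ef_aux {N : ℕ} (h1 : 29 ≤ N) (h2 : N ≤ 2049) : ef N ≤ 0.05 * N + (ebs (N-1) : ℕ) * 0.0866434 := by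
  obtain ⟨m, rfl⟩ : ∃ m, N = m + 1 := ⟨N - 1, by omega⟩
  have h := eb_spec 2047 0 1 (by simp [Nat.lcmUpto]) one_pos eb_run m (by omega) (by omega) (by omega)
  rw [Nat.add_sub_cancel]
  generalize he : 111550 * (m+1) / 10000 + 48 = e at h
  generalize ebs m = s at h ⊢
  have hl2 := Real.log_two_gt_d9
  have hl2' := Real.log_two_lt_d9
  have hp := lcmUpto_pos m
  have a2 := le_log_of_two_pow_le h
  rw [Nat.cast_mul, Nat.cast_pow, Nat.cast_pow, Real.log_mul (by positivity) (by positivity), Real.log_pow, Real.log_pow, ← psi_eq_log_lcmUpto] at a2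
  have a3 : 11.1550 * ((m:ℝ) + 1) + 47 ≤ (e : ℝ) := by
    rw [← he]
    have := Nat.lt_div_mul_add (a := 111550 * (m + 1)) (b := 10000) (by norm_num)
    have : 111550 * (m + 1) + 470000 ≤ ((111550 * (m + 1)) / 10000 + 48) * 10000 := by omega
    have : 111550 * ((m : ℝ) + 1) + 470000 ≤ (((111550 * (m + 1)) / 10000 + 48 : ℕ) : ℝ) * 10000 := by exact_mod_cast this
    linarith
  unfold ef
  have e1 : (((m+1:ℕ):ℝ)) - 1 = m := by push_cast; ring
  rw [e1]
  have hs : (0:ℝ) ≤ s := Nat.cast_nonneg _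
  have hm : (0:ℝ) ≤ m := Nat.cast_nonneg _
  norm_num at a2 ⊢
  have b1 : s * Real.log 2 ≤ s * 0.6931471808 := by gcongr
  have b2 : (11.1550 * ((m:ℝ) + 1) + 47) * 0.6931471803 ≤ e * Real.log 2 := by gcongr
  linarith

theorem ef_large {N : ℕ} (h1 : 410 ≤ N) : ef N ≤ 0.05 * N := by
  rcases Nat.lt_or_ge N 2050 with h | h
  · have := ef_aux (N := N) (by omega) (by omega)
    have e : ebs (N-1) = 0 := by
      unfold ebs
      have a1 : Nat.ble (N-1) 228 = false := by
        rw [Bool.eq_false_iff]; intro h; have := Nat.le_of_ble_eq_true h; omega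
      have a2 : Nat.ble (N-1) 408 = false := by
        rw [Bool.eq_false_iff]; intro h; have := Nat.le_of_ble_eq_true h; omega
      rw [a1, a2]
      rfl
    rw [e] at this
    simpa using this
  · have hN : (2050:ℝ) ≤ N := by exact_mod_cast h
    have := psi_lo (t := (N:ℝ) - 1) (by linarith)
    unfold ef
    linarith

theorem log_six {N : ℕ} (h : 409 ≤ N) : 6 ≤ Real.log N := by
  rw [Real.le_log_iff_exp_le (by exact_mod_cast (by omega : 0 < N))]
  have h1 := Real.exp_one_lt_d9
  have h2 : Real.exp 6 = Real.exp 1 ^ 6 := by rw [← Real.exp_nat_mul]; norm_num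
  rw [h2]
  have h3 : Real.exp 1 ^ 6 ≤ 2.7182818286 ^ 6 := pow_le_pow_left₀ (Real.exp_pos _).le h1.le 6
  have h4 : (2.7182818286:ℝ) ^ 6 ≤ 409 := by norm_num
  have h5 : (409:ℝ) ≤ N := by exact_mod_cast h
  linarith

theorem large_case {N : ℕ} (hN : 410 ≤ N) (x : ℕ) (hx : N^2 ≤ x) : Ph N x ≤ 0.6 / Real.log N * x := by
  have hL := log_six (N := N) (by omega)
  rcases le_total (x:ℝ) (Real.exp (6.75 * Real.log N)) with h | h
  · exact engine_large hN hL (ef_large hN) x hx h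
  · exact selberg_large hN hL (ef_large hN) x h

theorem pi_num {L l t N e : ℝ} (hN : 410 ≤ N) (hL : 6 ≤ L) (hl : 12 ≤ l) (hl2 : l ≤ 2 * (N / 410 + 6)) (ht : (N-1)^2 ≤ t)
    (he0 : 0 ≤ e) (he : e ≤ 0.05 * N) :
    1 + e / L + 1.0165 * (t / l + t / l^2 + 4 * (t / l^3)) < 1.2 * t / l := by
  have ht0 : 0 < t := lt_of_lt_of_le (by nlinarith) ht
  have h1 : e / L ≤ 0.0084 * N := by
    rw [div_le_iff₀ (by linarith)]; nlinarith
  have h2 : t / l + t / l^2 + 4 * (t / l^3) ≤ t / l * (1 + 1/12 + 4/144) := by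
    have e1 : t / l + t / l^2 + 4 * (t / l^3) = t / l * (1 + 1 / l + 4 / l^2) := by
      field_simp
    rw [e1]
    have : 1 / l ≤ 1 / 12 := one_div_le_one_div_of_le (by norm_num) hl
    have : 4 / l^2 ≤ 4 / 144 := by
      apply div_le_div_of_nonneg_left (by norm_num) (by norm_num); nlinarith
    have : 0 ≤ t / l := by positivity
    gcongr
  have h3 : 1 + 0.0084 * N < 0.07 * (t / l) := by
    have : l * (1 + 0.0084 * N) < 0.07 * t := by
      have : l * (1 + 0.0084 * N) ≤ 2 * (N / 410 + 6) * (1 + 0.0084 * N) := by gcongr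
      nlinarith
    have hl0 : 0 < l := by linarith
    rw [show 0.07 * (t / l) = (0.07 * t) / l by ring, lt_div_iff₀ hl0]
    linarith
  have h4 : 1.2 * t / l = 1.2 * (t / l) := by ring
  have : 0 < t / l := div_pos ht0 (by linarith)
  rw [h4]
  nlinarith

theorem pi_large {N : ℕ} (hN : 410 ≤ N) {t : ℝ} (h1 : ((N:ℝ)-1)^2 ≤ t) (h2 : t < (N:ℝ)^2) :
    Ph N t < 1.2 * t / Real.log t := by
  have hL := log_six (N := N) (by omega)
  have hL' := log_six (N := N - 1) (by omega)
  rw [Nat.cast_sub (by omega), Nat.cast_one] at hL'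
  have hN1 : (410:ℝ) ≤ N := by exact_mod_cast hN
  have h := Ph_le hL (by omega) (z := t) (by nlinarith) h2
  have ht0 : 0 < t := lt_of_lt_of_le (by nlinarith) h1
  have hl : 12 ≤ Real.log t := by
    have := Real.log_le_log (by nlinarith) h1
    rw [Real.log_pow] at this
    push_cast at this
    linarith
  have hl2 : Real.log t ≤ 2 * (N / 410 + 6) := by
    have a1 := Real.log_le_log ht0 h2.le
    rw [Real.log_pow] at a1
    have a2 := Real.log_le_sub_one_of_pos (show 0 < (N:ℝ) / 410 by positivity)
    rw [Real.log_div (by positivity) (by norm_num)] at a2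
    have h410 : Real.log 410 ≤ 7 := by
      rw [Real.log_le_iff_le_exp (by norm_num)]
      have h1 := Real.exp_one_gt_d9
      have h2 : Real.exp 7 = Real.exp 1 ^ 7 := by rw [← Real.exp_nat_mul]; norm_num
      rw [h2]
      calc (410:ℝ) ≤ 2.7 ^ 7 := by norm_num
        _ ≤ _ := pow_le_pow_left₀ (by norm_num) (by linarith) 7
    push_cast at a1
    linarith
  have hFN : 0 ≤ Fu N := by
    unfold Fu; positivity
  have := pi_num hN1 hL hl hl2 h1 (ef_nonneg (by omega)) (ef_large hN)
  unfold Fu at h hFN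
  linarith

/-! ## Legendre -/
theorem Rgh_succ_of_not_prime {N : ℕ} (h : ¬ N.Prime) (n : ℕ) : Rgh (N+1) n ↔ Rgh N n := by
  constructor
  · intro a p hp hd
    have := a p hp hd
    omega
  · intro a p hp hd
    have := a p hp hd
    rcases Nat.lt_or_ge N p with h1 | h1
    · exact h1
    · have : p = N := by omega
      exact absurd (this ▸ hp) h

theorem RS_succ_of_not_prime {N : ℕ} (h : ¬ N.Prime) (x : ℝ) : RS (N+1) x = RS N x := by
  classical
  unfold RS
  apply Finset.filter_congr
  intro n _
  exact Rgh_succ_of_not_prime h n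

theorem Ph_succ_of_not_prime {N : ℕ} (h : ¬ N.Prime) (x : ℝ) : Ph (N+1) x = Ph N x := by
  rw [Ph, Ph, RS_succ_of_not_prime h]

theorem Ph_succ_of_prime {N : ℕ} (h : N.Prime) {x : ℝ} (hx : 0 ≤ x) : Ph (N+1) x = Ph N x - Ph N (x / N) := by
  classical
  have hN : 0 < N := h.pos
  have hN' : (0:ℝ) < N := by exact_mod_cast hN
  have e1 : RS N x = RS (N+1) x ∪ (RS N (x / N)).image (fun m => N * m) := by
    ext n
    rw [Finset.mem_union, Finset.mem_image, mem_RS hx, mem_RS hx]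
    constructor
    · rintro ⟨h1, h2, h3⟩
      by_cases hd : N ∣ n
      · right
        obtain ⟨m, rfl⟩ := hd
        refine ⟨m, ?_, rfl⟩
        rw [mem_RS (by positivity)]
        refine ⟨Nat.pos_of_ne_zero (by rintro rfl; simp at h1), ?_, fun p hp hd => h3 p hp (hd.mul_left _)⟩
        rw [le_div_iff₀ hN']
        push_cast at h2
        linarith
      · left
        refine ⟨h1, h2, fun p hp hpd => ?_⟩
        have := h3 p hp hpd
        rcases Nat.lt_or_ge N p with h1 | h1
        · exact h1
        · have : p = N := by omega
          exact absurd (this ▸ hpd) hd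
    · rintro (⟨h1, h2, h3⟩ | ⟨m, hm, rfl⟩)
      · exact ⟨h1, h2, fun p hp hd => (Nat.le_succ N).trans (h3 p hp hd)⟩
      · rw [mem_RS (by positivity)] at hm
        obtain ⟨h1, h2, h3⟩ := hm
        refine ⟨Nat.mul_pos hN h1, ?_, fun p hp hd => ?_⟩
        · rw [le_div_iff₀ hN'] at h2
          push_cast
          linarith
        · rcases (Nat.Prime.dvd_mul hp).1 hd with hd | hd
          · exact ((Nat.prime_dvd_prime_iff_eq hp h).1 hd).ge
          · exact h3 p hp hd
  have hdis : Disjoint (RS (N+1) x) ((RS N (x / N)).image (fun m => N * m)) := by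
    rw [Finset.disjoint_left]
    intro n hn hn'
    rw [mem_RS hx] at hn
    obtain ⟨m, -, rfl⟩ := Finset.mem_image.1 hn'
    have := hn.2.2 N h (Dvd.intro _ rfl)
    omega
  have e2 : (RS N x).card = (RS (N+1) x).card + (RS N (x/N)).card := by
    rw [e1, Finset.card_union_of_disjoint hdis, Finset.card_image_of_injective _ (fun a b hab => Nat.eq_of_mul_eq_mul_left hN hab)]
  unfold Ph
  rw [e2]
  push_cast
  ring

/-- Legendre bound with `k` primes below `N`, and density at most `v/10^12` -/
def Leg (N k v : ℕ) : Prop := ∃ V : ℝ, 0 ≤ V ∧ V ≤ v / 10^12 ∧ ∀ x : ℝ, 0 ≤ x → |Ph N x - V * x| ≤ 2^k / 4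

theorem Leg_not_prime {N k v : ℕ} (h : ¬ N.Prime) (hl : Leg N k v) : Leg (N+1) k v := by
  obtain ⟨V, h0, h1, h2⟩ := hl
  exact ⟨V, h0, h1, fun x hx => by rw [Ph_succ_of_not_prime h]; exact h2 x hx⟩

theorem Leg_prime {N k v : ℕ} (h : N.Prime) (hl : Leg N k v) : Leg (N+1) (k+1) (v - v / N) := by
  obtain ⟨V, h0, h1, h2⟩ := hl
  have hN : (0:ℝ) < N := by exact_mod_cast h.pos
  have hN1 : (1:ℝ) ≤ N := by exact_mod_cast h.pos
  refine ⟨V - V / N, ?_, ?_, fun x hx => ?_⟩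
  · have := div_le_self h0 hN1
    linarith
  · rw [Nat.cast_sub (Nat.div_le_self _ _)]
    have a1 : ((v / N : ℕ) : ℝ) ≤ v / N := Nat.cast_div_le
    have a2 : V - V / N = V * (1 - 1 / N) := by ring
    have a3 : 0 ≤ 1 - 1 / (N:ℝ) := by
      rw [sub_nonneg, div_le_one hN]; exact hN1
    calc V - V / N = V * (1 - 1 / N) := by ring
      _ ≤ v / 10^12 * (1 - 1 / N) := by gcongr
      _ = (v - v / N) / 10^12 := by ring
      _ ≤ _ := by gcongr
  · rw [Ph_succ_of_prime h hx]
    have b1 := abs_le.1 (h2 x hx)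
    have b2 := abs_le.1 (h2 (x / N) (by positivity))
    have e : V * (x / N) = V / N * x := by ring
    rw [e] at b2
    rw [abs_le, pow_succ]
    constructor <;> linarith

theorem Leg_three : Leg 3 1 500000000000 := by
  refine ⟨1/2, by norm_num, by norm_num, fun x hx => ?_⟩
  have hP1 : ∀ y : ℝ, 0 ≤ y → Ph 2 y = ⌊y⌋₊ := by
    intro y hy
    classical
    have : RS 2 y = Finset.Icc 1 ⌊y⌋₊ := by
      unfold RS
      apply Finset.filter_true_of_mem
      intro n _ p hp _
      exact hp.two_le
    rw [Ph, this]
    simp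
  have h := Ph_succ_of_prime Nat.prime_two hx
  rw [hP1 x hx, hP1 _ (by positivity)] at h
  rw [show (3:ℕ) = 2 + 1 from rfl, h]
  have e : ⌊x / ((2:ℕ):ℝ)⌋₊ = ⌊x⌋₊ / 2 := Nat.floor_div_natCast x 2
  rw [e]
  generalize hn : ⌊x⌋₊ = n
  have f1 : (n:ℝ) ≤ x := hn ▸ Nat.floor_le hx
  have f2 : x < n + 1 := hn ▸ Nat.lt_floor_add_one x
  rcases Nat.even_or_odd' n with ⟨m, rfl | rfl⟩
  · have : 2 * m / 2 = m := by omega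
    rw [this]
    push_cast at *
    rw [abs_le]; constructor <;> linarith
  · have : (2 * m + 1) / 2 = m := by omega
    rw [this]
    push_cast at *
    rw [abs_le]; constructor <;> linarith

theorem Leg_bound {N k v : ℕ} (h : Leg N k v) {x κ : ℝ} (hx : 0 ≤ x) (hk : v / 10^12 * x + 2^k / 4 ≤ κ * x) : Ph N x ≤ κ * x := by
  obtain ⟨V, h0, h1, h2⟩ := h
  have b1 := abs_le.1 (h2 x hx)
  have : V * x ≤ v / 10^12 * x := by gcongr
  linarith

/-! ## Verified table of primes -/
inductive Tb : Type where
  | nil (z : ℕ) : Tb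
  | cons (z T R l : ℕ) (t : Tb) : Tb

noncomputable def Tb.hd (t : Tb) : ℕ := Tb.rec (fun z => z) (fun z _ _ _ _ _ => z) t

def cp (P z T R f : ℕ) : ℕ → ℕ → Bool :=
  Nat.rec (fun t r => and (Nat.beq t T) (Nat.ble r R)) (fun k ih t r =>
    cond (Nat.beq (Nat.gcd P (Nat.add z k)) 1)
      (force (Nat.add t 2) fun a => force (Nat.add r (Nat.add 2 (Nat.div 1000000000 (Nat.add z k)))) fun b => ih a b)
      (ih t r)) f

noncomputable def tchk (P1 P2 : ℕ) (t : Tb) : Bool :=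
  Tb.rec (fun _ => true) (fun z T R l t ih =>
    and (Nat.ble (Nat.pow 2 l) (Nat.pow z 1024)) (and (Nat.ble (Nat.pow z 1024) (Nat.pow 2 (Nat.succ l)))
      (and (Nat.ble (Nat.succ z) (Tb.hd t)) (and (Nat.ble 23 z)
        (and (cp (cond (Nat.ble z 408) P1 P2) z T R (Nat.sub (Tb.hd t) z) 0 0) ih))))) t

def Ps (a b : ℕ) : Finset ℕ := (Finset.Ico a b).filter Nat.Prime

noncomputable def uu : ℝ := Real.log 2 / 1024

def RowOK (z T R l z' : ℕ) : Prop := z < z' ∧ 23 ≤ z ∧ (Ps z z').card ≤ T ∧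
  (∀ Z : ℝ, (z':ℝ) ≤ Z → ∑ p ∈ Ps z z', (1 / (p:ℝ) - 1 / Z) ≤ R / 10^9 - T / Z) ∧
  l * uu ≤ Real.log z ∧ Real.log z ≤ (l + 1) * uu

def TOK : Tb → Prop
  | .nil _ => True
  | .cons z T R l t => RowOK z T R l t.hd ∧ TOK t

theorem cp_spec {P z T R : ℕ} (f : ℕ) (hP : ∀ p, z ≤ p → p.Prime → Nat.gcd P p = 1) : ∀ t r, cp P z T R f t r = true →
    ∃ C : Finset ℕ, Ps z (z+f) ⊆ C ∧ C ⊆ Finset.Ico z (z+f) ∧ t + C.card = T ∧ r + ∑ n ∈ C, (1 + 1000000000 / n) ≤ R := by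
  induction f with
  | zero =>
    intro t r h
    have h' : (Nat.beq t T && Nat.ble r R) = true := h
    rw [Bool.and_eq_true] at h'
    exact ⟨∅, by simp [Ps], by simp, by simpa using Nat.eq_of_beq_eq_true h'.1, by simpa using Nat.le_of_ble_eq_true h'.2⟩
  | succ f ih =>
    intro t r h
    have h' : (cond (Nat.beq (Nat.gcd P (z + f)) 1)
      (force (t + 2) fun a => force (r + (2 + 1000000000 / (z + f))) fun b => cp P z T R f a b)
      (cp P z T R f t r)) = true := h
    have hps : Ps z (z+(f+1)) ⊆ insert (z+f) (Ps z (z+f)) := by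
      intro p hp
      simp only [Ps, Finset.mem_filter, Finset.mem_Ico, Finset.mem_insert] at hp ⊢
      rcases Nat.lt_or_ge p (z+f) with h1 | h1
      · right; exact ⟨⟨hp.1.1, h1⟩, hp.2⟩
      · left; omega
    have hico : Finset.Ico z (z+f) ⊆ Finset.Ico z (z+(f+1)) := Finset.Ico_subset_Ico_right (by omega)
    cases hb : Nat.beq (Nat.gcd P (z + f)) 1 with
    | true =>
      rw [hb] at h'
      obtain ⟨a, ha, h1⟩ := force_spec (n := t + 2) (f := fun a => force (r + (2 + 1000000000 / (z + f))) fun b => cp P z T R f a b) h'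
      obtain ⟨b, hb, h2⟩ := force_spec (n := r + (2 + 1000000000 / (z + f))) (f := fun b => cp P z T R f a b) h1
      obtain ⟨C, c1, c2, c3, c4⟩ := ih a b h2
      have hn : z + f ∉ C := fun hm => by
        have := c2 hm
        simp at this
      refine ⟨insert (z+f) C, hps.trans (Finset.insert_subset_insert _ c1), ?_, ?_, ?_⟩
      · apply Finset.insert_subset
        · simp
        · exact c2.trans hico
      · rw [Finset.card_insert_of_notMem hn]; omega
      · rw [Finset.sum_insert hn]; omega
    | false =>
      rw [hb] at h'
      obtain ⟨C, c1, c2, c3, c4⟩ := ih t r h'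
      refine ⟨C, ?_, c2.trans hico, c3, c4⟩
      intro p hp
      rcases Finset.mem_insert.1 (hps hp) with e | e
      · exfalso
        simp only [Ps, Finset.mem_filter, Finset.mem_Ico] at hp
        have := hP p hp.1.1 hp.2
        rw [e] at this
        rw [this] at hb
        exact absurd hb (by decide)
      · exact c1 e

theorem log_pow_bounds {z l M : ℕ} (hz : 0 < z) (hM : 0 < M) (a1 : 2^l ≤ z^M) (a2 : z^M ≤ 2^(l+1)) :
    l * (Real.log 2 / M) ≤ Real.log z ∧ Real.log z ≤ (l+1) * (Real.log 2 / M) := by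
  have hM' : (0:ℝ) < M := by exact_mod_cast hM
  have b1 := le_log_of_two_pow_le a1
  have b2 := log_le_of_le_two_pow (pow_pos hz M) a2
  rw [Nat.cast_pow, Real.log_pow] at b1 b2
  push_cast at b1 b2
  constructor
  · rw [← mul_div_assoc, div_le_iff₀ hM']; linarith
  · rw [← mul_div_assoc, le_div_iff₀ hM']; linarith

theorem tchk_spec {P1 P2 : ℕ} (h1 : P1 = Nat.factorial 22) (h2 : P2 = Nat.factorial 408) (t : Tb) : tchk P1 P2 t = true → TOK t := by
  induction t with
  | nil z => intro _; trivial
  | cons z T R l t ih =>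
    intro h
    have h' : ((Nat.ble (2^l) (z^1024)) && ((Nat.ble (z^1024) (2^(l+1))) &&
      ((Nat.ble (z+1) (Tb.hd t)) && ((Nat.ble 23 z) && ((cp (cond (Nat.ble z 408) P1 P2) z T R (Tb.hd t - z) 0 0) && tchk P1 P2 t))))) = true := h
    simp only [Bool.and_eq_true] at h'
    obtain ⟨a1, a2, a3, a4, a5, a6⟩ := h'
    refine ⟨?_, ih a6⟩
    have a1 := Nat.le_of_ble_eq_true a1
    have a2 := Nat.le_of_ble_eq_true a2
    have a3 := Nat.le_of_ble_eq_true a3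
    have a4 := Nat.le_of_ble_eq_true a4
    have hz : (0:ℝ) < z := by exact_mod_cast (by omega : 0 < z)
    have hP : ∀ p, z ≤ p → p.Prime → Nat.gcd (cond (Nat.ble z 408) P1 P2) p = 1 := by
      intro p hp hpp
      have key : ∀ m, m < p → Nat.gcd (Nat.factorial m) p = 1 := by
        intro m hm
        rw [Nat.gcd_comm]
        exact (Nat.Prime.coprime_iff_not_dvd hpp).2 (fun hd => by have := (Nat.Prime.dvd_factorial hpp).1 hd; omega)
      cases hb : Nat.ble z 408 with
      | true => show Nat.gcd P1 p = 1; rw [h1]; exact key _ (by omega)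
      | false =>
        show Nat.gcd P2 p = 1; rw [h2]; apply key
        have : ¬ z ≤ 408 := fun hh => by rw [Nat.ble_eq_true_of_le hh] at hb; exact absurd hb (by decide)
        omega
    obtain ⟨C, c1, c2, c3, c4⟩ := cp_spec _ hP 0 0 a5
    rw [show z + (Tb.hd t - z) = Tb.hd t by omega] at c1 c2
    rw [zero_add] at c3 c4
    have hlb := log_pow_bounds (by omega) (by norm_num) a1 a2
    rw [Nat.cast_ofNat] at hlb
    refine ⟨a3, a4, c3 ▸ Finset.card_le_card c1, fun Z hZ => ?_, hlb.1, hlb.2⟩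
    · have hZ0 : 0 < Z := lt_of_lt_of_le (by exact_mod_cast (by omega : 0 < Tb.hd t)) hZ
      have hC : ∀ n ∈ C, (0:ℝ) < n ∧ (n:ℝ) ≤ Z := by
        intro n hn
        have := Finset.mem_Ico.1 (c2 hn)
        refine ⟨by exact_mod_cast (by omega : 0 < n), le_trans ?_ hZ⟩
        exact_mod_cast this.2.le
      calc ∑ p ∈ Ps z (Tb.hd t), (1 / (p:ℝ) - 1 / Z) ≤ ∑ p ∈ C, (1 / (p:ℝ) - 1 / Z) := by
            apply Finset.sum_le_sum_of_subset_of_nonneg c1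
            intro n hn _
            obtain ⟨b1, b2⟩ := hC n hn
            have := one_div_le_one_div_of_le b1 b2
            linarith
        _ = ∑ p ∈ C, 1 / (p:ℝ) - T / Z := by
            rw [Finset.sum_sub_distrib, Finset.sum_const, c3, nsmul_eq_mul]; ring
        _ ≤ R / 10^9 - T / Z := by
            gcongr
            have : ∑ p ∈ C, 1 / (p:ℝ) ≤ ∑ n ∈ C, ((1 + 1000000000 / n : ℕ) : ℝ) / 10^9 := by
              apply Finset.sum_le_sum
              intro n hn
              obtain ⟨b1, b2⟩ := hC n hn
              have := Nat.lt_div_mul_add (a := 1000000000) (b := n) (by exact_mod_cast b1)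
              have : 1000000000 ≤ (1 + 1000000000 / n) * n := by rw [add_mul, one_mul, add_comm]; exact this.le
              have : (1000000000:ℝ) ≤ ((1 + 1000000000 / n : ℕ):ℝ) * n := by exact_mod_cast this
              rw [div_le_div_iff₀ b1 (by norm_num)]
              linarith
            refine this.trans ?_
            rw [← Finset.sum_div, ← Nat.cast_sum]
            gcongr

def tb0 (t : Tb) : Tb :=
  .cons 23 1 43478261 4632 <| .cons 24 0 0 4695 <| .cons 25 0 0 4755 <| .cons 26 0 0 4813 <|
  .cons 27 0 0 4869 <| .cons 28 0 0 4922 <| .cons 29 1 34482759 4974 <| .cons 30 0 0 5024 <|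
  .cons 31 1 32258065 5073 <| .cons 32 0 0 5120 <| .cons 33 0 0 5165 <| .cons 34 0 0 5209 <|
  .cons 35 0 0 5252 <| .cons 36 0 0 5294 <| .cons 37 1 27027028 5334 <| .cons 38 0 0 5373 <|
  .cons 39 0 0 5412 <| .cons 40 0 0 5449 <| .cons 41 1 24390244 5486 <| .cons 42 0 0 5521 <|
  .cons 43 1 23255814 5556 <| .cons 44 0 0 5590 <| .cons 45 0 0 5623 <| .cons 46 0 0 5656 <| t

def tb1 (t : Tb) : Tb :=
  .cons 47 1 21276596 5687 <| .cons 48 0 0 5719 <| .cons 49 0 0 5749 <| .cons 50 0 0 5779 <|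
  .cons 51 0 0 5808 <| .cons 52 0 0 5837 <| .cons 53 1 18867925 5865 <| .cons 54 0 0 5893 <|
  .cons 55 0 0 5920 <| .cons 56 0 0 5946 <| .cons 57 0 0 5972 <| .cons 58 0 0 5998 <|
  .cons 59 1 16949153 6023 <| .cons 60 0 0 6048 <| .cons 61 1 16393443 6073 <| .cons 62 0 0 6097 <|
  .cons 63 0 0 6120 <| .cons 64 0 0 6144 <| .cons 65 0 0 6166 <| .cons 66 0 0 6189 <|
  .cons 67 1 14925374 6211 <| .cons 68 0 0 6233 <| .cons 69 0 0 6255 <| .cons 70 0 0 6276 <| t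

def tb2 (t : Tb) : Tb :=
  .cons 71 1 14084508 6297 <| .cons 72 0 0 6318 <| .cons 73 1 13698631 6338 <| .cons 74 0 0 6358 <|
  .cons 75 0 0 6378 <| .cons 76 0 0 6397 <| .cons 77 0 0 6417 <| .cons 78 0 0 6436 <|
  .cons 79 1 12658228 6455 <| .cons 80 0 0 6473 <| .cons 81 0 0 6492 <| .cons 82 0 0 6510 <|
  .cons 83 1 12048193 6528 <| .cons 84 0 0 6545 <| .cons 85 0 0 6563 <| .cons 86 0 0 6580 <|
  .cons 87 0 0 6597 <| .cons 88 0 0 6614 <| .cons 89 1 11235956 6631 <| .cons 90 0 0 6647 <|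
  .cons 91 0 0 6663 <| .cons 92 0 0 6680 <| .cons 93 0 0 6696 <| .cons 94 0 0 6711 <| t

def tb3 (t : Tb) : Tb :=
  .cons 95 0 0 6727 <| .cons 96 0 0 6743 <| .cons 97 1 10309279 6758 <| .cons 98 0 0 6773 <|
  .cons 99 0 0 6788 <| .cons 100 0 0 6803 <| .cons 101 1 9900991 6818 <| .cons 102 0 0 6832 <|
  .cons 103 1 9708738 6846 <| .cons 104 0 0 6861 <| .cons 105 0 0 6875 <| .cons 106 0 0 6889 <|
  .cons 107 1 9345795 6903 <| .cons 108 0 0 6917 <| .cons 109 1 9174312 6930 <| .cons 110 0 0 6944 <|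
  .cons 111 0 0 6957 <| .cons 112 0 0 6970 <| .cons 113 1 8849558 6983 <| .cons 114 0 0 6996 <|
  .cons 115 0 0 7009 <| .cons 116 0 0 7022 <| .cons 117 0 0 7035 <| .cons 118 0 0 7047 <| t

def tb4 (t : Tb) : Tb :=
  .cons 119 0 0 7060 <| .cons 120 0 0 7072 <| .cons 121 0 0 7084 <| .cons 122 0 0 7097 <|
  .cons 123 0 0 7109 <| .cons 124 0 0 7121 <| .cons 125 0 0 7132 <| .cons 126 0 0 7144 <|
  .cons 127 1 7874016 7156 <| .cons 128 0 0 7168 <| .cons 129 0 0 7179 <| .cons 130 0 0 7190 <|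
  .cons 131 1 7633588 7202 <| .cons 132 0 0 7213 <| .cons 133 0 0 7224 <| .cons 134 0 0 7235 <|
  .cons 135 0 0 7246 <| .cons 136 0 0 7257 <| .cons 137 1 7299271 7268 <| .cons 138 0 0 7279 <|
  .cons 139 1 7194245 7289 <| .cons 140 0 0 7300 <| .cons 141 0 0 7310 <| .cons 142 0 0 7321 <| t

def tb5 (t : Tb) : Tb :=
  .cons 143 0 0 7331 <| .cons 144 0 0 7342 <| .cons 145 0 0 7352 <| .cons 146 0 0 7362 <|
  .cons 147 0 0 7372 <| .cons 148 0 0 7382 <| .cons 149 1 6711410 7392 <| .cons 150 0 0 7402 <|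
  .cons 151 1 6622517 7412 <| .cons 152 0 0 7421 <| .cons 153 0 0 7431 <| .cons 154 0 0 7441 <|
  .cons 155 0 0 7450 <| .cons 156 0 0 7460 <| .cons 157 1 6369427 7469 <| .cons 158 0 0 7479 <|
  .cons 159 0 0 7488 <| .cons 160 0 0 7497 <| .cons 161 0 0 7506 <| .cons 162 0 0 7516 <|
  .cons 163 1 6134970 7525 <| .cons 164 0 0 7534 <| .cons 165 0 0 7543 <| .cons 166 0 0 7552 <| t

def tb6 (t : Tb) : Tb :=
  .cons 167 1 5988024 7560 <| .cons 168 0 0 7569 <| .cons 169 0 0 7578 <| .cons 170 0 0 7587 <|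
  .cons 171 0 0 7595 <| .cons 172 0 0 7604 <| .cons 173 1 5780347 7613 <| .cons 174 0 0 7621 <|
  .cons 175 0 0 7630 <| .cons 176 0 0 7638 <| .cons 177 0 0 7646 <| .cons 178 0 0 7655 <|
  .cons 179 1 5586593 7663 <| .cons 180 0 0 7671 <| .cons 181 1 5524862 7679 <| .cons 182 0 0 7687 <|
  .cons 183 0 0 7696 <| .cons 184 0 0 7704 <| .cons 185 0 0 7712 <| .cons 186 0 0 7720 <|
  .cons 187 0 0 7728 <| .cons 188 0 0 7735 <| .cons 189 0 0 7743 <| .cons 190 0 0 7751 <| t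

def tb7 (t : Tb) : Tb :=
  .cons 191 1 5235603 7759 <| .cons 192 0 0 7767 <| .cons 193 1 5181348 7774 <| .cons 194 0 0 7782 <|
  .cons 195 0 0 7789 <| .cons 196 0 0 7797 <| .cons 197 1 5076143 7804 <| .cons 198 0 0 7812 <|
  .cons 199 1 5025126 7819 <| .cons 200 0 0 7827 <| .cons 201 0 0 7834 <| .cons 202 0 0 7842 <|
  .cons 203 0 0 7849 <| .cons 204 0 0 7856 <| .cons 205 0 0 7863 <| .cons 206 0 0 7870 <|
  .cons 207 0 0 7878 <| .cons 208 0 0 7885 <| .cons 209 0 0 7892 <| .cons 210 0 0 7899 <|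
  .cons 211 1 4739337 7906 <| .cons 212 0 0 7913 <| .cons 213 0 0 7920 <| .cons 214 0 0 7927 <| t

def tb8 (t : Tb) : Tb :=
  .cons 215 0 0 7934 <| .cons 216 0 0 7941 <| .cons 217 0 0 7947 <| .cons 218 0 0 7954 <|
  .cons 219 0 0 7961 <| .cons 220 0 0 7968 <| .cons 221 0 0 7974 <| .cons 222 0 0 7981 <|
  .cons 223 1 4484305 7988 <| .cons 224 0 0 7994 <| .cons 225 0 0 8001 <| .cons 226 0 0 8007 <|
  .cons 227 1 4405287 8014 <| .cons 228 0 0 8020 <| .cons 229 1 4366813 8027 <| .cons 230 0 0 8033 <|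
  .cons 231 0 0 8040 <| .cons 232 0 0 8046 <| .cons 233 1 4291846 8052 <| .cons 234 0 0 8059 <|
  .cons 235 0 0 8065 <| .cons 236 0 0 8071 <| .cons 237 0 0 8078 <| .cons 238 0 0 8084 <| t

def tb9 (t : Tb) : Tb :=
  .cons 239 1 4184101 8090 <| .cons 240 0 0 8096 <| .cons 241 1 4149378 8102 <| .cons 242 0 0 8108 <|
  .cons 243 0 0 8115 <| .cons 244 0 0 8121 <| .cons 245 0 0 8127 <| .cons 246 0 0 8133 <|
  .cons 247 0 0 8139 <| .cons 248 0 0 8145 <| .cons 249 0 0 8151 <| .cons 250 0 0 8156 <|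
  .cons 251 1 3984064 8162 <| .cons 252 0 0 8168 <| .cons 253 0 0 8174 <| .cons 254 0 0 8180 <|
  .cons 255 0 0 8186 <| .cons 256 0 0 8192 <| .cons 257 1 3891051 8197 <| .cons 258 0 0 8203 <|
  .cons 259 0 0 8209 <| .cons 260 0 0 8214 <| .cons 261 0 0 8220 <| .cons 262 0 0 8226 <| t

def tb10 (t : Tb) : Tb :=
  .cons 263 1 3802282 8231 <| .cons 264 0 0 8237 <| .cons 265 0 0 8243 <| .cons 266 0 0 8248 <|
  .cons 267 0 0 8254 <| .cons 268 0 0 8259 <| .cons 269 1 3717473 8265 <| .cons 270 0 0 8270 <|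
  .cons 271 1 3690037 8276 <| .cons 272 0 0 8281 <| .cons 273 0 0 8286 <| .cons 274 0 0 8292 <|
  .cons 275 0 0 8297 <| .cons 276 0 0 8303 <| .cons 277 1 3610109 8308 <| .cons 278 0 0 8313 <|
  .cons 279 0 0 8319 <| .cons 280 0 0 8324 <| .cons 281 1 3558719 8329 <| .cons 282 0 0 8334 <|
  .cons 283 1 3533569 8340 <| .cons 284 0 0 8345 <| .cons 285 0 0 8350 <| .cons 286 0 0 8355 <| t

def tb11 (t : Tb) : Tb :=
  .cons 287 0 0 8360 <| .cons 288 0 0 8366 <| .cons 289 0 0 8371 <| .cons 290 0 0 8376 <|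
  .cons 291 0 0 8381 <| .cons 292 0 0 8386 <| .cons 293 1 3412970 8391 <| .cons 294 0 0 8396 <|
  .cons 295 0 0 8401 <| .cons 296 0 0 8406 <| .cons 297 0 0 8411 <| .cons 298 0 0 8416 <|
  .cons 299 0 0 8421 <| .cons 300 0 0 8426 <| .cons 301 0 0 8431 <| .cons 302 0 0 8436 <|
  .cons 303 0 0 8441 <| .cons 304 0 0 8445 <| .cons 305 0 0 8450 <| .cons 306 0 0 8455 <|
  .cons 307 1 3257329 8460 <| .cons 308 0 0 8465 <| .cons 309 0 0 8469 <| .cons 310 0 0 8474 <| t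

def tb12 (t : Tb) : Tb :=
  .cons 311 1 3215435 8479 <| .cons 312 0 0 8484 <| .cons 313 1 3194889 8488 <| .cons 314 0 0 8493 <|
  .cons 315 0 0 8498 <| .cons 316 0 0 8503 <| .cons 317 1 3154575 8507 <| .cons 318 0 0 8512 <|
  .cons 319 0 0 8517 <| .cons 320 0 0 8521 <| .cons 321 0 0 8526 <| .cons 322 0 0 8530 <|
  .cons 323 0 0 8535 <| .cons 324 0 0 8540 <| .cons 325 0 0 8544 <| .cons 326 0 0 8549 <|
  .cons 327 0 0 8553 <| .cons 328 0 0 8558 <| .cons 329 0 0 8562 <| .cons 330 0 0 8567 <|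
  .cons 331 1 3021149 8571 <| .cons 332 0 0 8576 <| .cons 333 0 0 8580 <| .cons 334 0 0 8584 <| t

def tb13 (t : Tb) : Tb :=
  .cons 335 0 0 8589 <| .cons 336 0 0 8593 <| .cons 337 1 2967360 8598 <| .cons 338 0 0 8602 <|
  .cons 339 0 0 8606 <| .cons 340 0 0 8611 <| .cons 341 0 0 8615 <| .cons 342 0 0 8619 <|
  .cons 343 0 0 8624 <| .cons 344 0 0 8628 <| .cons 345 0 0 8632 <| .cons 346 0 0 8637 <|
  .cons 347 1 2881845 8641 <| .cons 348 0 0 8645 <| .cons 349 1 2865330 8649 <| .cons 350 0 0 8654 <|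
  .cons 351 0 0 8658 <| .cons 352 0 0 8662 <| .cons 353 1 2832862 8666 <| .cons 354 0 0 8670 <|
  .cons 355 0 0 8674 <| .cons 356 0 0 8679 <| .cons 357 0 0 8683 <| .cons 358 0 0 8687 <| t

def tb14 (t : Tb) : Tb :=
  .cons 359 1 2785516 8691 <| .cons 360 0 0 8695 <| .cons 361 0 0 8699 <| .cons 362 0 0 8703 <|
  .cons 363 0 0 8707 <| .cons 364 0 0 8711 <| .cons 365 0 0 8716 <| .cons 366 0 0 8720 <|
  .cons 367 1 2724796 8724 <| .cons 368 0 0 8728 <| .cons 369 0 0 8732 <| .cons 370 0 0 8736 <|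
  .cons 371 0 0 8740 <| .cons 372 0 0 8744 <| .cons 373 1 2680966 8748 <| .cons 374 0 0 8752 <|
  .cons 375 0 0 8755 <| .cons 376 0 0 8759 <| .cons 377 0 0 8763 <| .cons 378 0 0 8767 <|
  .cons 379 1 2638523 8771 <| .cons 380 0 0 8775 <| .cons 381 0 0 8779 <| .cons 382 0 0 8783 <| t

def tb15 (t : Tb) : Tb :=
  .cons 383 1 2610967 8787 <| .cons 384 0 0 8791 <| .cons 385 0 0 8794 <| .cons 386 0 0 8798 <|
  .cons 387 0 0 8802 <| .cons 388 0 0 8806 <| .cons 389 1 2570695 8810 <| .cons 390 0 0 8813 <|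
  .cons 391 0 0 8817 <| .cons 392 0 0 8821 <| .cons 393 0 0 8825 <| .cons 394 0 0 8828 <|
  .cons 395 0 0 8832 <| .cons 396 0 0 8836 <| .cons 397 1 2518892 8840 <| .cons 398 0 0 8843 <|
  .cons 399 0 0 8847 <| .cons 400 0 0 8851 <| .cons 401 1 2493766 8854 <| .cons 402 0 0 8858 <|
  .cons 403 0 0 8862 <| .cons 404 0 0 8866 <| .cons 405 0 0 8869 <| .cons 406 0 0 8873 <| t

def tb16 (t : Tb) : Tb :=
  .cons 407 0 0 8876 <| .cons 408 0 0 8880 <| .cons 409 1 2444988 8884 <| .cons 415 1 2386635 8905 <|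
  .cons 421 1 2375297 8926 <| .cons 427 1 2320186 8947 <| .cons 433 1 2309469 8968 <| .cons 439 2 4535242 8988 <|
  .cons 445 1 2227172 9008 <| .cons 451 1 2188184 9028 <| .cons 458 2 4329026 9051 <| .cons 465 1 2141328 9073 <|
  .cons 472 0 0 9095 <| .cons 479 1 2087683 9117 <| .cons 486 2 4090049 9139 <| .cons 493 1 2004009 9160 <|
  .cons 500 1 1988072 9180 <| .cons 507 1 1964637 9201 <| .cons 514 1 1919386 9221 <| .cons 522 1 1912046 9244 <|
  .cons 530 0 0 9267 <| .cons 538 1 1848429 9289 <| .cons 546 1 1828154 9310 <| .cons 554 1 1795333 9332 <| t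

def tb17 (t : Tb) : Tb :=
  .cons 562 2 3533669 9353 <| .cons 570 2 3484417 9374 <| .cons 578 0 0 9395 <| .cons 587 2 3389919 9417 <|
  .cons 596 2 3333344 9440 <| .cons 605 2 3278769 9462 <| .cons 614 2 3236255 9484 <| .cons 623 1 1584787 9505 <|
  .cons 632 0 0 9527 <| .cons 641 3 4660869 9547 <| .cons 651 2 3048845 9570 <| .cons 661 1 1512860 9593 <|
  .cons 671 2 2962990 9615 <| .cons 681 1 1464129 9637 <| .cons 691 1 1447179 9658 <| .cons 701 2 2836972 9680 <|
  .cons 711 1 1390821 9701 <| .cons 722 1 1375516 9723 <| .cons 733 3 4063333 9746 <| .cons 744 1 1331558 9768 <|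
  .cons 755 2 2635065 9789 <| .cons 766 2 2594053 9811 <| .cons 777 1 1270649 9832 <| .cons 789 1 1254706 9854 <| t

def tb18 (t : Tb) : Tb :=
  .cons 801 2 2469140 9877 <| .cons 813 2 2433094 9899 <| .cons 825 2 2415463 9920 <| .cons 837 1 1191896 9942 <|
  .cons 850 3 3503340 9964 <| .cons 863 1 1158749 9987 <| .cons 876 4 4535224 10009 <| .cons 889 0 0 10031 <|
  .cons 902 2 2200231 10052 <| .cons 916 2 2164567 10075 <| .cons 930 2 2129936 10097 <| .cons 944 2 2105285 10119 <|
  .cons 958 2 2063994 10141 <| .cons 972 2 2040836 10163 <| .cons 987 2 2012092 10185 <| .cons 1002 2 1978248 10207 <|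
  .cons 1017 3 2930720 10229 <| .cons 1032 2 1930519 10251 <| .cons 1048 4 3788006 10274 <| .cons 1064 1 935454 10296 <|
  .cons 1080 3 2751469 10318 <| .cons 1096 3 2719911 10340 <| .cons 1113 3 2671468 10363 <| .cons 1130 0 0 10385 <| t

def tb19 (t : Tb) : Tb :=
  .cons 1147 3 2595959 10407 <| .cons 1164 2 1700712 10429 <| .cons 1182 2 1680683 10451 <| .cons 1200 3 2478736 10474 <|
  .cons 1218 3 2443680 10496 <| .cons 1237 2 1609049 10519 <| .cons 1256 1 794282 10541 <| .cons 1275 5 3894761 10563 <|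
  .cons 1294 4 3072222 10585 <| .cons 1314 3 2268734 10608 <| .cons 1334 0 0 10630 <| .cons 1354 3 2194616 10652 <|
  .cons 1375 1 724113 10675 <| .cons 1396 2 1424521 10697 <| .cons 1417 4 2801140 10719 <| .cons 1439 5 3448827 10742 <|
  .cons 1461 2 1355030 10765 <| .cons 1483 5 3355301 10787 <| .cons 1506 2 1318413 10809 <| .cons 1529 3 1946835 10832 <|
  .cons 1552 4 2560054 10854 <| .cons 1576 3 1891200 10876 <| .cons 1600 6 3722926 10899 <| .cons 1625 2 1225503 10922 <| t

def tb20 (t : Tb) : Tb :=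
  .cons 1650 4 2403867 10944 <| .cons 1675 3 1768526 10966 <| .cons 1701 3 1746580 10989 <| .cons 1727 3 1723828 11012 <|
  .cons 1753 3 1701703 11034 <| .cons 1780 4 2234671 11056 <| .cons 1807 3 1646879 11079 <| .cons 1835 2 1078765 11101 <|
  .cons 1863 6 3198341 11124 <| .cons 1892 3 1573163 11146 <| .cons 1921 3 1548282 11169 <| .cons 1951 3 1524707 11192 <|
  .cons 1981 5 2505284 11214 <| .cons 2011 5 2469683 11237 <| .cons 2042 3 1455150 11259 <| .cons 2073 5 2394889 11281 <|
  .cons 2105 4 1885940 11304 <| .cons 2137 5 2328872 11326 <| .cons 2170 1 458927 11349 <| .cons 2203 4 1809155 11371 <|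
  .cons 2237 6 2665571 11394 <| .cons 2271 5 2187069 11416 <| .cons 2306 5 2149137 11439 <| .cons 2342 5 2118158 11462 <| t

def tb21 (t : Tb) : Tb :=
  .cons 2378 6 2507711 11484 <| .cons 2415 5 2055123 11507 <| .cons 2452 4 1620104 11529 <| .cons 2490 2 796189 11552 <|
  .cons 2528 6 2357593 11575 <| .cons 2567 3 1159354 11597 <| .cons 2607 4 1526735 11620 <| .cons 2647 8 2998577 11643 <|
  .cons 2688 8 2954823 11665 <| .cons 2730 5 1819411 11688 <| .cons 2772 6 2148251 11711 <| .cons 2815 6 2112720 11733 <|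
  .cons 2858 4 1388438 11756 <| .cons 2902 5 1712950 11778 <| .cons 2947 5 1687718 11801 <| .cons 2993 6 1990091 11824 <|
  .cons 3039 6 1958701 11847 <| .cons 3086 4 1286404 11869 <| .cons 3134 5 1580613 11892 <| .cons 3182 7 2181995 11914 <|
  .cons 3231 5 1534599 11937 <| .cons 3281 8 2413124 11960 <| .cons 3332 6 1786268 11983 <| .cons 3384 5 1467775 12005 <| t

def tb22 (t : Tb) : Tb :=
  .cons 3436 6 1733612 12028 <| .cons 3489 9 2556315 12051 <| .cons 3543 7 1960744 12073 <| .cons 3598 7 1931365 12096 <|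
  .cons 3654 8 2171157 12119 <| .cons 3711 6 1603888 12142 <| .cons 3768 7 1843192 12164 <| .cons 3826 7 1814513 12187 <|
  .cons 3885 9 2296671 12209 <| .cons 3945 5 1255878 12232 <| .cons 4006 8 1984909 12255 <| .cons 4068 8 1951148 12277 <|
  .cons 4131 6 1444759 12300 <| .cons 4195 10 2363889 12323 <| .cons 4260 6 1402211 12345 <| .cons 4326 8 1837221 12368 <|
  .cons 4393 8 1805604 12391 <| .cons 4461 9 2000092 12414 <| .cons 4530 7 1531519 12436 <| .cons 4600 9 1939548 12459 <|
  .cons 4671 8 1699818 12482 <| .cons 4743 9 1880474 12504 <| .cons 4817 6 1235198 12527 <| .cons 4892 10 2026379 12550 <| t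

def tb23 (t : Tb) : Tb :=
  .cons 4968 11 2198963 12573 <| .cons 5045 10 1964906 12595 <| .cons 5123 7 1353496 12618 <| .cons 5203 9 1715018 12641 <|
  .cons 5284 7 1314998 12664 <| .cons 5366 12 2216514 12686 <| .cons 5449 12 2182926 12709 <| .cons 5534 6 1076756 12732 <|
  .cons 5620 13 2296083 12755 <| .cons 5707 9 1565226 12778 <| .cons 5796 15 2566641 12800 <| .cons 5886 6 1012900 12823 <|
  .cons 5977 10 1659460 12846 <| .cons 6070 12 1962220 12869 <| .cons 6164 10 1608935 12891 <| .cons 6260 14 2220259 12914 <|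
  .cons 6357 11 1719458 12937 <| .cons 6456 9 1381937 12960 <| .cons 6556 10 1515739 12982 <| .cons 6658 13 1940009 13005 <|
  .cons 6762 13 1907859 13028 <| .cons 6867 13 1877604 13051 <| .cons 6974 13 1851186 13074 <| .cons 7082 9 1260469 13096 <| t

def tb24 (t : Tb) : Tb :=
  .cons 7192 12 1658409 13119 <| .cons 7304 11 1495884 13142 <| .cons 7418 13 1736768 13165 <| .cons 7533 17 2240904 13188 <|
  .cons 7650 14 1815187 13210 <| .cons 7769 12 1529929 13233 <| .cons 7890 12 1509471 13256 <| .cons 8013 13 1608956 13279 <|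
  .cons 8138 14 1706285 13302 <| .cons 8265 15 1801420 13325 <| .cons 8394 11 1300335 13347 <| .cons 8525 15 1746464 13370 <|
  .cons 8658 18 2064504 13393 <| .cons 8793 15 1693944 13416 <| .cons 8930 17 1888357 13439 <| .cons 9069 15 1638531 13462 <|
  .cons 9210 16 1722302 13485 <| .cons 9353 19 2013841 13507 <| .cons 9499 14 1461109 13530 <| .cons 9647 17 1747840 13553 <|
  .cons 9797 19 1924140 13576 <| .cons 9950 14 1393129 13599 <| .cons 10105 17 1669086 13622 <| .cons 10262 16 1549687 13644 <| t

def tb25 (t : Tb) : Tb :=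
  .cons 10422 16 1525805 13667 <| .cons 10584 20 1875658 13690 <| .cons 10749 17 1567936 13713 <| .cons 10916 16 1453509 13736 <|
  .cons 11086 18 1611584 13758 <| .cons 11259 17 1499319 13781 <| .cons 11434 18 1563520 13804 <| .cons 11612 17 1452208 13827 <|
  .cons 11793 23 1934859 13850 <| .cons 11977 21 1738193 13873 <| .cons 12164 18 1467130 13896 <| .cons 12354 23 1846423 13918 <|
  .cons 12547 22 1740852 13941 <| .cons 12743 21 1634538 13964 <| .cons 12942 21 1611228 13987 <| .cons 13144 23 1736967 14010 <|
  .cons 13349 19 1412046 14033 <| .cons 13557 25 1828103 14056 <| .cons 13768 21 1513486 14079 <| .cons 13983 20 1419655 14101 <|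
  .cons 14201 20 1396248 14124 <| .cons 14422 25 1720082 14147 <| .cons 14647 27 1828943 14170 <| .cons 14875 22 1467813 14193 <| t

def tb26 (t : Tb) : Tb :=
  .cons 15107 28 1838577 14216 <| .cons 15343 25 1617553 14239 <| .cons 15582 30 1909571 14261 <| .cons 15825 23 1440888 14284 <|
  .cons 16072 23 1421003 14307 <| .cons 16323 26 1580436 14330 <| .cons 16578 24 1436484 14353 <| .cons 16837 28 1649662 14376 <|
  .cons 17100 25 1450323 14399 <| .cons 17367 31 1772006 14422 <| .cons 17638 26 1462063 14444 <| .cons 17913 31 1717432 14467 <|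
  .cons 18192 32 1745666 14490 <| .cons 18476 25 1342677 14513 <| .cons 18764 23 1215906 14536 <| .cons 19057 27 1406314 14559 <|
  .cons 19354 34 1745377 14582 <| .cons 19656 31 1565198 14604 <| .cons 19963 35 1740636 14627 <| .cons 20274 30 1468898 14650 <|
  .cons 20590 31 1493755 14673 <| .cons 20911 35 1660681 14696 <| .cons 21237 33 1540762 14719 <| .cons 21568 36 1656777 14742 <| t

def tb27 (t : Tb) : Tb :=
  .cons 21905 34 1540724 14765 <| .cons 22247 34 1517328 14787 <| .cons 22594 36 1581608 14810 <| .cons 22947 38 1643866 14833 <|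
  .cons 23305 34 1446994 14856 <| .cons 23669 41 1719062 14879 <| .cons 24038 36 1487641 14902 <| .cons 24413 33 1341771 14925 <|
  .cons 24794 37 1480458 14948 <| .cons 25181 35 1379972 14970 <| .cons 25574 43 1669196 14993 <| .cons 25973 40 1528128 15016 <|
  .cons 26378 42 1579511 15039 <| .cons 26790 40 1482306 15062 <| .cons 27208 36 1312999 15085 <| .cons 27633 46 1652101 15108 <|
  .cons 28064 39 1378944 15131 <| .cons 28502 50 1741762 15153 <| .cons 28947 43 1473656 15176 <| .cons 29399 40 1350818 15199 <|
  .cons 29858 46 1528133 15222 <| .cons 30324 40 1308544 15245 <| .cons 30797 54 1739090 15268 <| .cons 31278 42 1331885 15291 <| t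

def tb28 (t : Tb) : Tb :=
  .cons 31766 46 1435889 15314 <| .cons 32262 51 1569387 15337 <| .cons 32766 50 1515212 15359 <| .cons 33277 57 1699847 15382 <|
  .cons 33796 49 1438263 15405 <| .cons 34324 53 1532226 15428 <| .cons 34860 49 1394518 15451 <| .cons 35404 48 1345520 15474 <|
  .cons 35957 52 1435750 15497 <| .cons 36518 62 1685135 15520 <| .cons 37088 58 1550603 15542 <| .cons 37667 47 1237546 15565 <|
  .cons 38255 56 1452237 15588 <| .cons 38852 60 1532211 15611 <| .cons 39459 56 1408050 15634 <| .cons 40075 54 1337345 15657 <|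
  .cons 40701 62 1511413 15680 <| .cons 41336 64 1536075 15703 <| .cons 41981 66 1560533 15726 <| .cons 42636 63 1467488 15748 <|
  .cons 43302 58 1328788 15771 <| .cons 43978 67 1511920 15794 <| .cons 44665 64 1421640 15817 <| .cons 45362 59 1290562 15840 <| t

def tb29 (t : Tb) : Tb :=
  .cons 46070 68 1464528 15863 <| .cons 46789 64 1356936 15886 <| .cons 47520 69 1441445 15909 <| .cons 48262 70 1439242 15932 <|
  .cons 49016 73 1478389 15954 <| .cons 49781 76 1515363 15977 <| .cons 50558 66 1294943 16000 <| .cons 51347 79 1527464 16023 <|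
  .cons 52149 72 1370049 16046 <| .cons 52963 77 1442922 16069 <| .cons 53790 80 1475225 16092 <| .cons 54630 71 1289688 16115 <|
  .cons 55483 81 1449172 16137 <| .cons 56349 92 1620109 16160 <| .cons 57229 81 1404257 16183 <| .cons 58123 83 1417128 16206 <|
  .cons 59031 85 1429576 16229 <| .cons 59953 81 1340821 16252 <| .cons 60889 84 1368909 16275 <| .cons 61840 84 1347977 16298 <|
  .cons 62806 94 1484272 16321 <| .cons 63787 79 1229137 16344 <| .cons 64783 97 1485435 16366 <| .cons 65795 87 1312024 16389 <| t

def tb30 (t : Tb) : Tb :=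
  .cons 66823 100 1484926 16412 <| .cons 67867 91 1330365 16435 <| .cons 68927 86 1238119 16458 <| .cons 70003 104 1474374 16481 <|
  .cons 71096 105 1465684 16504 <| .cons 72206 98 1347164 16527 <| .cons 73334 103 1393625 16550 <| .cons 74479 106 1412161 16572 <|
  .cons 75642 100 1312003 16595 <| .cons 76823 112 1446619 16618 <| .cons 78023 102 1297163 16641 <| .cons 79242 111 1390067 16664 <|
  .cons 80480 117 1442760 16687 <| .cons 81737 114 1384302 16710 <| .cons 83014 109 1302990 16733 <| .cons 84311 117 1377102 16756 <|
  .cons 85628 113 1309534 16779 <| .cons 86965 117 1335520 16801 <| .cons 88323 124 1392430 16824 <| .cons 89703 121 1338883 16847 <|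
  .cons 91104 128 1394081 16870 <| .cons 92527 130 1394621 16893 <| .cons 93972 132 1393725 16916 <| .cons 95440 130 1351955 16939 <| t

def tb31 (t : Tb) : Tb :=
  .cons 96931 124 1269465 16962 <| .cons 98445 137 1381074 16985 <| .cons 99983 136 1349301 17008 <| .cons 101545 139 1358662 17030 <|
  .cons 103131 135 1298324 17053 <| .cons 104742 141 1335613 17076 <| .cons 106378 138 1287461 17099 <| .cons 108040 150 1377640 17122 <|
  .cons 109728 141 1275066 17145 <| .cons 111442 158 1406433 17168 <| .cons 113183 140 1227098 17191 <| .cons 114951 154 1329583 17214 <|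
  .cons 116747 155 1317745 17237 <| .cons 118571 159 1330699 17259 <| .cons 120423 169 1392582 17282 <| .cons 122304 163 1322422 17305 <|
  .cons 124215 167 1333971 17328 <| .cons 126155 160 1258417 17351 <| .cons 128126 176 1363407 17374 <| .cons 130127 168 1281288 17397 <|
  .cons 132160 176 1321705 17420 <| .cons 134225 177 1308493 17443 <| .cons 136322 189 1376161 17466 <| .cons 138452 180 1289948 17488 <| t

def tb32 (t : Tb) : Tb :=
  .cons 140615 189 1334049 17511 <| .cons 142812 177 1229643 17534 <| .cons 145043 190 1299855 17557 <| .cons 147309 200 1346929 17580 <|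
  .cons 149610 204 1352727 17603 <| .cons 151947 196 1279986 17626 <| .cons 154321 198 1273283 17649 <| .cons 156732 197 1247511 17672 <|
  .cons 159180 211 1315497 17695 <| .cons 161667 208 1276596 17717 <| .cons 164193 202 1220862 17740 <| .cons 166758 211 1255902 17763 <| t

def tbl : Tb := tb0 <| tb1 <| tb2 <| tb3 <| tb4 <| tb5 <| tb6 <| tb7 <| tb8 <| tb9 <| tb10 <| tb11 <| tb12 <| tb13 <| tb14 <| tb15 <| tb16 <| tb17 <| tb18 <| tb19 <| tb20 <| tb21 <| tb22 <| tb23 <| tb24 <| tb25 <| tb26 <| tb27 <| tb28 <| tb29 <| tb30 <| tb31 <| tb32 <| .nil 169363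

set_option maxRecDepth 100000 in
theorem tbl_run : (force (Nat.factorial 22) fun a => force (Nat.factorial 408) fun b => tchk (Nat.succ a) (Nat.succ b) tbl) = true := by
  decide +kernel

theorem tbl_ok : TOK tbl := by
  obtain ⟨a, ha, h1⟩ := force_spec (n := Nat.factorial 22) (f := fun a => force (Nat.factorial 408) fun b => tchk (Nat.succ a) (Nat.succ b) tbl) tbl_run
  obtain ⟨b, hb, h2⟩ := force_spec (n := Nat.factorial 408) (f := fun b => tchk (Nat.succ a) (Nat.succ b) tbl) h1
  exact tchk_spec ha.symm hb.symm tbl h2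

/-! ## The check for a single `N` -/
theorem uu_lo : 0.0006769015 ≤ uu := by
  unfold uu; have := Real.log_two_gt_d9; linarith
theorem uu_hi : uu ≤ 0.0006769016 := by
  unfold uu; have := Real.log_two_lt_d9; linarith
theorem uu_pos : 0 < uu := lt_of_lt_of_le (by norm_num) uu_lo

theorem Ps_split {M : Type*} [AddCommMonoid M] {N z z' : ℕ} (h1 : N ≤ z) (h2 : z ≤ z') (f : ℕ → M) :
    ∑ p ∈ Ps N z', f p = ∑ p ∈ Ps N z, f p + ∑ p ∈ Ps z z', f p := by
  unfold Ps
  rw [Finset.sum_filter, Finset.sum_filter, Finset.sum_filter]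
  exact (Finset.sum_Ico_consecutive _ h1 h2).symm

theorem RSsum_le {N Z : ℕ} {zr : ℝ} (hz : 0 ≤ zr) (g f : ℕ → ℝ) (hf : ∀ n ∈ insert 1 (Ps N Z), 0 ≤ f n)
    (hg : ∀ n ∈ RS N zr, n < N^2 → n < Z → g n ≤ f n) (hg0 : ∀ n ∈ RS N zr, ¬ (n < N^2 ∧ n < Z) → g n ≤ 0) :
    ∑ n ∈ RS N zr, g n ≤ f 1 + ∑ p ∈ Ps N Z, f p := by
  classical
  have h1 : (1:ℕ) ∉ Ps N Z := by
    intro h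
    exact Nat.not_prime_one (Finset.mem_filter.1 h).2
  rw [← Finset.sum_insert h1]
  have hsub : (RS N zr).filter (fun n => n < N^2 ∧ n < Z) ⊆ insert 1 (Ps N Z) := by
    intro n hn
    rw [Finset.mem_filter, mem_RS hz] at hn
    obtain ⟨⟨a1, a2, a3⟩, a4, a5⟩ := hn
    rw [Finset.mem_insert]
    rcases Nat.lt_or_ge 1 n with h | h
    · right
      have hp := prime_of_rgh h a3 a4
      exact Finset.mem_filter.2 ⟨Finset.mem_Ico.2 ⟨a3 n hp dvd_rfl, a5⟩, hp⟩
    · left; omega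
  calc ∑ n ∈ RS N zr, g n ≤ ∑ n ∈ RS N zr, (if n < N^2 ∧ n < Z then f n else 0) := by
        apply Finset.sum_le_sum
        intro n hn
        split_ifs with h
        · exact hg n hn h.1 h.2
        · exact hg0 n hn h
    _ = ∑ n ∈ (RS N zr).filter (fun n => n < N^2 ∧ n < Z), f n := by rw [Finset.sum_filter]
    _ ≤ _ := Finset.sum_le_sum_of_subset_of_nonneg hsub (fun n hn _ => hf n hn)

noncomputable def lw (N : ℕ) (n : ℕ) : ℝ := if n < N^2 then Real.log (((N^2 : ℕ) : ℝ) / n) else 0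

def TInv (N z cnt S W : ℕ) : Prop := (1 + (Ps N z).card ≤ cnt) ∧
  (∀ Z : ℝ, (z:ℝ) ≤ Z → (1 - 1 / Z) + ∑ p ∈ Ps N z, (1 / (p:ℝ) - 1 / Z) ≤ S / 10^9 - cnt / Z) ∧
  (2 * Real.log N + ∑ p ∈ Ps N z, lw N p ≤ W * uu)

theorem Inv_start {N l : ℕ} (hl : Real.log N ≤ (l + 1) * uu) : TInv N N 1 1000000000 (2 * l + 2) := by
  have : Ps N N = ∅ := by simp [Ps]
  refine ⟨by simp [this], fun Z _ => ?_, ?_⟩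
  · rw [this]; norm_num
  · rw [this]; push_cast; simp; linarith

theorem Inv_step {N z T R l z' cnt S W m : ℕ} (h : TInv N z cnt S W) (hr : RowOK z T R l z') (hN : N ≤ z) (hz : z < N^2)
    (hm : Real.log N ≤ (m + 1) * uu) : TInv N z' (cnt + T) (S + R) (W + T * (2 * m + 2 - l)) := by
  obtain ⟨r1, r2, r3, r4, r5, r6⟩ := hr
  obtain ⟨i1, i2, i3⟩ := h
  have hu := uu_pos
  refine ⟨?_, fun Z hZ => ?_, ?_⟩
  · have := Ps_split hN r1.le (fun _ => (1:ℕ))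
    simp only [Finset.sum_const, smul_eq_mul, mul_one] at this
    omega
  · rw [Ps_split hN r1.le]
    have a1 := i2 Z (le_trans (by exact_mod_cast r1.le) hZ)
    have a2 := r4 Z hZ
    push_cast
    rw [add_div, add_div]
    linarith
  · rw [Ps_split hN r1.le]
    have hz0 : (0:ℝ) < z := by exact_mod_cast (by omega : 0 < z)
    have hN0 : (0:ℝ) < (N^2:ℕ) := by exact_mod_cast (by omega : 0 < N^2)
    have hNz : Real.log z ≤ 2 * Real.log N := by
      have : Real.log z ≤ Real.log ((N^2:ℕ):ℝ) := Real.log_le_log hz0 (by exact_mod_cast hz.le)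
      rw [Nat.cast_pow, Real.log_pow] at this
      exact_mod_cast this
    have hlm : l ≤ 2 * m + 2 := by
      have : (l:ℝ) * uu ≤ (2 * (m + 1)) * uu := by linarith
      have := le_of_mul_le_mul_right this hu
      have : (l:ℝ) ≤ ((2 * m + 2 : ℕ):ℝ) := by push_cast; linarith
      exact_mod_cast this
    have hb : ∀ p ∈ Ps z z', lw N p ≤ ((2 * m + 2 - l : ℕ):ℝ) * uu := by
      intro p hp
      have hp' := Finset.mem_Ico.1 (Finset.mem_filter.1 hp).1
      have hzp : (z:ℝ) ≤ p := by exact_mod_cast hp'.1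
      unfold lw
      split_ifs with hlt
      · rw [Real.log_div hN0.ne' (by linarith), Nat.cast_pow, Real.log_pow, Nat.cast_sub hlm]
        have := Real.log_le_log hz0 hzp
        push_cast
        linarith
      · positivity
    have := Finset.sum_le_card_nsmul _ _ _ hb
    rw [nsmul_eq_mul] at this
    have h3 : ((Ps z z').card : ℝ) * (((2 * m + 2 - l : ℕ):ℝ) * uu) ≤ T * (((2 * m + 2 - l : ℕ):ℝ) * uu) := by
      have : ((Ps z z').card : ℝ) ≤ T := by exact_mod_cast r3
      gcongr
    have e : ((W + T * (2 * m + 2 - l) : ℕ) : ℝ) * uu = W * uu + T * (((2 * m + 2 - l : ℕ):ℝ) * uu) := by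
      rw [Nat.cast_add, Nat.cast_mul]; ring
    rw [e]
    linarith

theorem Inv_Ph {N z cnt S W : ℕ} (h : TInv N z cnt S W) {t : ℝ} (ht0 : 0 ≤ t) (ht : t < z) (ht2 : t < (N:ℝ)^2) : Ph N t ≤ cnt := by
  have := RSsum_le (N := N) (Z := z) ht0 (fun _ => 1) (fun _ => 1) (fun _ _ => zero_le_one) (fun _ _ _ _ => le_rfl) (by
    intro n hn hc
    exfalso
    apply hc
    rw [mem_RS ht0] at hn
    exact ⟨by exact_mod_cast lt_of_le_of_lt hn.2.1 ht2, by exact_mod_cast lt_of_le_of_lt hn.2.1 ht⟩)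
  simp only [Finset.sum_const, nsmul_eq_mul, mul_one] at this
  have h1 : ((1 + (Ps N z).card : ℕ):ℝ) ≤ cnt := by exact_mod_cast h.1
  push_cast at h1
  unfold Ph
  linarith

theorem Inv_Jf {N z cnt S W : ℕ} (h : TInv N z cnt S W) {t : ℝ} (ht0 : 0 < t) (ht : t ≤ z) (ht2 : t ≤ (N:ℝ)^2) :
    Jf N t ≤ S / 10^9 - cnt / z := by
  have h2 := h.2.1 z le_rfl
  have hz0 : (0:ℝ) < z := by linarith
  refine le_trans ?_ h2
  unfold Jf
  have := RSsum_le (N := N) (Z := z) ht0.le (fun m => 1 / (m:ℝ) - 1 / t) (fun m => 1 / (m:ℝ) - 1 / z) ?_ ?_ ?_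
  · simpa using this
  · intro n hn
    rw [sub_nonneg]
    rcases Finset.mem_insert.1 hn with rfl | hn
    · have : (1:ℝ) ≤ z := by
        have : 0 < z := by exact_mod_cast hz0
        exact_mod_cast this
      exact one_div_le_one_div_of_le (by norm_num) (by simpa using this)
    · have h1 := Finset.mem_filter.1 hn
      have h2 := Finset.mem_Ico.1 h1.1
      exact one_div_le_one_div_of_le (by exact_mod_cast h1.2.pos) (by exact_mod_cast h2.2.le)
  · intro n hn _ _
    have := one_div_le_one_div_of_le ht0 ht
    show 1 / (n:ℝ) - 1 / t ≤ 1 / (n:ℝ) - 1 / z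
    linarith
  · intro n hn hc
    rw [mem_RS ht0.le] at hn
    have : t ≤ n := by
      by_contra hh
      push Not at hh
      exact hc ⟨by exact_mod_cast lt_of_lt_of_le hh ht2, by exact_mod_cast lt_of_lt_of_le hh ht⟩
    have := one_div_le_one_div_of_le ht0 this
    show 1 / (n:ℝ) - 1 / t ≤ 0
    linarith

theorem Inv_If {N z cnt S W : ℕ} (h : TInv N z cnt S W) (hN : 2 ≤ N) (hz : N^2 ≤ z) :
    If N ((N^2:ℕ):ℝ) ≤ W * uu := by
  refine le_trans ?_ h.2.2
  have hN2 : 1 < N^2 := by nlinarith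
  have hp : (0:ℝ) < ((N^2:ℕ):ℝ) := by exact_mod_cast (by omega : 0 < N^2)
  unfold If
  have := RSsum_le (N := N) (Z := z) hp.le (fun m => Real.log (((N^2:ℕ):ℝ) / m)) (lw N) ?_ ?_ ?_
  · refine this.trans ?_
    gcongr
    unfold lw
    rw [if_pos hN2, Nat.cast_one, div_one, Nat.cast_pow, Real.log_pow]
    push_cast
    exact le_rfl
  · intro n hn
    unfold lw
    split_ifs with hlt
    · rcases Nat.eq_zero_or_pos n with rfl | h0
      · simp
      · apply Real.log_nonneg
        rw [le_div_iff₀ (by exact_mod_cast h0), one_mul]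
        exact_mod_cast hlt.le
    · exact le_rfl
  · intro n hn h1 _
    unfold lw
    rw [if_pos h1]
  · intro n hn hc
    rw [mem_RS hp.le] at hn
    have : N^2 ≤ n := by
      by_contra hh
      exact hc ⟨by omega, by omega⟩
    apply Real.log_nonpos (by positivity)
    rw [div_le_one (by exact_mod_cast hn.1)]
    exact_mod_cast this

/-! ## The loop over the rows of the table -/
def gmid (N E D z z' cnt S : ℕ) : ℕ :=
  ((100 * D + E * cnt) * 10000000) / (N * z) + 1 + ((10165 * (S - (cnt * 1000000000) / z')) / 10000 + 1)

def midb (N Lam E D z z' l cnt S : ℕ) : Bool :=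
  Nat.ble (10 * (Lam + 1) * gmid N E D z z' cnt S + 8868000000000) (6000000000 * (Lam + l))

def pib (z l cnt : ℕ) : Bool := Nat.ble (cnt * (l + 1) * 6769016 + 1) (12000000000 * z)

def gend (N D z cnt S : ℕ) : ℕ :=
  (D * 1000000000) / (N * N * N) + 1 + ((10165 * (S - (cnt * 1000000000) / z)) / 10000 + 1)

def finb (N Lam E D b z cnt S W : ℕ) : Bool :=
  and (Nat.ble (N * N) z)
  (and (Nat.ble ((W * 6769016 - D * 10000000000) * (Lam + 1) * 6769016) (60000000000000000000 * (N * N)))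
    (Nat.ble (6 * (1478000000000 + ((14780000000 * E) / N + 1) + 16896000000 * b) + 10 * (Lam + 1) * gend N D z cnt S)
      (18297000000 * Lam)))

noncomputable def loop (N Lam E D b : ℕ) (t : Tb) : ℕ → ℕ → ℕ → Bool :=
  Tb.rec (fun z cnt S W => finb N Lam E D b z cnt S W)
    (fun z T R l t ih cnt S W => cond (Nat.ble (N * N) z) (finb N Lam E D b z cnt S W)
      (force (cnt + T + 1) fun cnt' => force (S + R + 1) fun S' => force (W + T * (2 * Lam + 2 - l) + 1) fun W' =>
        and (midb N Lam E D z (Tb.hd t) l cnt' S') (and (pib z l cnt') (ih cnt' S' W')))) t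

theorem mid_abs {L lx Q : ℝ} {Lam l G : ℕ} (h0 : 0 < L) (h1 : L ≤ (Lam + 1) * uu) (h2 : (Lam + l) * uu ≤ lx)
    (hQ : Q ≤ G / 10^9) (hc : 10 * (Lam + 1) * G + 8868000000000 ≤ 6000000000 * (Lam + l)) :
    0.6 / L + Q ≤ 0.6 / L * lx := by
  have hu := uu_lo
  have hc' : (10 * (Lam + 1) * G + 8868000000000 : ℝ) ≤ 6000000000 * (Lam + l) := by exact_mod_cast hc
  have a : Q * L ≤ G / 10^9 * ((Lam + 1) * uu) := by
    calc Q * L ≤ G / 10^9 * L := by gcongr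
      _ ≤ _ := by gcongr
  have b := mul_le_mul_of_nonneg_right hc' uu_pos.le
  have key : 0.6 + Q * L ≤ 0.6 * lx := by nlinarith
  have e1 : 0.6 / L + Q = (0.6 + Q * L) / L := by field_simp
  have e2 : 0.6 / L * lx = (0.6 * lx) / L := by field_simp
  rw [e1, e2]
  gcongr

theorem natdiv_lt (a b : ℕ) (hb : 0 < b) : (a:ℝ) / b ≤ ((a / b + 1 : ℕ) : ℝ) := by
  have hb' : (0:ℝ) < b := by exact_mod_cast hb
  rw [div_le_iff₀ hb']
  exact_mod_cast (Nat.lt_mul_of_div_lt (Nat.lt_succ_self _) hb).le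

theorem jpart (S cnt z : ℕ) : 1.0165 * ((S:ℝ) / 10^9 - cnt / z) ≤
    (((10165 * (S - (cnt * 1000000000) / z)) / 10000 + 1 : ℕ) : ℝ) / 10^9 := by
  have h1 := natdiv_lt (10165 * (S - (cnt * 1000000000) / z)) 10000 (by norm_num)
  have h2 : ((cnt * 1000000000 / z : ℕ) : ℝ) ≤ cnt * 1000000000 / z := by
    have := @Nat.cast_div_le ℝ _ _ _ (cnt * 1000000000) z
    push_cast at this
    exact this
  have h3 : (S:ℝ) - ((cnt * 1000000000 / z : ℕ) : ℝ) ≤ ((S - (cnt * 1000000000) / z : ℕ) : ℝ) := by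
    rw [sub_le_iff_le_add]
    exact_mod_cast Nat.sub_le_iff_le_add.1 le_rfl
  rw [Nat.cast_mul] at h1
  push_cast at h1
  rw [le_div_iff₀ (by norm_num)]
  have e : (cnt:ℝ) / z * 1000000000 = cnt * 1000000000 / z := by ring
  push_cast
  nlinarith

def PiC (N : ℕ) (t : ℝ) : Prop := Ph N t < 1.2 * t / Real.log t

theorem pi_row {z l cnt : ℕ} {t P : ℝ} (hz : 23 ≤ z) (hl : Real.log z ≤ (l + 1) * uu) (ht : (z:ℝ) ≤ t) (hP : P ≤ cnt)
    (hc : cnt * (l + 1) * 6769016 + 1 ≤ 12000000000 * z) : P < 1.2 * t / Real.log t := by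
  have hz' : (23:ℝ) ≤ z := by exact_mod_cast hz
  have he := Real.exp_one_lt_d9
  have hlz : 0 < Real.log z := Real.log_pos (by linarith)
  have hlt : 0 < Real.log t := Real.log_pos (by linarith)
  have hm : Real.log t / t ≤ Real.log z / z :=
    Real.log_div_self_antitoneOn (by show Real.exp 1 ≤ _; linarith) (by show Real.exp 1 ≤ _; linarith) ht
  have hc' : (cnt * (l + 1) * 6769016 + 1 : ℝ) ≤ 12000000000 * z := by exact_mod_cast hc
  have h1 : (cnt:ℝ) * Real.log z < 1.2 * z := by
    have : (cnt:ℝ) * Real.log z ≤ cnt * ((l + 1) * 0.0006769016) := by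
      have := uu_hi
      have : Real.log z ≤ (l + 1) * 0.0006769016 := hl.trans (by gcongr)
      gcongr
    linarith
  have h2 : (cnt:ℝ) * (Real.log z / z) < 1.2 := by
    rw [← mul_div_assoc, div_lt_iff₀ (by linarith)]; exact h1
  have h3 : (cnt:ℝ) * (Real.log t / t) < 1.2 := lt_of_le_of_lt (by gcongr) h2
  rw [lt_div_iff₀ hlt]
  rw [← mul_div_assoc, div_lt_iff₀ (by linarith)] at h3
  exact lt_of_le_of_lt (mul_le_mul_of_nonneg_right hP hlt.le) h3

def MidC (N D : ℕ) (t : ℝ) : Prop := ∀ x : ℝ, x / N = t → 0.6 / Real.log N + D / x + 1.0165 * Jf N t + ef N * Ph N t / x ≤ 0.6 / Real.log N * Real.log x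

theorem mid_row {N Lam E D z T R l z' cnt S W : ℕ} (hN : 2 ≤ N) (hL : Real.log N ≤ (Lam + 1) * uu) (hL' : Lam * uu ≤ Real.log N)
    (hE : ef N ≤ E / 100) (hr : RowOK z T R l z') (hi : TInv N z' cnt S W) {t : ℝ} (h1 : (z:ℝ) ≤ t) (h2 : t < z') (h3 : t < (N:ℝ)^2)
    (hc : 10 * (Lam + 1) * gmid N E D z z' cnt S + 8868000000000 ≤ 6000000000 * (Lam + l)) : MidC N D t := by
  obtain ⟨r1, r2, r3, r4, r5, r6⟩ := hr
  intro x hx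
  have hN' : (2:ℝ) ≤ N := by exact_mod_cast hN
  have hz' : (23:ℝ) ≤ z := by exact_mod_cast r2
  have hxt : x = N * t := by rw [← hx]; field_simp
  have hx0 : (N:ℝ) * z ≤ x := by rw [hxt]; gcongr
  have hNz : (0:ℝ) < (N:ℝ) * z := by positivity
  have hxp : 0 < x := by linarith
  have hlog : (Lam + l) * uu ≤ Real.log x := by
    rw [hxt, Real.log_mul (by linarith) (by linarith)]
    have := Real.log_le_log (by linarith) h1
    linarith
  have hP := Inv_Ph hi (by linarith) h2 h3
  have hJ := Inv_Jf hi (by linarith) h2.le h3.le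
  have he0 := ef_nonneg (N := N) (by omega)
  have hQ : D / x + 1.0165 * Jf N t + ef N * Ph N t / x ≤ (gmid N E D z z' cnt S : ℕ) / 10^9 := by
    have q1 : (D:ℝ) / x ≤ D / (N * z) := by gcongr
    have q2 : ef N * Ph N t / x ≤ (E / 100) * cnt / (N * z) := by
      have := Ph_nonneg N t
      gcongr
    have q3 := jpart S cnt z'
    have q4 := natdiv_lt ((100 * D + E * cnt) * 10000000) (N * z) (by positivity)
    have e : (gmid N E D z z' cnt S : ℝ) = (((100 * D + E * cnt) * 10000000 / (N * z) + 1 : ℕ):ℝ) + (((10165 * (S - (cnt * 1000000000) / z')) / 10000 + 1 : ℕ) : ℝ) := by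
      rw [gmid, Nat.cast_add]
    rw [e, add_div]
    have q5 : (D:ℝ) / (N * z) + (E / 100) * cnt / (N * z) ≤ (((100 * D + E * cnt) * 10000000 / (N * z) + 1 : ℕ):ℝ) / 10^9 := by
      rw [le_div_iff₀ (by norm_num)]
      refine le_trans (le_of_eq ?_) q4
      rw [Nat.cast_mul N z, Nat.cast_mul, Nat.cast_add, Nat.cast_mul, Nat.cast_mul]
      push_cast
      field_simp
      ring
    linarith
  have := mid_abs (Real.log_pos (by linarith)) hL hlog hQ hc
  linarith

def FinC (N D b : ℕ) : Prop := If N ((N^2:ℕ):ℝ) ≤ 0.6 / Real.log N * (N:ℝ)^2 + D ∧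
  0.6 / Real.log N + D / (N:ℝ)^3 + 1.0165 * (Jf N ((N^2:ℕ):ℝ) + 0.6 / Real.log N * (Real.log (2^b) - 3 * Real.log N)) + ef N * (0.6 / Real.log N) / N ≤ 0.6 / Real.log N * Real.log (2^b)

theorem fin_row {N Lam E D b z cnt S W : ℕ} (hN : 2 ≤ N) (hL : Real.log N ≤ (Lam + 1) * uu) (hL' : Lam * uu ≤ Real.log N)
    (hE : ef N ≤ E / 100) (hi : TInv N z cnt S W) (hc : finb N Lam E D b z cnt S W = true) : FinC N D b := by
  unfold finb at hc
  simp only [Bool.and_eq_true] at hc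
  obtain ⟨c1, c2, c3⟩ := hc
  replace c1 := Nat.le_of_ble_eq_true c1
  replace c2 := Nat.le_of_ble_eq_true c2
  replace c3 := Nat.le_of_ble_eq_true c3
  have hN' : (2:ℝ) ≤ N := by exact_mod_cast hN
  have hlN : 0 < Real.log N := Real.log_pos (by linarith)
  have hz1 : ((N^2:ℕ):ℝ) ≤ z := by exact_mod_cast (by rw [pow_two]; exact c1 : N^2 ≤ z)
  have hI := Inv_If hi hN (by rw [pow_two]; exact c1)
  have hJ := Inv_Jf hi (t := ((N^2:ℕ):ℝ)) (by positivity) hz1 (by push_cast; exact le_rfl)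
  have hu := uu_lo
  have hu' := uu_hi
  set L := Real.log N with hLdef
  constructor
  · have c2' : (((W * 6769016 - D * 10000000000 : ℕ):ℝ) * (Lam + 1) * 6769016) ≤ 60000000000000000000 * (N * N) := by exact_mod_cast c2
    have s : (W:ℝ) * 6769016 - D * 10000000000 ≤ ((W * 6769016 - D * 10000000000 : ℕ):ℝ) := by
      rw [sub_le_iff_le_add]
      exact_mod_cast Nat.sub_le_iff_le_add.1 le_rfl
    set V := ((W * 6769016 - D * 10000000000 : ℕ):ℝ)
    have hV : 0 ≤ V := Nat.cast_nonneg _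
    have h1 : (W:ℝ) * uu - D ≤ V / 10^10 := by
      have : (W:ℝ) * uu ≤ W * 0.0006769016 := by gcongr
      rw [le_div_iff₀ (by norm_num)]
      linarith
    have h2 : L ≤ (Lam + 1) * 0.0006769016 := hL.trans (by gcongr)
    have h3 : V / 10^10 * L ≤ 0.6 * (N:ℝ)^2 := by
      calc V / 10^10 * L ≤ V / 10^10 * ((Lam + 1) * 0.0006769016) := by gcongr
        _ ≤ _ := by linarith
    have h4 : V / 10^10 ≤ 0.6 / L * (N:ℝ)^2 := by
      have : 0.6 / L * (N:ℝ)^2 = 0.6 * (N:ℝ)^2 / L := by ring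
      rw [this, le_div_iff₀ hlN]; exact h3
    linarith
  · have c3' : (6 * (1478000000000 + (((14780000000 * E) / N + 1 : ℕ):ℝ) + 16896000000 * b) + 10 * (Lam + 1) * (gend N D z cnt S : ℕ)) ≤ 18297000000 * (Lam:ℝ) := by
      exact_mod_cast c3
    have q3 := jpart S cnt z
    have q4 := natdiv_lt (D * 1000000000) (N * N * N) (by positivity)
    have q5 := natdiv_lt (14780000000 * E) N (by omega)
    have e : (gend N D z cnt S : ℝ) = ((D * 1000000000 / (N * N * N) + 1 : ℕ):ℝ) + (((10165 * (S - (cnt * 1000000000) / z)) / 10000 + 1 : ℕ) : ℝ) := by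
      rw [gend, Nat.cast_add]
    have q6 : D / (N:ℝ)^3 + 1.0165 * Jf N ((N^2:ℕ):ℝ) ≤ (gend N D z cnt S : ℝ) / 10^9 := by
      rw [e, add_div]
      have : (D:ℝ) / (N:ℝ)^3 ≤ ((D * 1000000000 / (N * N * N) + 1 : ℕ):ℝ) / 10^9 := by
        rw [le_div_iff₀ (by norm_num)]
        refine le_trans (le_of_eq ?_) q4
        rw [Nat.cast_mul, Nat.cast_mul, Nat.cast_mul]
        push_cast
        ring
      linarith
    have q7 : ef N / N ≤ (((14780000000 * E) / N + 1 : ℕ):ℝ) / 10^9 * uu := by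
      have a : (E / 100 : ℝ) / N ≤ (((14780000000 * E) / N + 1 : ℕ):ℝ) / 10^9 * uu := by
        calc (E / 100 : ℝ) / N ≤ ((14780000000 * E : ℕ) : ℝ) / N / 10^9 * 0.0006769015 := by
              rw [Nat.cast_mul]
              push_cast
              have : (0:ℝ) ≤ E / N := by positivity
              have e1 : (E / 100 : ℝ) / N = E / N * 0.01 := by ring
              have e2 : (14780000000 * E : ℝ) / N / 10^9 * 0.0006769015 = E / N * (14.78 * 0.0006769015) := by ring
              rw [e1, e2]
              gcongr
              norm_num
          _ ≤ _ := by gcongr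
      exact le_trans (by gcongr) a
    set Gd := (gend N D z cnt S : ℝ)
    set Ee := (((14780000000 * E) / N + 1 : ℕ):ℝ)
    set J := Jf N ((N^2:ℕ):ℝ)
    have hG : 0 ≤ Gd := Nat.cast_nonneg _
    have e2 : Real.log (2^b) = b * 1024 * uu := by
      rw [Real.log_pow, uu]; ring
    rw [e2]
    have q8 : (D / (N:ℝ)^3 + 1.0165 * J) * L ≤ Gd / 10^9 * ((Lam + 1) * uu) := by
      calc _ ≤ Gd / 10^9 * L := by gcongr
        _ ≤ _ := by gcongr
    have b' := mul_le_mul_of_nonneg_right c3' uu_pos.le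
    have key : 0.6 + (D / (N:ℝ)^3 + 1.0165 * J) * L + 0.6 * 1.0165 * (b * 1024 * uu - 3 * L) + 0.6 * (ef N / N) ≤ 0.6 * (b * 1024 * uu) := by
      nlinarith
    have e3 : 0.6 / L + D / (N:ℝ)^3 + 1.0165 * (J + 0.6 / L * (b * 1024 * uu - 3 * L)) + ef N * (0.6 / L) / N
        = (0.6 + (D / (N:ℝ)^3 + 1.0165 * J) * L + 0.6 * 1.0165 * (b * 1024 * uu - 3 * L) + 0.6 * (ef N / N)) / L := by
      field_simp
      ring
    have e4 : 0.6 / L * (b * 1024 * uu) = (0.6 * (b * 1024 * uu)) / L := by ring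
    rw [e3, e4]
    gcongr

theorem pib_spec {z l cnt : ℕ} (h : pib z l cnt = true) : cnt * (l + 1) * 6769016 + 1 ≤ 12000000000 * z := by
  unfold pib at h
  exact Nat.le_of_ble_eq_true h

theorem midb_spec {N Lam E D z z' l cnt S : ℕ} (h : midb N Lam E D z z' l cnt S = true) :
    10 * (Lam + 1) * gmid N E D z z' cnt S + 8868000000000 ≤ 6000000000 * (Lam + l) := by
  unfold midb at h
  exact Nat.le_of_ble_eq_true h

theorem loop_spec {N Lam E D b : ℕ} (hN : 2 ≤ N) (hL : Real.log N ≤ (Lam + 1) * uu) (hL' : Lam * uu ≤ Real.log N)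
    (hE : ef N ≤ E / 100) (t : Tb) : ∀ cnt S W, TOK t → N ≤ t.hd → TInv N t.hd cnt S W → loop N Lam E D b t cnt S W = true →
    FinC N D b ∧ ∀ s : ℝ, (t.hd : ℝ) ≤ s → s < (N:ℝ)^2 → PiC N s ∧ MidC N D s := by
  induction t with
  | nil z =>
    intro cnt S W _ _ hi h
    have h' : finb N Lam E D b z cnt S W = true := h
    refine ⟨fin_row hN hL hL' hE hi h', fun s h1 h2 => ?_⟩
    unfold finb at h'
    simp only [Bool.and_eq_true] at h'
    have c1 := Nat.le_of_ble_eq_true h'.1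
    have c2 : ((N * N : ℕ):ℝ) ≤ z := by exact_mod_cast c1
    have h1' : (z:ℝ) ≤ s := h1
    push_cast at c2
    nlinarith
  | cons z T R l t ih =>
    intro cnt S W hok hNz hi h
    have h' : (cond (Nat.ble (N * N) z) (finb N Lam E D b z cnt S W)
      (force (cnt + T + 1) fun cnt' => force (S + R + 1) fun S' => force (W + T * (2 * Lam + 2 - l) + 1) fun W' =>
        and (midb N Lam E D z (Tb.hd t) l cnt' S') (and (pib z l cnt') (loop N Lam E D b t cnt' S' W')))) = true := h
    have hi' : TInv N z cnt S W := hi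
    have hNz' : N ≤ z := hNz
    obtain ⟨hr, hok'⟩ : RowOK z T R l t.hd ∧ TOK t := hok
    cases hb : Nat.ble (N * N) z with
    | true =>
      rw [hb] at h'
      refine ⟨fin_row hN hL hL' hE hi' h', fun s h1 h2 => ?_⟩
      have c1 := Nat.le_of_ble_eq_true hb
      have c2 : ((N * N : ℕ):ℝ) ≤ z := by exact_mod_cast c1
      have h1' : (z:ℝ) ≤ s := h1
      push_cast at c2
      nlinarith
    | false =>
      rw [hb] at h'
      have hzN : z < N^2 := by
        by_contra hh
        push Not at hh
        rw [pow_two] at hh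
        rw [Nat.ble_eq_true_of_le hh] at hb
        exact Bool.noConfusion hb
      rw [cond_false] at h'
      obtain ⟨cnt', hc', h'⟩ := force_spec h'
      obtain ⟨S', hS', h'⟩ := force_spec h'
      obtain ⟨W', hW', h'⟩ := force_spec h'
      obtain rfl := Nat.succ.inj hc'
      obtain rfl := Nat.succ.inj hS'
      obtain rfl := Nat.succ.inj hW'
      rw [Bool.and_eq_true, Bool.and_eq_true] at h'
      obtain ⟨m1, m2, m3⟩ := h'
      have hi2 := Inv_step hi' hr hNz' hzN hL
      have r1 := hr.1
      obtain ⟨f1, f2⟩ := ih _ _ _ hok' (by omega) hi2 m3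
      refine ⟨f1, fun s h1 h2 => ?_⟩
      rcases lt_or_ge s (t.hd : ℝ) with hlt | hge
      · have h1' : (z:ℝ) ≤ s := h1
        refine ⟨pi_row hr.2.1 hr.2.2.2.2.2 h1' (Inv_Ph hi2 (le_trans (Nat.cast_nonneg _) h1') hlt h2) (pib_spec m2), ?_⟩
        exact mid_row hN hL hL' hE hr hi2 h1' hlt h2 (midb_spec m1)
      · exact f2 s hge h2

/-! ## The driver: all primes `29 ≤ N ≤ 409` -/
def FinP (N : ℕ) : Prop := (∀ x : ℕ, N^2 ≤ x → Ph N x ≤ 0.6 / Real.log N * x) ∧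
  (∀ t : ℝ, 9 ≤ t → t < (N:ℝ)^2 → Ph N t < 1.2 * t / Real.log t)

def Ebd (N : ℕ) : ℕ := cond (Nat.ble N 229) (850 + 5 * N) (399 + 5 * N)

theorem Ebd_spec {N : ℕ} (h1 : 29 ≤ N) (h2 : N ≤ 409) : ef N ≤ (Ebd N : ℕ) / 100 := by
  have h := ef_aux h1 (by omega)
  unfold ebs at h
  unfold Ebd
  rcases Nat.lt_or_ge 229 N with h3 | h3
  · have a : Nat.ble (N-1) 228 = false := by
      rw [← Bool.not_eq_true]; intro hh; have := Nat.le_of_ble_eq_true hh; omega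
    have a' : Nat.ble N 229 = false := by
      rw [← Bool.not_eq_true]; intro hh; have := Nat.le_of_ble_eq_true hh; omega
    have b : Nat.ble (N-1) 408 = true := Nat.ble_eq_true_of_le (by omega)
    rw [a, b] at h
    rw [a']
    simp only [cond_false, cond_true] at h ⊢
    push_cast at h ⊢
    linarith
  · have a : Nat.ble (N-1) 228 = true := Nat.ble_eq_true_of_le (by omega)
    have a' : Nat.ble N 229 = true := Nat.ble_eq_true_of_le (by omega)
    rw [a] at h
    rw [a']
    simp only [cond_true] at h ⊢
    push_cast at h ⊢
    linarith

def legb (Lam v : ℕ) : Bool :=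
  Nat.ble ((256 * v + 1000000000000) * (Lam + 1) * 6769016) 1536000000000000000000000

theorem legb_spec {N Lam k v : ℕ} (hN : 2 ≤ N) (hL : Real.log N ≤ (Lam + 1) * uu) (hleg : Leg N k v) (h : legb Lam v = true)
    {x : ℝ} (hx : 2^(k+6) ≤ x) : Ph N x ≤ 0.6 / Real.log N * x := by
  unfold legb at h
  have h := Nat.le_of_ble_eq_true h
  have h' : ((256 * v + 1000000000000) * (Lam + 1) * 6769016 : ℝ) ≤ 1536000000000000000000000 := by exact_mod_cast h
  have hN' : (2:ℝ) ≤ N := by exact_mod_cast hN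
  have hlN : 0 < Real.log N := Real.log_pos (by linarith)
  have hx0 : 0 < x := lt_of_lt_of_le (by positivity) hx
  apply Leg_bound hleg hx0.le
  have h2 : (v / 10^12 + 1/256 : ℝ) ≤ 0.6 / Real.log N := by
    rw [le_div_iff₀ hlN]
    have hu := uu_hi
    have : Real.log N ≤ (Lam + 1) * 0.0006769016 := hL.trans (by gcongr)
    calc (v / 10^12 + 1/256 : ℝ) * Real.log N ≤ (v / 10^12 + 1/256 : ℝ) * ((Lam + 1) * 0.0006769016) := by gcongr
      _ ≤ 0.6 := by linarith
  have h3 : (2:ℝ)^k / 4 ≤ 1/256 * x := by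
    rw [pow_add] at hx; linarith
  calc (v:ℝ) / 10^12 * x + 2^k/4 ≤ (v / 10^12 + 1/256 : ℝ) * x := by linarith
    _ ≤ _ := by gcongr

noncomputable def rowgood (t : Tb) (N Lam k v : ℕ) : Bool :=
  and (legb Lam v) (force (Ebd N) fun E => force (Nat.succ (N / 8)) fun D => force (Nat.add k 7) fun b =>
    loop N Lam (Nat.succ E) D b t 1 1000000000 (2 * Lam + 2))

theorem Ph_one {N : ℕ} {t : ℝ} (h0 : 0 ≤ t) (ht : t < N) : Ph N t ≤ 1 := by
  have hs : RS N t ⊆ {1} := by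
    intro n hn
    rw [mem_RS h0] at hn
    rw [Finset.mem_singleton]
    by_contra hne
    have h2 := hn.2.2 _ (Nat.minFac_prime hne) (Nat.minFac_dvd n)
    have h3 := Nat.minFac_le (n := n) (by omega)
    have : (N:ℝ) ≤ n := by exact_mod_cast h2.trans h3
    linarith
  have := Finset.card_le_card hs
  rw [Finset.card_singleton] at this
  unfold Ph
  exact_mod_cast this

theorem Ph_one_lt {N : ℕ} {t : ℝ} (h0 : 9 ≤ t) (ht : t < N) : Ph N t < 1.2 * t / Real.log t := by
  have := Ph_one (by linarith) ht
  have h1 := Real.log_le_sub_one_of_pos (x := t) (by linarith)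
  have h2 : 0 < Real.log t := Real.log_pos (by linarith)
  refine lt_of_le_of_lt this ?_
  rw [lt_div_iff₀ h2]
  linarith

theorem div_range {N y : ℕ} (hN : 0 < N) (hy1 : N^2 ≤ y) (hy2 : y < N^3) : (N:ℝ) ≤ (y:ℝ) / N ∧ (y:ℝ) / N < (N:ℝ)^2 := by
  have g1 : ((N^2:ℕ):ℝ) ≤ y := by exact_mod_cast hy1
  have g2 : (y:ℝ) < ((N^3:ℕ):ℝ) := by exact_mod_cast hy2
  have h0 : (0:ℝ) < N := by exact_mod_cast hN
  push_cast at g1 g2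
  constructor
  · rw [le_div_iff₀ h0]; nlinarith
  · rw [div_lt_iff₀ h0]; nlinarith

theorem rowgood_spec {N T R Lam k v : ℕ} {t : Tb} (h1 : 29 ≤ N) (h2 : N ≤ 409) (hok : TOK (.cons N T R Lam t)) (hleg : Leg N k v)
    (h : rowgood (.cons N T R Lam t) N Lam k v = true) : FinP N := by
  unfold rowgood at h
  rw [Bool.and_eq_true] at h
  obtain ⟨hl, h⟩ := h
  obtain ⟨E, hE, h⟩ := force_spec h
  obtain ⟨D, hD, h⟩ := force_spec h
  obtain ⟨b, hb, h⟩ := force_spec h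
  obtain ⟨hr, hok'⟩ : RowOK N T R Lam t.hd ∧ TOK t := hok
  have hb' : b = k + 6 := by
    have : k + 7 = b + 1 := hb
    omega
  subst hb'
  obtain ⟨f1, f2⟩ := loop_spec (E := E + 1) (D := D) (b := k + 6) (by omega) hr.2.2.2.2.2 hr.2.2.2.2.1 (hE ▸ Ebd_spec h1 h2) (.cons N T R Lam t) 1 1000000000
    (2 * Lam + 2) ⟨hr, hok'⟩ (le_refl N) (Inv_start hr.2.2.2.2.2) h
  have f2' : ∀ s : ℝ, (N:ℝ) ≤ s → s < (N:ℝ)^2 → PiC N s ∧ MidC N D s := f2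
  have hN0 : (29:ℝ) ≤ N := by exact_mod_cast h1
  constructor
  · intro x hx
    rcases le_total ((2:ℝ)^(k+6)) x with hh | hh
    · exact legb_spec (by omega) hr.2.2.2.2.2 hleg hl hh
    · refine engine (N := N) (κ := 0.6 / Real.log N) (D := D) (X := 2^(k+6)) (by omega) ?_ (Nat.cast_nonneg _) f1.1 ?_ f1.2 x hx hh
      · have : 0 < Real.log N := Real.log_pos (by linarith)
        positivity
      · intro y hy1 hy2
        obtain ⟨g1, g2⟩ := div_range (by omega) hy1 hy2
        exact (f2' ((y:ℝ)/N) g1 g2).2 y rfl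
  · intro s hs1 hs2
    rcases lt_or_ge s (N:ℝ) with hh | hh
    · exact Ph_one_lt hs1 hh
    · exact (f2' s hh hs2).1

/-- `F + 1 = (z-1)!` at a row `z`. -/
noncomputable def drv (t : Tb) : ℕ → ℕ → ℕ → Bool :=
  Tb.rec (fun _ _ _ _ => false) (fun z T R l t ih F k v =>
    cond (Nat.beq (Nat.gcd (Nat.succ F) z) 1)
      (and (or (Nat.ble z 28) (rowgood (.cons z T R l t) z l k v))
        (or (Nat.ble 409 z) (and (Nat.beq (Tb.hd t) (Nat.succ z))
          (force (Nat.mul (Nat.succ F) z) fun F' => force (Nat.succ k) fun k' => force (Nat.succ (Nat.sub v (Nat.div v z))) fun v' =>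
            ih F' (Nat.succ k') v'))))
      (and (Nat.ble z 408) (and (Nat.beq (Tb.hd t) (Nat.succ z)) (force (Nat.mul (Nat.succ F) z) fun F' => ih F' k v)))) t

theorem gcd_fac {z : ℕ} (hz : 2 ≤ z) : Nat.gcd (Nat.factorial (z-1)) z = 1 ↔ z.Prime := by
  constructor
  · intro h
    by_contra hp
    have h1 := Nat.minFac_prime (n := z) (by omega)
    have h2 : z.minFac < z := (Nat.not_prime_iff_minFac_lt hz).1 hp
    have h3 : z.minFac ∣ Nat.factorial (z-1) := Nat.dvd_factorial h1.pos (by omega)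
    have := Nat.dvd_gcd h3 (Nat.minFac_dvd z)
    rw [h] at this
    exact h1.one_lt.ne' (Nat.dvd_one.1 this)
  · intro h
    rw [Nat.gcd_comm]
    exact (Nat.coprime_factorial_iff (by omega)).2 (by rw [h.minFac_eq]; omega)

theorem drv_spec (t : Tb) : ∀ F k v, TOK t → 23 ≤ t.hd → t.hd ≤ 409 → Nat.factorial (t.hd - 1) = F + 1 → Leg t.hd k v → drv t F k v = true →
    ∀ N, t.hd ≤ N → 29 ≤ N → N ≤ 409 → N.Prime → FinP N := by
  induction t with
  | nil z =>
    intro F k v _ _ _ _ _ h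
    have h' : false = true := h
    exact Bool.noConfusion h'
  | cons z T R l t ih =>
    intro F k v hok hz23 hz409 hF hleg h
    have h' : cond (Nat.beq (Nat.gcd (Nat.succ F) z) 1)
      (and (or (Nat.ble z 28) (rowgood (.cons z T R l t) z l k v))
        (or (Nat.ble 409 z) (and (Nat.beq (Tb.hd t) (Nat.succ z))
          (force (Nat.mul (Nat.succ F) z) fun F' => force (Nat.succ k) fun k' => force (Nat.succ (Nat.sub v (Nat.div v z))) fun v' =>
            drv t F' (Nat.succ k') v'))))
      (and (Nat.ble z 408) (and (Nat.beq (Tb.hd t) (Nat.succ z)) (force (Nat.mul (Nat.succ F) z) fun F' => drv t F' k v))) = true := h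
    clear h
    have hz23' : 23 ≤ z := hz23
    have hz409' : z ≤ 409 := hz409
    have hF' : Nat.factorial (z - 1) = F + 1 := hF
    have hleg' : Leg z k v := hleg
    have hok' : TOK t := hok.2
    have hg := gcd_fac (z := z) (by omega)
    rw [hF'] at hg
    have hfz : Nat.factorial z = (F + 1) * z := by
      have : z = (z - 1) + 1 := by omega
      rw [this, Nat.factorial_succ, ← this, hF', mul_comm]
    intro N hN1 hN2 hN3 hNp
    have hN1' : z ≤ N := hN1
    cases hb : Nat.beq (Nat.gcd (Nat.succ F) z) 1 with
    | true =>
      rw [hb, cond_true, Bool.and_eq_true, Bool.or_eq_true, Bool.or_eq_true] at h'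
      have hzp : z.Prime := hg.1 (Nat.eq_of_beq_eq_true hb)
      obtain ⟨a, b⟩ := h'
      rcases Nat.lt_or_ge z N with hlt | hge
      · rcases b with b | b
        · have := Nat.le_of_ble_eq_true b; omega
        · rw [Bool.and_eq_true] at b
          obtain ⟨b1, b⟩ := b
          obtain ⟨F', e1, b⟩ := force_spec b
          obtain ⟨k', e2, b⟩ := force_spec b
          obtain ⟨v', e3, b⟩ := force_spec b
          have b1 : t.hd = z + 1 := Nat.eq_of_beq_eq_true b1
          obtain rfl := Nat.succ.inj e2
          obtain rfl := Nat.succ.inj e3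
          refine ih F' _ _ hok' (by omega) (by omega) ?_ ?_ b N (by omega) hN2 hN3 hNp
          · rw [b1, Nat.add_sub_cancel, hfz]; exact e1
          · rw [b1]; exact Leg_prime hzp hleg'
      · obtain rfl : z = N := by omega
        rcases a with a | a
        · have := Nat.le_of_ble_eq_true a; omega
        · exact rowgood_spec hN2 hN3 hok hleg' a
    | false =>
      rw [hb, cond_false, Bool.and_eq_true, Bool.and_eq_true] at h'
      obtain ⟨b0, b1, b⟩ := h'
      obtain ⟨F', e1, b⟩ := force_spec b
      have b0 := Nat.le_of_ble_eq_true b0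
      have b1 : t.hd = z + 1 := Nat.eq_of_beq_eq_true b1
      have hzp : ¬ z.Prime := by
        intro hp
        have := hg.2 hp
        rw [show Nat.gcd (Nat.succ F) z = 1 from this] at hb
        exact Bool.noConfusion hb
      have hne : z ≠ N := fun e => hzp (e ▸ hNp)
      refine ih F' _ _ hok' (by omega) (by omega) ?_ ?_ b N (by omega) hN2 hN3 hNp
      · rw [b1, Nat.add_sub_cancel, hfz]; exact e1
      · rw [b1]; exact Leg_not_prime hzp hleg'

theorem Leg_5 : Leg 5 2 333333333334 := by
  have h := Leg_not_prime (by norm_num) (Leg_prime (by norm_num) Leg_three)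
  norm_num at h
  exact h
theorem Leg_7 : Leg 7 3 266666666668 := by
  have h := Leg_not_prime (by norm_num) (Leg_prime (by norm_num) Leg_5)
  norm_num at h
  exact h
theorem Leg_11 : Leg 11 4 228571428573 := by
  have h := Leg_not_prime (by norm_num) <| Leg_not_prime (by norm_num) <| Leg_not_prime (by norm_num) (Leg_prime (by norm_num) Leg_7)
  norm_num at h
  exact h
theorem Leg_13 : Leg 13 5 207792207794 := by
  have h := Leg_not_prime (by norm_num) (Leg_prime (by norm_num) Leg_11)
  norm_num at h
  exact h
theorem Leg_17 : Leg 17 6 191808191810 := by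
  have h := Leg_not_prime (by norm_num) <| Leg_not_prime (by norm_num) <| Leg_not_prime (by norm_num) (Leg_prime (by norm_num) Leg_13)
  norm_num at h
  exact h
theorem Leg_19 : Leg 19 7 180525356998 := by
  have h := Leg_not_prime (by norm_num) (Leg_prime (by norm_num) Leg_17)
  norm_num at h
  exact h
theorem Leg_23 : Leg 23 8 171024022420 := by
  have h := Leg_not_prime (by norm_num) <| Leg_not_prime (by norm_num) <| Leg_not_prime (by norm_num) (Leg_prime (by norm_num) Leg_19)
  norm_num at h
  exact h

set_option maxRecDepth 100000 in
theorem drv_run : (force (Nat.factorial 22) fun F => drv tbl F 8 171024022420) = true := by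
  decide +kernel

theorem FinP_mid {N : ℕ} (h1 : 29 ≤ N) (h2 : N ≤ 409) (hp : N.Prime) : FinP N := by
  obtain ⟨F, hF, h⟩ := force_spec drv_run
  have hhd : tbl.hd = 23 := rfl
  exact drv_spec tbl F 8 171024022420 tbl_ok (by rw [hhd]) (by rw [hhd]; norm_num) (by rw [hhd]; exact hF) (by rw [hhd]; exact Leg_23) h N (by rw [hhd]; omega) h1 h2 hp

/-! ## The small primes `5 ≤ N ≤ 23` -/
def r1 (P l N2 f : ℕ) : ℕ → ℕ → Bool :=
  Nat.rec (fun _ _ => true) (fun _ ih n c =>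
    and (cond (Nat.ble N2 n) (Nat.ble (Nat.mul (Nat.mul c (Nat.succ l)) 6769016) (Nat.mul 6000000000 n))
        (Nat.ble (Nat.pow n (Nat.mul 10 c)) (Nat.pow 2 (Nat.mul 17 n))))
      (force (Nat.succ (Nat.succ n)) fun n' =>
        cond (Nat.beq (Nat.gcd P n') 1) (force (Nat.succ (Nat.succ c)) fun c' => ih n' c') (ih n' c))) f

theorem Ph_step_le {N n : ℕ} (hN : 2 ≤ N) : Ph N ((n + 1 : ℕ):ℝ) ≤ Ph N (n:ℝ) + (if Nat.gcd (Nat.factorial (N-1)) (n+1) = 1 then 1 else 0) := by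
  have hins : RS N ((n+1:ℕ):ℝ) ⊆ insert (n+1) (RS N (n:ℝ)) := by
    intro m hm
    rw [mem_RS (Nat.cast_nonneg _)] at hm
    rw [Finset.mem_insert, mem_RS (Nat.cast_nonneg _)]
    have h2 : m ≤ n + 1 := by exact_mod_cast hm.2.1
    rcases Nat.lt_or_ge n m with h | h
    · left; omega
    · right; exact ⟨hm.1, by exact_mod_cast h, hm.2.2⟩
  split_ifs with h
  · have := (Finset.card_le_card hins).trans (Finset.card_insert_le _ _)
    unfold Ph
    exact_mod_cast this
  · have : RS N ((n+1:ℕ):ℝ) ⊆ RS N (n:ℝ) := by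
      intro m hm
      rcases Finset.mem_insert.1 (hins hm) with e | e
      · exfalso
        apply h
        rw [mem_RS (Nat.cast_nonneg _), e] at hm
        rw [Nat.gcd_comm]
        rcases Nat.eq_zero_or_pos n with rfl | hn
        · simp
        · refine (Nat.coprime_factorial_iff (by omega)).2 ?_
          have := hm.2.2 _ (Nat.minFac_prime (n := n + 1) (by omega)) (Nat.minFac_dvd _)
          omega
      · exact e
    have := Finset.card_le_card this
    unfold Ph
    rw [add_zero]
    exact_mod_cast this

theorem r1_spec {N l : ℕ} (hN : 2 ≤ N) (f : ℕ) : ∀ n c : ℕ, Ph N (n:ℝ) ≤ c → r1 (Nat.factorial (N-1)) l (N*N) f n c = true →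
    ∀ m, n ≤ m → m < n + f → ∃ d : ℕ, Ph N (m:ℝ) ≤ d ∧ (N * N ≤ m → d * (l + 1) * 6769016 ≤ 6000000000 * m) ∧
      (m < N * N → m^(10 * d) ≤ 2^(17*m)) := by
  induction f with
  | zero => intro n c _ _ m h1 h2; omega
  | succ f ih =>
    intro n c hP h m h1 h2
    have h' : and (cond (Nat.ble (N*N) n) (Nat.ble (Nat.mul (Nat.mul c (Nat.succ l)) 6769016) (Nat.mul 6000000000 n))
        (Nat.ble (Nat.pow n (Nat.mul 10 c)) (Nat.pow 2 (Nat.mul 17 n))))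
      (force (Nat.succ (Nat.succ n)) fun n' =>
        cond (Nat.beq (Nat.gcd (Nat.factorial (N-1)) n') 1) (force (Nat.succ (Nat.succ c)) fun c' => r1 (Nat.factorial (N-1)) l (N*N) f n' c')
          (r1 (Nat.factorial (N-1)) l (N*N) f n' c)) = true := h
    clear h
    rw [Bool.and_eq_true] at h'
    obtain ⟨a, b⟩ := h'
    rcases Nat.eq_or_lt_of_le h1 with e | hlt
    · rw [← e]
      refine ⟨c, hP, fun hh => ?_, fun hh => ?_⟩
      · rw [Nat.ble_eq_true_of_le hh, cond_true] at a
        exact Nat.le_of_ble_eq_true a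
      · have : Nat.ble (N*N) n = false := by
          rw [← Bool.not_eq_true]; intro h3; have := Nat.le_of_ble_eq_true h3; omega
        rw [this, cond_false] at a
        exact Nat.le_of_ble_eq_true a
    · obtain ⟨n', e1, b⟩ := force_spec b
      obtain rfl := Nat.succ.inj e1
      have hst := Ph_step_le (N := N) (n := n) hN
      cases hb : Nat.beq (Nat.gcd (Nat.factorial (N-1)) (Nat.succ n)) 1 with
      | true =>
        rw [hb, cond_true] at b
        obtain ⟨c', e2, b⟩ := force_spec b
        obtain rfl := Nat.succ.inj e2
        rw [if_pos (Nat.eq_of_beq_eq_true hb)] at hst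
        exact ih (n+1) (c+1) (by push_cast at hst ⊢; linarith) b m (by omega) (by omega)
      | false =>
        rw [hb, cond_false] at b
        have hne : ¬ Nat.gcd (Nat.factorial (N-1)) (n+1) = 1 := by
          intro h3
          rw [show Nat.gcd (Nat.factorial (N-1)) (Nat.succ n) = 1 from h3] at hb
          exact Bool.noConfusion hb
        rw [if_neg hne] at hst
        exact ih (n+1) c (by push_cast at hst ⊢; linarith) b m (by omega) (by omega)

theorem log_ratio_mono {z t P c : ℝ} (hz : 3 ≤ z) (ht : z ≤ t) (hP : P ≤ c) (hc0 : 0 ≤ c) (hc : c * Real.log z < 1.2 * z) :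
    P < 1.2 * t / Real.log t := by
  have he := Real.exp_one_lt_d9
  have hlt : 0 < Real.log t := Real.log_pos (by linarith)
  have hm : Real.log t / t ≤ Real.log z / z :=
    Real.log_div_self_antitoneOn (by show Real.exp 1 ≤ _; linarith) (by show Real.exp 1 ≤ _; linarith) ht
  have h2 : c * (Real.log z / z) < 1.2 := by
    rw [← mul_div_assoc, div_lt_iff₀ (by linarith)]; exact hc
  have h3 : c * (Real.log t / t) < 1.2 := lt_of_le_of_lt (by gcongr) h2
  rw [lt_div_iff₀ hlt]
  rw [← mul_div_assoc, div_lt_iff₀ (by linarith)] at h3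
  exact lt_of_le_of_lt (mul_le_mul_of_nonneg_right hP hlt.le) h3

theorem pow_log {m d : ℕ} (hm : 3 ≤ m) (h : m^(10*d) ≤ 2^(17*m)) : (d:ℝ) * Real.log m < 1.2 * m := by
  have hm' : (3:ℝ) ≤ m := by exact_mod_cast hm
  have h' : ((m:ℝ)^(10*d)) ≤ 2^(17*m) := by exact_mod_cast h
  have := Real.log_le_log (by positivity) h'
  rw [Real.log_pow, Real.log_pow] at this
  push_cast at this
  have := Real.log_two_lt_d9
  nlinarith

theorem FinP_small {N l k v c : ℕ} (hN : 5 ≤ N) (hN2 : N * N ≤ 4096) (hleg : Leg N k v)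
    (hl : N^1024 ≤ 2^(l+1)) (hl' : 2^l ≤ N^1024) (hlb : (16384 * v + 2^k * 1000000000000) * ((l + 1) * 6769016) ≤ 98304000000000000000000000)
    (hr : r1 (Nat.factorial (N-1)) l (N*N) 4087 9 c = true) (hc : Ph N 9 ≤ c) : FinP N := by
  have hL : Real.log N ≤ (l+1) * uu := by
    have := (log_pow_bounds (z := N) (M := 1024) (by omega) (by norm_num) hl' hl).2
    unfold uu
    exact_mod_cast this
  clear hl hl'
  have hu := uu_hi
  have hL2 : Real.log N ≤ (l + 1) * 0.0006769016 := hL.trans (by gcongr)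
  have hN' : (5:ℝ) ≤ N := by exact_mod_cast hN
  have hlN : 0 < Real.log N := Real.log_pos (by linarith)
  have hs := r1_spec (N := N) (l := l) (by omega) 4087 9 c (by exact_mod_cast hc) hr
  clear hr
  constructor
  · intro x hx
    rcases Nat.lt_or_ge x 4096 with hlt | hge
    · obtain ⟨d, d1, d2, _⟩ := hs x (by nlinarith) (by omega)
      have d3 := d2 (by rw [← pow_two]; exact hx)
      have d3' : (d * (l + 1) * 6769016 : ℝ) ≤ 6000000000 * x := by exact_mod_cast d3
      refine d1.trans ?_
      have : 0.6 / Real.log N * x = 0.6 * x / Real.log N := by ring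
      rw [this, le_div_iff₀ hlN]
      calc (d:ℝ) * Real.log N ≤ d * ((l + 1) * 0.0006769016) := by gcongr
        _ ≤ _ := by linarith
    · have hx' : (4096:ℝ) ≤ x := by exact_mod_cast hge
      apply Leg_bound hleg (Nat.cast_nonneg _)
      have hlb' : ((16384 * v + 2^k * 1000000000000) * ((l + 1) * 6769016) : ℝ) ≤ 98304000000000000000000000 := by exact_mod_cast hlb
      have h2 : (v / 10^12 + 2^k/16384 : ℝ) ≤ 0.6 / Real.log N := by
        rw [le_div_iff₀ hlN]
        calc (v / 10^12 + 2^k/16384 : ℝ) * Real.log N ≤ (v / 10^12 + 2^k/16384 : ℝ) * ((l + 1) * 0.0006769016) := by gcongr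
          _ ≤ 0.6 := by linarith
      have h3 : (2:ℝ)^k / 4 ≤ 2^k/16384 * x := by
        have : (2:ℝ)^k / 4 = 2^k/16384 * 4096 := by ring
        rw [this]; gcongr
      calc (v:ℝ) / 10^12 * x + 2^k/4 ≤ (v / 10^12 + 2^k/16384 : ℝ) * x := by linarith
        _ ≤ _ := by gcongr
  · intro t h9 ht
    have hf9 : 9 ≤ ⌊t⌋₊ := Nat.le_floor (by exact_mod_cast h9)
    have hft := Nat.floor_le (a := t) (by linarith)
    have hfl : ⌊t⌋₊ < N * N := by
      rw [Nat.floor_lt (by linarith)]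
      push_cast
      nlinarith
    obtain ⟨d, d1, _, d2⟩ := hs ⌊t⌋₊ hf9 (by omega)
    rw [Ph_floor]
    have h9' : (9:ℝ) ≤ ⌊t⌋₊ := by exact_mod_cast hf9
    exact log_ratio_mono (by linarith) hft d1 (Nat.cast_nonneg _) (pow_log (by omega) (d2 hfl))

theorem Ph9 {N : ℕ} (h : 7 ≤ N) : Ph N 9 ≤ (2:ℕ) := by
  have : RS N 9 ⊆ {1, 7} := by
    intro m hm
    rw [mem_RS (by norm_num)] at hm
    have h9 : m ≤ 9 := by exact_mod_cast hm.2.1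
    simp only [Finset.mem_insert, Finset.mem_singleton]
    rcases Nat.lt_or_ge 1 m with h1 | h1
    · have := hm.2.2 _ (Nat.minFac_prime (n := m) (by omega)) (Nat.minFac_dvd _)
      have h2 := Nat.minFac_le (n := m) (by omega)
      have h3 := Nat.minFac_dvd m
      obtain ⟨q, hq⟩ := h3
      have : m.minFac = m := by
        have : q = 1 := by
          rcases Nat.lt_or_ge q 2 with h4 | h4
          · rcases Nat.eq_zero_or_pos q with rfl | h5
            · omega
            · omega
          · nlinarith
        rw [this] at hq; omega
      have hp := Nat.minFac_prime (n := m) (by omega)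
      rw [this] at hp
      right
      interval_cases m <;> first | omega | (exfalso; revert hp; norm_num)
    · left; omega
  have := Finset.card_le_card this
  unfold Ph
  exact_mod_cast this

theorem Ph9' : Ph 5 9 ≤ (3:ℕ) := by
  have e : Ph 7 9 = Ph 5 9 - Ph 5 (9 / (5:ℕ)) := by
    have a : Ph 7 9 = Ph 6 9 := Ph_succ_of_not_prime (N := 6) (by norm_num) 9
    have b : Ph 6 9 = Ph 5 9 - Ph 5 (9 / (5:ℕ)) := Ph_succ_of_prime (N := 5) (by norm_num) (by norm_num)
    rw [a, b]
  have h1 := Ph9 (N := 7) le_rfl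
  have h2 := Ph_one (N := 5) (t := 9 / (5:ℕ)) (by norm_num) (by norm_num)
  push_cast at *
  linarith

set_option maxRecDepth 100000 in
theorem FinP_5 : FinP 5 :=
  FinP_small (l := 2377) (c := 3) (by norm_num) (by norm_num) Leg_5 (by decide +kernel) (by decide +kernel) (by norm_num) (by decide +kernel) Ph9'
set_option maxRecDepth 100000 in
theorem FinP_7 : FinP 7 :=
  FinP_small (l := 2874) (c := 2) (by norm_num) (by norm_num) Leg_7 (by decide +kernel) (by decide +kernel) (by norm_num) (by decide +kernel) (Ph9 (by norm_num))
set_option maxRecDepth 100000 in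
theorem FinP_11 : FinP 11 :=
  FinP_small (l := 3542) (c := 2) (by norm_num) (by norm_num) Leg_11 (by decide +kernel) (by decide +kernel) (by norm_num) (by decide +kernel) (Ph9 (by norm_num))
set_option maxRecDepth 100000 in
theorem FinP_13 : FinP 13 :=
  FinP_small (l := 3789) (c := 2) (by norm_num) (by norm_num) Leg_13 (by decide +kernel) (by decide +kernel) (by norm_num) (by decide +kernel) (Ph9 (by norm_num))
set_option maxRecDepth 100000 in
theorem FinP_17 : FinP 17 :=
  FinP_small (l := 4185) (c := 2) (by norm_num) (by norm_num) Leg_17 (by decide +kernel) (by decide +kernel) (by norm_num) (by decide +kernel) (Ph9 (by norm_num))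
set_option maxRecDepth 100000 in
theorem FinP_19 : FinP 19 :=
  FinP_small (l := 4349) (c := 2) (by norm_num) (by norm_num) Leg_19 (by decide +kernel) (by decide +kernel) (by norm_num) (by decide +kernel) (Ph9 (by norm_num))
set_option maxRecDepth 100000 in
theorem FinP_23 : FinP 23 :=
  FinP_small (l := 4632) (c := 2) (by norm_num) (by norm_num) Leg_23 (by decide +kernel) (by decide +kernel) (by norm_num) (by decide +kernel) (Ph9 (by norm_num))

theorem FinP_all {N : ℕ} (h1 : 4 ≤ N) (h2 : N ≤ 409) (hp : N.Prime) : FinP N := by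
  rcases Nat.lt_or_ge N 29 with h | h
  · interval_cases N
    all_goals first
      | exact FinP_5
      | exact FinP_7
      | exact FinP_11
      | exact FinP_13
      | exact FinP_17
      | exact FinP_19
      | exact FinP_23
      | (exfalso; revert hp; norm_num)
  · exact FinP_mid h h2 hp

open Finset
open scoped Classical

theorem Phi_eq_Ph {x y : ℝ} {N : ℕ} (h : ∀ p : ℕ, p.Prime → (y < (p:ℝ) ↔ N ≤ p)) : (Phi x y : ℝ) = Ph N x := by
  unfold Phi Ph RS
  congr 2
  ext n
  simp only [Finset.mem_filter, Rgh]
  refine and_congr_right fun _ => ?_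
  exact ⟨fun hh p hp hd => (h p hp).1 (hh p hp hd), fun hh p hp hd => (h p hp).2 (hh p hp hd)⟩

theorem final_step {x y : ℝ} {N : ℕ} (hy : 3 ≤ y) (hyx : y^2 ≤ x) (hyN : y < N)
    (h1 : ∀ n : ℕ, N^2 ≤ n → Ph N n ≤ 0.6 / Real.log N * n)
    (h2 : x < (N:ℝ)^2 → Ph N x < 1.2 * x / Real.log x) : Ph N x < 0.6 * x / Real.log y := by
  have hly : 0 < Real.log y := Real.log_pos (by linarith)
  have hx0 : 9 ≤ x := by nlinarith
  have hlN : Real.log y < Real.log N := Real.log_lt_log (by linarith) hyN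
  rcases lt_or_ge x ((N:ℝ)^2) with h | h
  · have hlx : 2 * Real.log y ≤ Real.log x := by
      have := Real.log_le_log (by positivity) hyx
      rwa [Real.log_pow, Nat.cast_ofNat] at this
    refine lt_of_lt_of_le (h2 h) ?_
    have : 0.6 * x / Real.log y = 1.2 * x / (2 * Real.log y) := by
      field_simp; norm_num
    rw [this]
    gcongr
  · have hN : N^2 ≤ ⌊x⌋₊ := Nat.le_floor (by push_cast; exact h)
    have := h1 _ hN
    rw [Ph_floor]
    have hfl := Nat.floor_le (a := x) (by linarith)
    calc Ph N (⌊x⌋₊ : ℕ) ≤ 0.6 / Real.log N * (⌊x⌋₊ : ℕ) := this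
      _ ≤ 0.6 / Real.log N * x := by
        have : 0 < Real.log N := by linarith
        gcongr
      _ = 0.6 * x / Real.log N := by ring
      _ < _ := by gcongr

theorem phi_lt_point_six (x y : ℝ) (hy : 3 ≤ y) (hyx : y ≤ Real.sqrt x) :
    (Phi x y : ℝ) < 0.6 * x / Real.log y := by
  have hx : y^2 ≤ x := by
    have := Real.le_sqrt' (x := y) (y := x) (by linarith)
    exact this.1 hyx
  have hfl := Nat.floor_le (a := y) (by linarith)
  have hfl2 := Nat.lt_floor_add_one y
  have hx9 : 9 ≤ x := by nlinarith
  rcases lt_or_ge y 409 with h | h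
  · have hex : ∃ p : ℕ, p.Prime ∧ y < (p:ℝ) := ⟨409, by norm_num, by exact_mod_cast h⟩
    obtain ⟨hp, hyp⟩ := Nat.find_spec hex
    have hmin : ∀ p : ℕ, p.Prime → (y < (p:ℝ) ↔ Nat.find hex ≤ p) := by
      intro p hp'
      constructor
      · intro hh; exact Nat.find_min' hex ⟨hp', hh⟩
      · intro hh; exact lt_of_lt_of_le hyp (by exact_mod_cast hh)
    rw [Phi_eq_Ph hmin]
    have hle : Nat.find hex ≤ 409 := Nat.find_min' hex ⟨by norm_num, by exact_mod_cast h⟩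
    have h4 : 4 ≤ Nat.find hex := by
      have : (3:ℝ) < (Nat.find hex : ℕ) := lt_of_le_of_lt hy hyp
      exact_mod_cast this
    obtain ⟨f1, f2⟩ := FinP_all h4 hle hp
    exact final_step hy hx hyp f1 (f2 x hx9)
  · have hN : 410 ≤ ⌊y⌋₊ + 1 := by
      have : 409 ≤ ⌊y⌋₊ := Nat.le_floor (by exact_mod_cast h)
      omega
    have hiff : ∀ p : ℕ, p.Prime → (y < (p:ℝ) ↔ ⌊y⌋₊ + 1 ≤ p) := by
      intro p _
      rw [Nat.succ_le_iff, Nat.floor_lt (by linarith)]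
    rw [Phi_eq_Ph hiff]
    refine final_step hy hx (by push_cast; exact hfl2) (large_case hN) (fun hlt => pi_large hN ?_ hlt)
    push_cast
    rw [add_sub_cancel_right]
    exact le_trans (pow_le_pow_left₀ (Nat.cast_nonneg _) hfl 2) hx
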